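/- arXiv:2511.12505 — 4 statements merged into one kernel-verified Lean document; each statement's English description precedes it below -/
import Mathlib

section
/- For all integers n ≥ k ≥ 3, the star-anti-Ramsey number of the cycle C_k satisfies ar*(n, C_k) = n + C(k-2, 2) - 1, where C(k-2,2) denotes the binomial coefficient (k-2 choose 2). -/
open SimpleGraph

/-- An edge-colouring of the complete graph on `α` (only values on
non-diagonal pairs are relevant). -/
abbrev EdgeColouring (α : Type*) := Sym2 α → ℕ

/-- A star-colouring: every colour class is a star, i.e. any two edges of the
same colour share a vertex, and no colour class contains a triangle. -/
def IsStarColouring {α : Type*} (c : EdgeColouring α) : Prop :=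
  (∀ a b x y : α, a ≠ b → x ≠ y → c s(a, b) = c s(x, y) →
      a = x ∨ a = y ∨ b = x ∨ b = y) ∧
  ∀ a b d : α, a ≠ b → b ≠ d → a ≠ d →
      ¬(c s(a, b) = c s(b, d) ∧ c s(b, d) = c s(a, d))

/-- The number of colours used on the edges of the complete graph on `α`. -/
noncomputable def colourCount {α : Type*} (c : EdgeColouring α) : ℕ :=
  (c '' {e : Sym2 α | ¬ e.IsDiag}).ncard

/-- The colouring `c` of the complete graph on `α` contains a rainbow copy of
the graph `H`: there is an injection of `V(H)` such that distinct edges of `H`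
receive distinct colours. -/
def HasRainbowCopy {α β : Type*} (c : EdgeColouring α) (H : SimpleGraph β) : Prop :=
  ∃ f : β ↪ α, ∀ u v x y : β, H.Adj u v → H.Adj x y → s(u, v) ≠ s(x, y) →
    c s(f u, f v) ≠ c s(f x, f y)

/-- The star-anti-Ramsey number `ar*(n, H)`: the maximum number of colours in a
star-colouring of `K_n` with no rainbow copy of `H`. -/
noncomputable def starAntiRamsey (n : ℕ) {β : Type*} (H : SimpleGraph β) : ℕ :=
  sSup {s | ∃ c : EdgeColouring (Fin n), IsStarColouring c ∧ colourCount c = s ∧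
    ¬ HasRainbowCopy c H}

/-- The lexical colouring of `K_n`: the edge `{i, j}` with `i < j` gets colour `i`. -/
def lexColouring (n : ℕ) : EdgeColouring (Fin n) :=
  Sym2.lift ⟨fun i j => min i.1 j.1, fun i j => by simp [min_comm]⟩

/-- `c` is a lexical colouring with respect to some ordering of the vertices. -/
def IsLexical {n : ℕ} (c : EdgeColouring (Fin n)) : Prop :=
  ∃ v : Fin n ≃ Fin n, ∀ i j i' j' : Fin n, i < j → i' < j' →
    (c s(v i, v j) = c s(v i', v j') ↔ i = i')

/-- `v` is a centre of the colour class of colour `m`: the class is nonempty and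
every edge of colour `m` is incident to `v` (for star-colourings this is exactly
a vertex of maximum degree in the class). -/
def IsCentre {α : Type*} (c : EdgeColouring α) (v : α) (m : ℕ) : Prop :=
  (∃ e : Sym2 α, ¬ e.IsDiag ∧ c e = m ∧ v ∈ e) ∧
  ∀ e : Sym2 α, ¬ e.IsDiag → c e = m → v ∈ e

/-- `G` contains a copy of `F` as a subgraph. -/
def ContainsCopy {α β : Type*} (F : SimpleGraph α) (G : SimpleGraph β) : Prop :=
  ∃ f : α ↪ β, ∀ u v, F.Adj u v → G.Adj (f u) (f v)

/-- The extremal (Turán) number `ex(n, F)`. -/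
noncomputable def extremalNumber (n : ℕ) {α : Type*} (F : SimpleGraph α) : ℕ :=
  sSup {m | ∃ G : SimpleGraph (Fin n), ¬ ContainsCopy F G ∧ G.edgeSet.ncard = m}

/-- The join of two graphs: vertex-disjoint copies of `G` and `H` together with
all edges between them. -/
def graphJoin {α β : Type*} (G : SimpleGraph α) (H : SimpleGraph β) :
    SimpleGraph (α ⊕ β) :=
  SimpleGraph.fromRel (fun x y => match x, y with
    | Sum.inl a, Sum.inl b => G.Adj a b
    | Sum.inr a, Sum.inr b => H.Adj a b
    | Sum.inl _, Sum.inr _ => True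
    | Sum.inr _, Sum.inl _ => False)

/-- The complete bipartite graph `K_{s,t}` minus one edge. -/
def Kstminus (s t : ℕ) (hs : 0 < s) (ht : 0 < t) : SimpleGraph (Fin s ⊕ Fin t) :=
  (completeBipartiteGraph (Fin s) (Fin t)).deleteEdges
    {s(Sum.inl ⟨0, hs⟩, Sum.inr ⟨0, ht⟩)}

/-- The edge from `v` to `w` has a colour all of whose edges contain `v`. -/
def Dominates {α : Type*} (c : EdgeColouring α) (v w : α) : Prop :=
  v = w ∨ ∀ e : Sym2 α, ¬ e.IsDiag → c e = c s(v, w) → v ∈ e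

/-- The colours of the consecutive edges of the path with the given vertices. -/
def pathColours {α : Type*} (c : EdgeColouring α) : List α → List ℕ
  | [] => []
  | [_] => []
  | a :: b :: l => c s(a, b) :: pathColours c (b :: l)

/-- The closed list `a, l, a` is a rainbow cycle. -/
def IsRainbowCycle {α : Type*} (c : EdgeColouring α) (a : α) (l : List α) : Prop :=
  (a :: l).Nodup ∧ (pathColours c (a :: l ++ [a])).Nodup

/-- The closed list `a, l, a` is a directed cycle for the relation `Dominates c`. -/
def IsDirectedCycle {α : Type*} (c : EdgeColouring α) (a : α) (l : List α) : Prop :=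
  (a :: l).Nodup ∧ (a :: l ++ [a]).IsChain (Dominates c)

section Paths

variable {α : Type*} {c : EdgeColouring α}

theorem dominates_or_dominates (hc : IsStarColouring c) (v w : α) :
    Dominates c v w ∨ Dominates c w v := by
  by_contra! h
  obtain ⟨h₁, h₂⟩ := h
  simp only [Dominates, not_or, not_forall] at h₁ h₂
  obtain ⟨hvw, e, he, hce, hve⟩ := h₁
  obtain ⟨-, e', he', hce', hwe'⟩ := h₂
  induction e with | _ a b => ?_
  induction e' with | _ x y => ?_
  simp only [Sym2.mk_isDiag_iff, Sym2.mem_iff, not_or] at he he' hve hwe'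
  have h1 := hc.1 a b v w he hvw hce
  have h2 := hc.1 x y w v he' (Ne.symm hvw) hce'
  have h3 := hc.1 a b x y he he' (by rw [hce, hce', Sym2.eq_swap])
  have key : ∀ z, z ≠ v → z ≠ w → c s(w, z) = c s(v, w) → c s(v, z) = c s(v, w) → False := by
    intro z hzv hzw hwz hvz
    exact hc.2 v w z hvw (Ne.symm hzw) (Ne.symm hzv) ⟨hwz.symm, hwz.trans hvz.symm⟩
  have e1 : c s(w, v) = c s(v, w) := by rw [Sym2.eq_swap]
  have e2 : c s(b, a) = c s(a, b) := by rw [Sym2.eq_swap]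
  have e3 : c s(y, x) = c s(x, y) := by rw [Sym2.eq_swap]
  grind

theorem Dominates.colour_ne {v w a b : α} (h : Dominates c v w) (hvw : v ≠ w) (hab : a ≠ b)
    (ha : v ≠ a) (hb : v ≠ b) : c s(v, w) ≠ c s(a, b) := by
  intro he
  have := (h.resolve_left hvw) s(a, b) (by simpa using hab) he.symm
  simp [ha, hb] at this

theorem pathColours_append_cons (l₁ l₂ : List α) (a : α) :
    pathColours c (l₁ ++ a :: l₂) = pathColours c (l₁ ++ [a]) ++ pathColours c (a :: l₂) := by
  induction l₁ with
  | nil => simp [pathColours]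
  | cons x l ih => cases l <;> simp_all [pathColours]

theorem pathColours_reverse (l : List α) :
    pathColours c l.reverse = (pathColours c l).reverse := by
  induction l with
  | nil => simp [pathColours]
  | cons x l ih =>
    cases l with
    | nil => simp [pathColours]
    | cons y l =>
      rw [List.reverse_cons] at ih
      rw [List.reverse_cons, List.reverse_cons, List.append_assoc, List.singleton_append,
        pathColours_append_cons, ih]
      simp [pathColours, Sym2.eq_swap]

theorem exists_of_mem_pathColours {m : ℕ} {l : List α} (hl : l.Nodup)
    (hm : m ∈ pathColours c l) : ∃ a ∈ l, ∃ b ∈ l, a ≠ b ∧ c s(a, b) = m := by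
  induction l with
  | nil => simp [pathColours] at hm
  | cons x l ih =>
    cases l with
    | nil => simp [pathColours] at hm
    | cons y l =>
      rcases List.mem_cons.1 hm with h | h
      · exact ⟨x, by simp, y, by simp, by grind, h.symm⟩
      · obtain ⟨a, ha, b, hb, hab⟩ := ih hl.of_cons h
        exact ⟨a, List.mem_cons_of_mem _ ha, b, List.mem_cons_of_mem _ hb, hab⟩

theorem Dominates.notMem_pathColours {v w : α} {l : List α} (h : Dominates c v w) (hvw : v ≠ w)
    (hl : l.Nodup) (hv : v ∉ l) : c s(v, w) ∉ pathColours c l := by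
  intro hm
  obtain ⟨a, ha, b, hb, hab, he⟩ := exists_of_mem_pathColours hl hm
  exact h.colour_ne hvw hab (by grind) (by grind) he.symm

theorem nodup_pathColours_append {P Y : List α} {y : α} (hn : (P ++ y :: Y).Nodup)
    (hP : (P ++ [y]).IsChain (Dominates c)) (hY : (pathColours c (y :: Y)).Nodup) :
    (pathColours c (P ++ y :: Y)).Nodup := by
  induction P with
  | nil => simpa
  | cons x P ih =>
    have ih := ih (by grind) (by simpa using hP.tail)
    cases P with
    | nil =>
      simp only [List.cons_append, List.nil_append, pathColours, List.nodup_cons,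
        List.isChain_cons_cons] at *
      exact ⟨hP.1.notMem_pathColours (by grind) (by grind) (by grind), hY⟩
    | cons z P =>
      simp only [List.cons_append, pathColours, List.nodup_cons,
        List.isChain_cons_cons] at hP hn ih ⊢
      exact ⟨hP.1.notMem_pathColours (by grind) (by grind) (by grind), ih⟩

theorem isRainbowCycle_of_path {x h t : α} {Z : List α} (hn : (x :: Z).Nodup)
    (hZ : (pathColours c Z).Nodup) (hh : Z.head? = some h) (ht : Z.getLast? = some t)
    (hxh : Dominates c x h) (hxt : Dominates c x t) (hne : c s(x, h) ≠ c s(x, t)) :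
    IsRainbowCycle c x Z := by
  refine ⟨hn, ?_⟩
  obtain ⟨Z₁, rfl⟩ := List.head?_eq_some_iff.1 hh
  obtain ⟨Z₂, hZ₂⟩ := List.getLast?_eq_some_iff.1 ht
  have hsplit : pathColours c (x :: h :: Z₁ ++ [x]) =
      c s(x, h) :: (pathColours c (h :: Z₁) ++ [c s(t, x)]) := by
    rw [hZ₂, List.cons_append, List.append_assoc, List.singleton_append]
    rw [show x :: (Z₂ ++ [t, x]) = (x :: Z₂) ++ t :: [x] by simp, pathColours_append_cons,
      List.cons_append, ← hZ₂]
    simp [pathColours]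
  have hxZ : x ∉ h :: Z₁ := (List.nodup_cons.1 hn).1
  have hZn := (List.nodup_cons.1 hn).2
  have htm : t ∈ h :: Z₁ := by rw [hZ₂]; simp
  have h1 := hxh.notMem_pathColours (by grind) hZn hxZ
  have h2 := hxt.notMem_pathColours (by grind) hZn hxZ
  rw [hsplit, show s(t, x) = s(x, t) from Sym2.eq_swap]
  simp only [List.nodup_cons, List.mem_append, List.mem_singleton, List.nodup_append]
  grind

theorem isRainbowCycle_of_fork {x y t : α} {P Q Y : List α}
    (hn : (x :: (P ++ Y ++ Q.reverse)).Nodup)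
    (hy : Y.head? = some y) (ht : Y.getLast? = some t) (hY : (pathColours c Y).Nodup)
    (hP : (x :: P ++ [y]).IsChain (Dominates c)) (hQ : (x :: Q ++ [t]).IsChain (Dominates c))
    (hne : ∀ p q, (P ++ [y]).head? = some p → (Q ++ [t]).head? = some q →
      c s(x, p) ≠ c s(x, q)) :
    IsRainbowCycle c x (P ++ Y ++ Q.reverse) := by
  have h1 : (pathColours c (P ++ Y)).Nodup := by
    obtain ⟨Y₁, rfl⟩ := List.head?_eq_some_iff.1 hy
    exact nodup_pathColours_append (by grind) hP.tail hY
  have h2 : (pathColours c (P ++ Y ++ Q.reverse)).Nodup := by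
    obtain ⟨Y₂, rfl⟩ := List.getLast?_eq_some_iff.1 ht
    have : P ++ (Y₂ ++ [t]) ++ Q.reverse = (Q ++ t :: (P ++ Y₂).reverse).reverse := by simp
    rw [this, pathColours_reverse, List.nodup_reverse]
    apply nodup_pathColours_append
    · rw [← List.nodup_reverse, ← this]; exact hn.of_cons
    · exact hQ.tail
    · have : t :: (P ++ Y₂).reverse = (P ++ (Y₂ ++ [t])).reverse := by simp
      rw [this, pathColours_reverse, List.nodup_reverse]
      exact h1
  obtain ⟨p, hp⟩ : ∃ p, (P ++ [y]).head? = some p := by cases P <;> simp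
  obtain ⟨q, hq⟩ : ∃ q, (Q ++ [t]).head? = some q := by cases Q <;> simp
  refine isRainbowCycle_of_path (h := p) (t := q) hn h2 ?_ ?_ ?_ ?_ (hne p q hp hq)
  · rw [← hp]; cases P <;> simp [hy]
  · rw [← hq]; cases Q <;> simp [ht]
  · cases P <;> simp_all
  · cases Q <;> simp_all

theorem IsDirectedCycle.isRainbowCycle {x : α} {l : List α} (h : IsDirectedCycle c x l)
    (hl : 2 ≤ l.length) : IsRainbowCycle c x l := by
  obtain ⟨hn, hd⟩ := h
  refine ⟨hn, ?_⟩
  match l, hl with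
  | b :: z :: l, _ =>
    obtain ⟨l', t, hlt⟩ : ∃ l' t, z :: l = l' ++ [t] :=
      ⟨(z :: l).dropLast, (z :: l).getLast (by simp), (List.dropLast_append_getLast _).symm⟩
    rw [hlt] at hn hd ⊢
    have h1 : (pathColours c (b :: l' ++ t :: [x])).Nodup := by
      have := nodup_pathColours_append (c := c) (P := b :: l' ++ [t]) (y := x) (Y := [])
        (by grind) (by simpa using hd.tail) (by simp [pathColours])
      simpa using this
    rw [show x :: b :: (l' ++ [t]) ++ [x] = x :: b :: (l' ++ [t, x]) by simp] at hd ⊢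
    rw [pathColours, List.nodup_cons]
    refine ⟨?_, by simpa using h1⟩
    rw [← List.cons_append, pathColours_append_cons]
    simp only [pathColours, List.mem_append, List.mem_singleton, not_or]
    rw [List.isChain_cons_cons] at hd
    refine ⟨hd.1.notMem_pathColours (by grind) (by grind) (by grind), ?_⟩
    have htx : Dominates c t x := by
      have h3 := hd.2
      rw [← List.cons_append] at h3
      have := (List.isChain_append.1 h3).2.1
      simpa using this
    exact (htx.colour_ne (by grind) (by grind) (by grind) (by grind)).symm

theorem IsRainbowCycle.rotate {x y : α} {l₁ l₂ : List α}
    (h : IsRainbowCycle c x (l₁ ++ y :: l₂)) : IsRainbowCycle c y (l₂ ++ x :: l₁) := by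
  refine ⟨by have := h.1; grind, ?_⟩
  have h2 := h.2
  rw [show x :: (l₁ ++ y :: l₂) ++ [x] = (x :: l₁) ++ y :: (l₂ ++ [x]) by simp,
    pathColours_append_cons, List.nodup_append_comm] at h2
  rw [show y :: (l₂ ++ x :: l₁) ++ [y] = (y :: l₂) ++ x :: (l₁ ++ [y]) by simp,
    pathColours_append_cons]
  simpa using h2

theorem IsRainbowCycle.nodup_pathColours {x : α} {l : List α} (h : IsRainbowCycle c x l) :
    (pathColours c (x :: l)).Nodup := by
  obtain ⟨l', t, hlt⟩ : ∃ l' t, x :: l = l' ++ [t] :=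
    ⟨(x :: l).dropLast, (x :: l).getLast (by simp), (List.dropLast_append_getLast _).symm⟩
  have h2 := h.2
  rw [hlt, List.append_assoc, List.singleton_append, pathColours_append_cons] at h2
  rw [hlt]
  exact h2.of_append_left

theorem nodup_pathColours_take {l : List α} (h : (pathColours c l).Nodup) (j : ℕ) :
    (pathColours c (l.take j)).Nodup := by
  rcases hd : l.drop j with _ | ⟨y, t⟩
  · rw [List.take_of_length_le (by simpa using hd)]; exact h
  · rcases List.eq_nil_or_concat (l.take j) with h0 | ⟨l', z, h0⟩
    · rw [h0]; simp [pathColours]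
    · have := List.take_append_drop j l
      rw [hd, h0, List.concat_eq_append, List.append_assoc, List.singleton_append] at this
      rw [← this, pathColours_append_cons] at h
      rw [h0, List.concat_eq_append]
      exact h.of_append_left

end Paths

section Cycles

variable {α : Type*} {c : EdgeColouring α}

theorem exists_isChain_insert (hc : IsStarColouring c) {u v z : α} {l : List α}
    (h : (u :: l ++ [z]).IsChain (Dominates c)) (huv : Dominates c u v) (hvz : Dominates c v z) :
    ∃ s₁ s₂, l = s₁ ++ s₂ ∧ (u :: s₁ ++ v :: s₂ ++ [z]).IsChain (Dominates c) := by
  induction l generalizing u with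
  | nil => exact ⟨[], [], rfl, by simp [huv, hvz]⟩
  | cons b l ih =>
    simp only [List.cons_append, List.isChain_cons_cons] at h
    rcases dominates_or_dominates hc v b with hb | hb
    · exact ⟨[], b :: l, rfl, by simpa [huv, hb] using h.2⟩
    · obtain ⟨s₁, s₂, rfl, hs⟩ := ih h.2 hb
      exact ⟨b :: s₁, s₂, rfl, by simpa [h.1] using hs⟩

theorem IsDirectedCycle.exists_rotate {x u : α} {l : List α} (h : IsDirectedCycle c x l)
    (hu : u ∈ x :: l) : ∃ l', IsDirectedCycle c u l' ∧ (u :: l').Perm (x :: l) := by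
  rcases List.mem_cons.1 hu with rfl | hu
  · exact ⟨l, h, .refl _⟩
  obtain ⟨l₁, l₂, rfl⟩ := List.append_of_mem hu
  have hp : (u :: (l₂ ++ x :: l₁)).Perm (x :: (l₁ ++ u :: l₂)) :=
    List.perm_append_comm (l₁ := u :: l₂) (l₂ := x :: l₁)
  refine ⟨l₂ ++ x :: l₁, ⟨hp.nodup_iff.2 h.1, ?_⟩, hp⟩
  have h2 := h.2
  rw [show x :: (l₁ ++ u :: l₂) ++ [x] = (x :: l₁) ++ u :: (l₂ ++ [x]) by simp,
    List.isChain_split] at h2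
  rw [show u :: (l₂ ++ x :: l₁) ++ [u] = (u :: l₂) ++ x :: (l₁ ++ [u]) by simp,
    List.isChain_split]
  exact ⟨by simpa using h2.2, by simpa using h2.1⟩

theorem IsRainbowCycle.exists_rotate {x u : α} {l : List α} (h : IsRainbowCycle c x l)
    (hu : u ∈ x :: l) : ∃ l', IsRainbowCycle c u l' ∧ (u :: l').Perm (x :: l) := by
  rcases List.mem_cons.1 hu with rfl | hu
  · exact ⟨l, h, .refl _⟩
  obtain ⟨l₁, l₂, rfl⟩ := List.append_of_mem hu
  exact ⟨l₂ ++ x :: l₁, h.rotate, List.perm_append_comm (l₁ := u :: l₂) (l₂ := x :: l₁)⟩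

theorem exists_consecutive_ne {β : Type*} (f : α → β) {p q : α} {l : List α} (hq : q ∈ l)
    (hpq : f p ≠ f q) : ∃ s₁ a b s₂, p :: l = s₁ ++ a :: b :: s₂ ∧ f a ≠ f b := by
  induction l generalizing p with
  | nil => simp at hq
  | cons z l ih =>
    by_cases hz : f p = f z
    · have hq' : q ∈ l := by grind
      obtain ⟨s₁, a, b, s₂, h, hab⟩ := ih hq' (hz ▸ hpq)
      exact ⟨p :: s₁, a, b, s₂, by simp [h], hab⟩
    · exact ⟨[], p, z, l, rfl, hz⟩

theorem IsRainbowCycle.exists_rotate_ne {β : Type*} (f : α → β) {x p q : α} {l : List α}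
    (h : IsRainbowCycle c x l) (hp : p ∈ x :: l) (hq : q ∈ x :: l) (hpq : f p ≠ f q) :
    ∃ y l' t, IsRainbowCycle c y l' ∧ (y :: l').Perm (x :: l) ∧ (y :: l').getLast? = some t ∧
      f y ≠ f t := by
  obtain ⟨l₁, h₁, hperm⟩ := h.exists_rotate hp
  have hq₁ : q ∈ l₁ := by
    have := hperm.mem_iff.2 hq
    grind
  obtain ⟨s₁, a, b, s₂, hs, hab⟩ := exists_consecutive_ne f hq₁ hpq
  have hb : ∃ r, l₁ = r ++ b :: s₂ ∧ (p :: r).getLast? = some a := by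
    cases s₁ with
    | nil => exact ⟨[], by simp_all, by simp_all⟩
    | cons z s₁ => exact ⟨s₁ ++ [a], by simp_all, by simp [List.getLast?_cons]⟩
  obtain ⟨r, rfl, hr⟩ := hb
  refine ⟨b, s₂ ++ p :: r, a, h₁.rotate,
    (List.perm_append_comm (l₁ := b :: s₂) (l₂ := p :: r)).trans hperm, ?_, hab.symm⟩
  rw [← List.cons_append, List.getLast?_append_of_ne_nil _ (by simp), hr]

/-- In a strongly connected set, a directed cycle that misses some vertex can be lengthened. -/
theorem IsDirectedCycle.exists_longer (hc : IsStarColouring c) {S : Finset α}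
    (hS : ∀ X ⊆ S, X.Nonempty → X ≠ S → ∃ x ∈ X, ∃ y ∈ S, y ∉ X ∧ Dominates c x y)
    {a : α} {l : List α} (h : IsDirectedCycle c a l) (hl : ∀ x ∈ a :: l, x ∈ S)
    (hcard : l.length + 1 < S.card) :
    ∃ a' l', IsDirectedCycle c a' l' ∧ (∀ x ∈ a' :: l', x ∈ S) ∧
      (l'.length = l.length + 1 ∨ l = [] ∧ l'.length = 2) := by
  classical
  by_cases hmix : ∃ v ∈ S, v ∉ a :: l ∧ ∃ u ∈ a :: l, ∃ w ∈ a :: l,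
      Dominates c u v ∧ Dominates c v w
  · obtain ⟨v, hvS, hv, u, hu, w, hw, huv, hvw⟩ := hmix
    obtain ⟨l₁, h₁, hperm⟩ := h.exists_rotate hu
    suffices H : ∃ l', (u :: l' ++ [u]).IsChain (Dominates c) ∧ l'.Perm (v :: l₁) by
      obtain ⟨l', hch, hp⟩ := H
      have hp' : (u :: l').Perm (v :: a :: l) :=
        (hp.cons u).trans ((List.Perm.swap v u l₁).trans (hperm.cons v))
      refine ⟨u, l', ⟨hp'.nodup_iff.2 (List.nodup_cons.2 ⟨hv, h.1⟩), hch⟩, ?_, .inl ?_⟩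
      · intro x hx
        rcases List.mem_cons.1 (hp'.mem_iff.1 hx) with rfl | hx
        exacts [hvS, hl x hx]
      · have := hp'.length_eq
        simpa using this
    rcases List.mem_cons.1 (hperm.mem_iff.2 hw) with rfl | hw
    · obtain ⟨s₁, s₂, rfl, hs⟩ := exists_isChain_insert hc h₁.2 huv hvw
      exact ⟨s₁ ++ v :: s₂, by simpa using hs, List.perm_middle⟩
    · obtain ⟨r₁, r₂, rfl⟩ := List.append_of_mem hw
      have h2 := h₁.2
      rw [show u :: (r₁ ++ w :: r₂) ++ [u] = (u :: r₁) ++ w :: (r₂ ++ [u]) by simp,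
        List.isChain_split] at h2
      obtain ⟨s₁, s₂, rfl, hs⟩ := exists_isChain_insert hc h2.1 huv hvw
      refine ⟨s₁ ++ v :: (s₂ ++ w :: r₂), ?_, by simp⟩
      have := List.isChain_split.2 ⟨hs, h2.2⟩
      simpa using this
  · push Not at hmix
    let A := S.filter fun v => v ∉ a :: l ∧ ∀ u ∈ a :: l, ¬ Dominates c v u
    have hB : ∀ v ∈ S, v ∉ a :: l → v ∉ A → ∀ u ∈ a :: l, ¬ Dominates c u v := by
      intro v hvS hv hvA u hu huv
      have : ∃ w ∈ a :: l, Dominates c v w := by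
        by_contra! hno
        exact hvA (Finset.mem_filter.2 ⟨hvS, hv, hno⟩)
      obtain ⟨w, hw, hvw⟩ := this
      exact hmix v hvS hv u hu w hw huv hvw
    have hA : A.Nonempty := by
      by_contra hA
      rw [Finset.not_nonempty_iff_eq_empty] at hA
      obtain ⟨x, hx, y, hyS, hy, hxy⟩ := hS (a :: l).toFinset
        (fun x hx => hl x (by simpa using hx)) ⟨a, by simp⟩ (by
          intro he
          have := List.toFinset_card_le (a :: l)
          rw [he] at this
          simp at this
          omega)
      exact hB y hyS (by simpa using hy) (by simp [hA]) x (by simpa using hx) hxy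
    obtain ⟨x, hxA, y, hyS, hyA, hxy⟩ := hS A (Finset.filter_subset _ _) hA (by
      intro he
      have := hl a (by simp)
      rw [← he] at this
      simp [A] at this)
    obtain ⟨hxS, hx, hxC⟩ := Finset.mem_filter.1 hxA
    have hy : y ∉ a :: l := fun hy => hxC y hy hxy
    have hax : ∀ u ∈ a :: l, Dominates c u x := fun u hu =>
      (dominates_or_dominates hc u x).resolve_right (hxC u hu)
    have hyu : ∀ u ∈ a :: l, Dominates c y u := fun u hu =>
      (dominates_or_dominates hc y u).resolve_right (hB y hyS hy hyA u hu)
    have hne : x ≠ y := by rintro rfl; exact hyA hxA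
    have hn := h.1
    cases l with
    | nil =>
      refine ⟨a, [x, y], ⟨by grind, by simp [hax a (by simp), hxy, hyu a (by simp)]⟩,
        by simp_all, .inr ⟨rfl, rfl⟩⟩
    | cons b l =>
      refine ⟨a, x :: y :: l, ⟨by grind, ?_⟩, by simp_all, .inl (by simp)⟩
      have h2 := h.2
      simp only [List.cons_append, List.isChain_cons_cons] at h2 ⊢
      refine ⟨hax a (by simp), hxy, ?_⟩
      cases l with
      | nil => simpa using hyu a (by simp)
      | cons d l =>
        simp only [List.cons_append, List.isChain_cons_cons] at h2 ⊢
        exact ⟨hyu d (by simp), h2.2.2⟩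

theorem exists_isDirectedCycle (hc : IsStarColouring c) {S : Finset α} (hne : S.Nonempty)
    (hS : ∀ X ⊆ S, X.Nonempty → X ≠ S → ∃ x ∈ X, ∃ y ∈ S, y ∉ X ∧ Dominates c x y)
    {j : ℕ} (hj : j + 1 ≤ S.card) :
    ∃ a l, IsDirectedCycle c a l ∧ (∀ x ∈ a :: l, x ∈ S) ∧
      (l.length = j ∨ j = 1 ∧ l.length = 2) := by
  induction j with
  | zero =>
    obtain ⟨a, ha⟩ := hne
    exact ⟨a, [], ⟨by simp, by simp [Dominates]⟩, by simpa, .inl rfl⟩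
  | succ j ih =>
    obtain ⟨a, l, h, hl, hlen⟩ := ih (by omega)
    rcases hlen with rfl | ⟨rfl, hlen⟩
    · obtain ⟨a', l', h', hl', hlen'⟩ := h.exists_longer hc hS hl (by omega)
      exact ⟨a', l', h', hl', by rcases hlen' with h | ⟨rfl, h⟩ <;> simp_all⟩
    · exact ⟨a, l, h, hl, .inl hlen⟩

theorem mem_of_card_le_length {W : Finset α} {l : List α} (hn : l.Nodup) (hl : ∀ x ∈ l, x ∈ W)
    (hcard : W.card ≤ l.length) {x : α} (hx : x ∈ W) : x ∈ l := by
  classical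
  have : l.toFinset = W := Finset.eq_of_subset_of_card_le (fun x hx => hl x (by simpa using hx))
    (by rwa [List.toFinset_card_of_nodup hn])
  rw [← this] at hx
  simpa using hx

/-- No vertex of `W` dominates a vertex outside `W`. -/
def IsTerminal (c : EdgeColouring α) (W : Finset α) : Prop :=
  ∀ w ∈ W, ∀ v, v ∉ W → ¬ Dominates c w v

/-- Every vertex is the centre of two differently coloured stars. -/
def HasTwoStars (c : EdgeColouring α) : Prop :=
  ∀ v, ∃ a b, a ≠ v ∧ b ≠ v ∧ Dominates c v a ∧ Dominates c v b ∧ c s(v, a) ≠ c s(v, b)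

/-- `W` contains rainbow cycles of all lengths up to its size. -/
def IsRainbowPancyclic (c : EdgeColouring α) (W : Finset α) : Prop :=
  ∀ j, 3 ≤ j → j ≤ W.card →
    ∃ a l, IsRainbowCycle c a l ∧ (∀ x ∈ a :: l, x ∈ W) ∧ l.length + 1 = j

theorem IsTerminal.three_le_card {W : Finset α} (hW : IsTerminal c W) (h2 : HasTwoStars c)
    (hne : W.Nonempty) : 3 ≤ W.card := by
  classical
  obtain ⟨v, hv⟩ := hne
  obtain ⟨a, b, ha, hb, hva, hvb, hab⟩ := h2 v
  have haW : a ∈ W := by by_contra h; exact hW v hv a h hva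
  have hbW : b ∈ W := by by_contra h; exact hW v hv b h hvb
  have hne : a ≠ b := by rintro rfl; exact hab rfl
  rw [← Finset.card_eq_three.2 ⟨v, a, b, ha.symm, hb.symm, hne, rfl⟩]
  exact Finset.card_le_card (by grind)

theorem IsTerminal.isRainbowPancyclic_union [DecidableEq α] (hc : IsStarColouring c)
    (h2 : HasTwoStars c) {W S : Finset α} (hW : IsTerminal c W) (hP : IsRainbowPancyclic c W)
    (hdisj : Disjoint W S) (hne : S.Nonempty) (hWS : IsTerminal c (W ∪ S))
    (hS : ∀ X ⊆ S, X.Nonempty → X ≠ S → ∃ x ∈ X, ∃ y ∈ S, y ∉ X ∧ Dominates c x y) :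
    IsRainbowPancyclic c (W ∪ S) := by
  intro k hk hkc
  rw [Finset.card_union_of_disjoint hdisj] at hkc
  rcases le_or_gt k W.card with hkW | hkW
  · obtain ⟨a, l, h, hl, hlen⟩ := hP k hk hkW
    exact ⟨a, l, h, fun x hx => Finset.mem_union_left _ (hl x hx), hlen⟩
  have hdir {j : ℕ} (hj : j + 1 ≤ S.card) : ∃ a l, IsDirectedCycle c a l ∧
      (∀ x ∈ a :: l, x ∈ S) ∧ (l.length = j ∨ j = 1 ∧ l.length = 2) :=
    exists_isDirectedCycle hc hne hS hj
  rcases le_or_gt k S.card with hkS | hkS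
  · obtain ⟨a, l, h, hl, hlen⟩ := hdir (j := k - 1) (by omega)
    exact ⟨a, l, h.isRainbowCycle (by omega), fun x hx => Finset.mem_union_right _ (hl x hx),
      by omega⟩
  have hWne : W.Nonempty := by
    rw [← Finset.card_pos]; omega
  have hW3 := hW.three_le_card h2 hWne
  have hSpos := hne.card_pos
  obtain ⟨x, t, ht, htS, htlen⟩ := hdir (j := S.card - 1) (by omega)
  have htlen : t.length + 1 = S.card := by
    have := Finset.card_le_card (s := (x :: t).toFinset) (t := S)
      (fun z hz => htS z (by simpa using hz))
    rw [List.toFinset_card_of_nodup ht.1, List.length_cons] at this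
    omega
  obtain ⟨y₀, Y₀, hY₀, hY₀W, hY₀len⟩ := hP W.card hW3 le_rfl
  have hdom : ∀ s ∈ S, ∀ w ∈ W, Dominates c s w := fun s hs w hw =>
    (dominates_or_dominates hc s w).resolve_right
      (hW w hw s (Finset.disjoint_right.1 hdisj hs))
  have hout : ∀ z, Dominates c x z → z ∈ W ∨ z ∈ S := by
    intro z hz
    by_contra h
    exact hWS x (Finset.mem_union_right _ (htS x (by simp))) z (by simpa using h) hz
  have hmemS : ∀ z ∈ S, z ∈ x :: t := fun z hz =>
    mem_of_card_le_length ht.1 htS (by simp [htlen]) hz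
  have hmemW : ∀ z ∈ W, z ∈ y₀ :: Y₀ := fun z hz =>
    mem_of_card_le_length hY₀.1 hY₀W (by simp [hY₀len]) hz
  have hchain {P : List α} (y : α) (hy : y ∈ W) (hPS : ∀ z ∈ P, z ∈ S)
      (hP : P.IsChain (Dominates c)) : (P ++ [y]).IsChain (Dominates c) :=
    hP.append (by simp) fun p hp q hq =>
      hdom p (hPS p (List.mem_of_getLast? hp)) q (by simp at hq; rwa [← hq])
  suffices H : ∃ P Q Y, (x :: (P ++ Q)).Perm (x :: t) ∧ Y.Nodup ∧ (∀ z ∈ Y, z ∈ W) ∧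
      Y.length = k - S.card ∧ (pathColours c Y).Nodup ∧
      (x :: P).IsChain (Dominates c) ∧ (x :: Q).IsChain (Dominates c) ∧
      ∀ p q y z, Y.head? = some y → Y.getLast? = some z →
        (P ++ [y]).head? = some p → (Q ++ [z]).head? = some q → c s(x, p) ≠ c s(x, q) by
    obtain ⟨P, Q, Y, hperm, hYn, hYW, hYlen, hYc, hPc, hQc, hcol⟩ := H
    have hYne : Y ≠ [] := by rintro rfl; simp at hYlen; omega
    obtain ⟨y, hy⟩ : ∃ y, Y.head? = some y := ⟨_, List.head?_eq_some_head hYne⟩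
    obtain ⟨z, hz⟩ : ∃ z, Y.getLast? = some z := ⟨_, List.getLast?_eq_some_getLast hYne⟩
    have hPS : ∀ p ∈ x :: (P ++ Q), p ∈ S := fun p hp => htS p (hperm.mem_iff.1 hp)
    have hp : (x :: (P ++ Y ++ Q.reverse)).Perm (x :: (P ++ Q) ++ Y) := by
      refine List.Perm.cons x ?_
      change (P ++ Y ++ Q.reverse).Perm (P ++ Q ++ Y)
      rw [List.append_assoc, List.append_assoc]
      exact ((List.perm_append_comm).trans ((List.reverse_perm Q).append_right Y)).append_left P
    refine ⟨x, P ++ Y ++ Q.reverse, isRainbowCycle_of_fork ?_ hy hz hYc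
      (hchain y (hYW y (List.mem_of_head? hy)) (by grind) hPc)
      (hchain z (hYW z (List.mem_of_getLast? hz)) (by grind) hQc)
      (fun p q => hcol p q y z hy hz), ?_, ?_⟩
    · rw [hp.nodup_iff, List.nodup_append]
      refine ⟨hperm.nodup_iff.2 ht.1, hYn, ?_⟩
      rintro p hp q hq rfl
      exact Finset.disjoint_left.1 hdisj (hYW p hq) (hPS p hp)
    · intro p hp'
      rw [hp.mem_iff, List.mem_append] at hp'
      exact Finset.mem_union.2 (hp'.symm.imp (hYW p) (hPS p))
    · have h1 := hp.length_eq
      have h3 := hperm.length_eq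
      simp only [List.length_cons, List.length_append] at h1 h3 ⊢
      omega
  obtain ⟨a, b, hax, hbx, hxa, hxb, hab⟩ := h2 x
  cases t with
  | nil =>
    have hsingle : ∀ z, z ≠ x → Dominates c x z → z ∈ y₀ :: Y₀ := fun z hzx hz =>
      hmemW z ((hout z hz).resolve_right fun h => hzx (by simpa using hmemS z h))
    obtain ⟨y, Y, z, hY, hperm, hz, hyz⟩ :=
      hY₀.exists_rotate_ne (fun v => c s(x, v)) (hsingle a hax hxa) (hsingle b hbx hxb) hab
    refine ⟨[], [], y :: Y, by simp, hY.1, fun z hz => hY₀W z (hperm.mem_iff.1 hz), ?_,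
      hY.nodup_pathColours, by simp, by simp, ?_⟩
    · have := hperm.length_eq
      simp at this htlen ⊢
      omega
    · grind
  | cons x₂ t =>
    obtain ⟨z, hzx, hxz, hz⟩ : ∃ z, z ≠ x ∧ Dominates c x z ∧ c s(x, z) ≠ c s(x, x₂) := by
      by_cases h : c s(x, a) = c s(x, x₂)
      · exact ⟨b, hbx, hxb, fun h' => hab (h.trans h'.symm)⟩
      · exact ⟨a, hax, hxa, h⟩
    have htc : (x :: x₂ :: t).IsChain (Dominates c) := ht.2.left_of_append
    rcases hout z hxz with hzW | hzS
    · obtain ⟨Y, hY, hperm⟩ := hY₀.exists_rotate (hmemW z hzW)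
      obtain ⟨j, hj⟩ : ∃ j, k - S.card = j + 1 := ⟨k - S.card - 1, by omega⟩
      refine ⟨[], x₂ :: t, (z :: Y).take (k - S.card), by simp, hY.1.sublist (List.take_sublist _ _),
        fun w hw => hY₀W w (hperm.mem_iff.1 (List.mem_of_mem_take hw)), ?_,
        nodup_pathColours_take hY.nodup_pathColours _, by simp, htc, ?_⟩
      · rw [List.length_take, hperm.length_eq, List.length_cons, hY₀len]
        omega
      · rw [hj]
        simp only [List.take_succ_cons]
        grind
    · have hzt : z ∈ t := by
        have := hmemS z hzS
        grind
      obtain ⟨s₁, s₂, rfl⟩ := List.append_of_mem hzt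
      refine ⟨x₂ :: s₁, z :: s₂, (y₀ :: Y₀).take (k - S.card), by simp,
        hY₀.1.sublist (List.take_sublist _ _),
        fun w hw => hY₀W w (List.mem_of_mem_take hw), ?_,
        nodup_pathColours_take hY₀.nodup_pathColours _, ?_, ?_, ?_⟩
      · rw [List.length_take, List.length_cons, hY₀len]
        omega
      · exact List.IsChain.left_of_append (l₂ := z :: s₂) (by simpa using htc)
      · have : (z :: s₂).IsChain (Dominates c) :=
          List.IsChain.right_of_append (l₁ := x :: x₂ :: s₁) (by simpa using htc)
        exact List.isChain_cons_cons.2 ⟨hxz, this⟩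
      · grind

theorem isRainbowPancyclic_univ [Fintype α] (hc : IsStarColouring c) (h2 : HasTwoStars c) :
    IsRainbowPancyclic c Finset.univ := by
  classical
  obtain ⟨W, hW, hmax⟩ := Finset.exists_max_image
    (Finset.univ.filter fun W : Finset α => IsTerminal c W ∧ IsRainbowPancyclic c W)
    Finset.card ⟨∅, by
      simp only [Finset.mem_filter, Finset.mem_univ, true_and]
      exact ⟨by simp [IsTerminal], fun j h3 hj => by simp at hj; omega⟩⟩
  obtain ⟨hWt, hWp⟩ := (Finset.mem_filter.1 hW).2
  by_cases hu : W = Finset.univ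
  · rwa [← hu]
  exfalso
  obtain ⟨S, hS, hmin⟩ := Finset.exists_min_image
    (Finset.univ.filter fun S : Finset α => S.Nonempty ∧ Disjoint W S ∧ IsTerminal c (W ∪ S))
    Finset.card ⟨Wᶜ, by
      simp only [Finset.mem_filter, Finset.mem_univ, true_and]
      refine ⟨?_, disjoint_compl_right, by simp [IsTerminal]⟩
      rwa [Finset.nonempty_iff_ne_empty, Ne, Finset.compl_eq_empty_iff]⟩
  obtain ⟨hSne, hdisj, hWS⟩ := (Finset.mem_filter.1 hS).2
  have hstrong : ∀ X ⊆ S, X.Nonempty → X ≠ S →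
      ∃ x ∈ X, ∃ y ∈ S, y ∉ X ∧ Dominates c x y := by
    intro X hXS hX hne
    by_contra! hno
    have hlt := Finset.card_lt_card (hXS.ssubset_of_ne hne)
    refine absurd (hmin X ?_) (not_le.2 hlt)
    simp only [Finset.mem_filter, Finset.mem_univ, true_and]
    refine ⟨hX, hdisj.mono_right hXS, fun w hw v hv hwv => ?_⟩
    rw [Finset.mem_union, not_or] at hv
    rcases Finset.mem_union.1 hw with hw | hw
    · exact hWt w hw v hv.1 hwv
    · by_cases hvS : v ∈ S
      · exact hno w hw v hvS hv.2 hwv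
      · exact hWS w (Finset.mem_union_right _ (hXS hw)) v (by simp [hv.1, hvS]) hwv
  have := hmax (W ∪ S) (by
    simp only [Finset.mem_filter, Finset.mem_univ, true_and]
    exact ⟨hWS, hWt.isRainbowPancyclic_union hc h2 hWp hdisj hSne hWS hstrong⟩)
  rw [Finset.card_union_of_disjoint hdisj] at this
  have := hSne.card_pos
  omega

end Cycles

section Counting

variable {α : Type*} {c : EdgeColouring α}

theorem length_pathColours (l : List α) : (pathColours c l).length = l.length - 1 := by
  induction l with
  | nil => rfl
  | cons a l ih => cases l <;> simp_all [pathColours]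

theorem getElem_pathColours (l : List α) (i : ℕ) (hi : i + 1 < l.length) :
    (pathColours c l)[i]'(by rw [length_pathColours]; omega) = c s(l[i], l[i + 1]) := by
  induction l generalizing i with
  | nil => simp at hi
  | cons a l ih =>
    cases l with
    | nil => simp at hi
    | cons b l =>
      cases i with
      | zero => simp [pathColours]
      | succ i =>
        simp only [pathColours, List.getElem_cons_succ]
        exact ih i (by simpa using hi)

theorem IsRainbowCycle.hasRainbowCopy {a : α} {l : List α} (h : IsRainbowCycle c a l)
    (hl : 2 ≤ l.length) : HasRainbowCopy c (cycleGraph (l.length + 1)) := by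
  obtain ⟨n, hn⟩ : ∃ n, l.length = n + 1 := ⟨l.length - 1, by omega⟩
  have hnext : ∀ i : Fin (l.length + 1), ∃ hi : (i : ℕ) < (pathColours c (a :: l ++ [a])).length,
      (pathColours c (a :: l ++ [a]))[(i : ℕ)] = c s((a :: l).get i, (a :: l).get (i + 1)) := by
    intro i
    have hle := i.is_le
    refine ⟨by rw [length_pathColours]; simp; omega, ?_⟩
    rw [getElem_pathColours _ _ (by simp; omega)]
    have h1 : (a :: l ++ [a])[(i : ℕ)]'(by rw [List.length_append, List.length_cons]; omega) =
        (a :: l).get i := by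
      rw [List.getElem_append_left (by simp; omega)]; rfl
    have h2 : (a :: l ++ [a])[(i : ℕ) + 1]'(by simp; omega) = (a :: l).get (i + 1) := by
      rcases Nat.lt_or_ge ((i : ℕ) + 1) (l.length + 1) with hi | hi
      · rw [List.getElem_append_left (by simpa using hi), List.get_eq_getElem]
        congr 1
        rw [Fin.val_add_one_of_lt' hi]
      · have : i = Fin.last l.length := by ext; simp; omega
        subst this
        rw [List.getElem_append_right (by simp)]
        simp
    rw [h1, h2]
  have hadj : ∀ u v : Fin (l.length + 1), (cycleGraph (l.length + 1)).Adj u v →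
      ∃ i : Fin (l.length + 1), s(u, v) = s(i, i + 1) := by
    rw [hn]
    intro u v huv
    rw [cycleGraph_adj] at huv
    rcases huv with huv | huv
    · exact ⟨v, by rw [sub_eq_iff_eq_add] at huv; rw [huv, add_comm 1 v, Sym2.eq_swap]⟩
    · exact ⟨u, by rw [sub_eq_iff_eq_add] at huv; rw [huv, add_comm 1 u]⟩
  refine ⟨⟨(a :: l).get, List.nodup_iff_injective_get.1 h.1⟩, fun u v x y huv hxy hne he => ?_⟩
  obtain ⟨i, hi⟩ := hadj u v huv
  obtain ⟨j, hj⟩ := hadj x y hxy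
  have hi' := congrArg (fun e => c (e.map (a :: l).get)) hi
  have hj' := congrArg (fun e => c (e.map (a :: l).get)) hj
  simp only [Sym2.map_mk] at hi' hj'
  obtain ⟨hil, hi2⟩ := hnext i
  obtain ⟨hjl, hj2⟩ := hnext j
  have : (i : ℕ) = j := (h.2.getElem_inj_iff).1
    (hi2.trans (hi'.symm.trans (he.trans (hj'.trans hj2.symm))))
  rw [hi, hj, Fin.ext this] at hne
  exact hne rfl

/-- The colouring induced on the complement of a vertex. -/
def deleteVertex (c : EdgeColouring α) (v : α) : EdgeColouring {x // x ≠ v} :=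
  fun e => c (e.map Subtype.val)

theorem IsStarColouring.deleteVertex (hc : IsStarColouring c) (v : α) :
    IsStarColouring (deleteVertex c v) := by
  refine ⟨fun a b x y hab hxy h => ?_, fun a b d hab hbd had => ?_⟩
  · simp only [Subtype.ext_iff]
    exact hc.1 a b x y (Subtype.coe_ne_coe.2 hab) (Subtype.coe_ne_coe.2 hxy) h
  · exact hc.2 a b d (Subtype.coe_ne_coe.2 hab) (Subtype.coe_ne_coe.2 hbd)
      (Subtype.coe_ne_coe.2 had)

theorem HasRainbowCopy.of_deleteVertex {β : Type*} {H : SimpleGraph β} {v : α}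
    (h : HasRainbowCopy (deleteVertex c v) H) : HasRainbowCopy c H := by
  obtain ⟨f, hf⟩ := h
  exact ⟨f.trans (Function.Embedding.subtype _), hf⟩

theorem colourCount_le_deleteVertex [Finite α] {v : α}
    (hv : ∀ a b, a ≠ v → b ≠ v → Dominates c v a → Dominates c v b → c s(v, a) = c s(v, b)) :
    colourCount c ≤ colourCount (deleteVertex c v) + 1 := by
  let T : Set ℕ := {m | ∃ w, w ≠ v ∧ Dominates c v w ∧ c s(v, w) = m}
  have hT : T.Subsingleton := by
    rintro _ ⟨a, ha, hva, rfl⟩ _ ⟨b, hb, hvb, rfl⟩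
    exact hv a b ha hb hva hvb
  have hfin : (deleteVertex c v '' {e | ¬ e.IsDiag}).Finite := Set.toFinite _
  have hsub : c '' {e | ¬ e.IsDiag} ⊆ deleteVertex c v '' {e | ¬ e.IsDiag} ∪ T := by
    rintro _ ⟨e, he, rfl⟩
    by_cases h : ∀ e' : Sym2 α, ¬ e'.IsDiag → c e' = c e → v ∈ e'
    · right
      obtain ⟨w, rfl⟩ := Sym2.mem_iff_exists.1 (h e he rfl)
      exact ⟨w, by simpa [eq_comm] using he, .inr h, rfl⟩
    · left
      push Not at h
      obtain ⟨e', he', hce, hve⟩ := h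
      rw [← hce]
      induction e' with | _ a b => ?_
      simp only [Sym2.mem_iff, not_or, Sym2.mk_isDiag_iff] at hve he'
      exact ⟨s(⟨a, Ne.symm hve.1⟩, ⟨b, Ne.symm hve.2⟩), by simpa using he', rfl⟩
  calc colourCount c ≤ (deleteVertex c v '' {e | ¬ e.IsDiag} ∪ T).ncard :=
        Set.ncard_le_ncard hsub (hfin.union hT.finite)
    _ ≤ _ := (Set.ncard_union_le _ _).trans
        (Nat.add_le_add_left ((Set.ncard_le_one hT.finite).2 fun a ha b hb => hT ha hb) _)

theorem colourCount_le_choose [Fintype α] (c : EdgeColouring α) :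
    colourCount c ≤ (Fintype.card α).choose 2 := by
  classical
  rw [← Sym2.card_subtype_not_diag, ← Nat.card_eq_fintype_card]
  exact Set.ncard_image_le (Set.toFinite _)

theorem colourCount_le {k n : ℕ} (hk : 3 ≤ k) (hn : k - 1 ≤ n) {α : Type*} [Fintype α]
    (hα : Fintype.card α = n) {c : EdgeColouring α} (hc : IsStarColouring c)
    (hr : ¬ HasRainbowCopy c (cycleGraph k)) :
    colourCount c ≤ n + (k - 2).choose 2 - 1 := by
  classical
  induction n, hn using Nat.le_induction generalizing α with
  | base =>
    refine (colourCount_le_choose c).trans (le_of_eq ?_)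
    obtain ⟨j, rfl⟩ : ∃ j, k = j + 3 := ⟨k - 3, by omega⟩
    rw [hα]
    simp only [Nat.reduceSubDiff, Nat.add_one_sub_one]
    have : (j + 2).choose 2 = (j + 1) + (j + 1).choose 2 := by
      simpa using Nat.choose_succ_succ' (j + 1) 1
    omega
  | succ n hn ih =>
    have h2 : ¬ HasTwoStars c := by
      intro h2
      obtain ⟨a, l, h, -, rfl⟩ := isRainbowPancyclic_univ hc h2 k hk
        (by rw [Finset.card_univ]; omega)
      exact hr (h.hasRainbowCopy (by omega))
    simp only [HasTwoStars, not_forall, not_exists, not_and, not_not] at h2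
    obtain ⟨v, hv⟩ := h2
    have := ih (α := {x // x ≠ v}) (by simp [Fintype.card_subtype_compl, hα])
      (hc.deleteVertex v) (fun h => hr h.of_deleteVertex)
    have := colourCount_le_deleteVertex hv
    omega

end Counting

/-- The edge `{i, j}` with `i < j` gets colour `i` if `i < t`, and a colour of its own otherwise. -/
def partialLexColouring (n t : ℕ) : EdgeColouring (Fin n) :=
  Sym2.lift ⟨fun i j => if min i.1 j.1 < t then min i.1 j.1 else
    n + Nat.pair (min i.1 j.1) (max i.1 j.1), fun i j => by simp [min_comm, max_comm]⟩

theorem partialLexColouring_mk {n t : ℕ} (i j : Fin n) :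
    partialLexColouring n t s(i, j) = if min i.1 j.1 < t then min i.1 j.1 else
      n + Nat.pair (min i.1 j.1) (max i.1 j.1) := rfl

theorem partialLexColouring_eq {n t : ℕ} {a b x y : Fin n}
    (h : partialLexColouring n t s(a, b) = partialLexColouring n t s(x, y)) :
    min a.1 b.1 = min x.1 y.1 ∧ (max a.1 b.1 = max x.1 y.1 ∨ min a.1 b.1 < t) := by
  simp only [partialLexColouring_mk] at h
  split_ifs at h
  · exact ⟨h, .inr (by assumption)⟩
  · omega
  · omega
  · have := Nat.pair_eq_pair.1 (Nat.add_left_cancel h)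
    exact ⟨this.1, .inl this.2⟩

theorem isStarColouring_partialLexColouring (n t : ℕ) :
    IsStarColouring (partialLexColouring n t) := by
  refine ⟨fun a b x y hab hxy h => ?_, fun a b d hab hbd had h => ?_⟩
  · have := (partialLexColouring_eq h).1
    simp only [Fin.ext_iff]
    omega
  · have h1 := (partialLexColouring_eq h.1).1
    have h2 := (partialLexColouring_eq h.2).1
    simp only [ne_eq, Fin.ext_iff] at hab hbd had
    omega

theorem not_hasRainbowCopy_partialLexColouring {n k : ℕ} (hk : 3 ≤ k) (hkn : k ≤ n) :
    ¬ HasRainbowCopy (partialLexColouring n (n + 1 - k)) (cycleGraph k) := by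
  rintro ⟨f, hf⟩
  obtain ⟨j, rfl⟩ : ∃ j, k = j + 3 := ⟨k - 3, by omega⟩
  obtain ⟨u, -, hu⟩ := Finset.exists_min_image Finset.univ (fun i => (f i).1) ⟨0, by simp⟩
  have hut : (f u).1 < n + 1 - (j + 3) := by
    by_contra! h
    have hcard := Finset.card_le_card_of_injOn (s := (Finset.univ : Finset (Fin (j + 3))))
      (t := Finset.Ico (n + 1 - (j + 3)) n) (fun i => (f i).1)
      (fun i _ => Finset.mem_coe.2 (Finset.mem_Ico.2 ⟨h.trans (hu i (by simp)), (f i).2⟩))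
      (fun a _ b _ hab => f.injective (Fin.ext hab))
    simp at hcard
    omega
  have hne : u + 1 ≠ u - 1 := by
    intro h
    rw [eq_sub_iff_add_eq, add_assoc, add_eq_left] at h
    simp only [Fin.ext_iff, Fin.val_add, Fin.val_one, Fin.val_zero, Nat.reduceAdd] at h
    rw [Nat.mod_eq_of_lt (by omega)] at h
    omega
  refine hf u (u + 1) u (u - 1) ?_ ?_ ?_ ?_
  · rw [cycleGraph_adj]; right; abel
  · rw [cycleGraph_adj]; left; abel
  · intro h
    rw [Sym2.congr_right] at h
    exact hne h
  · have h1 := hu (u + 1) (by simp)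
    have h2 := hu (u - 1) (by simp)
    simp only [partialLexColouring_mk, min_eq_left h1, min_eq_left h2, if_pos hut]

theorem le_colourCount_partialLexColouring {n k : ℕ} (hk : 3 ≤ k) (hkn : k ≤ n) :
    n + (k - 2).choose 2 - 1 ≤ colourCount (partialLexColouring n (n + 1 - k)) := by
  let t := n + 1 - k
  let P := (Finset.range (k - 1)).sigma fun j => Finset.range j
  let g : (Σ _ : ℕ, ℕ) → ℕ := fun p => n + Nat.pair (t + p.2) (t + p.1)
  let A := Finset.range t ∪ P.image g
  have hg : Function.Injective g := by
    rintro ⟨a, b⟩ ⟨a', b'⟩ h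
    have := Nat.pair_eq_pair.1 (Nat.add_left_cancel h)
    simp only [Nat.add_left_cancel_iff] at this
    simp [this.1, this.2]
  have hP : P.card = (k - 1).choose 2 := by
    simp only [P, Finset.card_sigma, Finset.card_range]
    rw [Finset.sum_range_id, Nat.choose_two_right]
  have hA : A.card = t + (k - 1).choose 2 := by
    rw [Finset.card_union_of_disjoint, Finset.card_range, Finset.card_image_of_injective _ hg, hP]
    rw [Finset.disjoint_left]
    intro m hm hm'
    obtain ⟨p, -, rfl⟩ := Finset.mem_image.1 hm'
    simp only [Finset.mem_range, g] at hm
    omega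
  have hsub : (A : Set ℕ) ⊆ partialLexColouring n t '' {e | ¬ e.IsDiag} := by
    intro m hm
    rcases Finset.mem_union.1 hm with hm | hm
    · rw [Finset.mem_range] at hm
      refine ⟨s(⟨m, by omega⟩, ⟨m + 1, by omega⟩), by simp, ?_⟩
      simp [partialLexColouring_mk, hm]
    · obtain ⟨⟨j, i⟩, hp, rfl⟩ := Finset.mem_image.1 hm
      simp only [P, Finset.mem_sigma, Finset.mem_range] at hp
      refine ⟨s(⟨t + i, by omega⟩, ⟨t + j, by omega⟩), by simp; omega, ?_⟩
      rw [partialLexColouring_mk, if_neg (by simp)]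
      simp only [g]
      rw [min_eq_left (by simp; omega), max_eq_right (by simp; omega)]
  calc n + (k - 2).choose 2 - 1 = A.card := by
        obtain ⟨j, rfl⟩ : ∃ j, k = j + 3 := ⟨k - 3, by omega⟩
        rw [hA]
        simp only [Nat.reduceSubDiff, t]
        have : (j + 2).choose 2 = (j + 1) + (j + 1).choose 2 := by
          simpa using Nat.choose_succ_succ' (j + 1) 1
        omega
    _ = (A : Set ℕ).ncard := (Set.ncard_coe_finset A).symm
    _ ≤ _ := Set.ncard_le_ncard hsub (Set.toFinite _)

/-- For all integers `n ≥ k ≥ 3`, `ar*(n, C_k) = n + (k-2 choose 2) - 1`. -/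
theorem starAntiRamsey_cycle (n k : ℕ) (hk : 3 ≤ k) (hkn : k ≤ n) :
    starAntiRamsey n (SimpleGraph.cycleGraph k) = n + (k - 2).choose 2 - 1 := by
  have hub : n + (k - 2).choose 2 - 1 ∈ upperBounds {s | ∃ c : EdgeColouring (Fin n),
      IsStarColouring c ∧ colourCount c = s ∧ ¬ HasRainbowCopy c (cycleGraph k)} := by
    rintro _ ⟨c, hc, rfl, hr⟩
    exact colourCount_le hk (by omega) (Fintype.card_fin n) hc hr
  have hmem : colourCount (partialLexColouring n (n + 1 - k)) ∈ {s | ∃ c : EdgeColouring (Fin n),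
      IsStarColouring c ∧ colourCount c = s ∧ ¬ HasRainbowCopy c (cycleGraph k)} :=
    ⟨_, isStarColouring_partialLexColouring _ _, rfl,
      not_hasRainbowCopy_partialLexColouring hk hkn⟩
  exact le_antisymm (csSup_le ⟨_, hmem⟩ hub)
    ((le_colourCount_partialLexColouring hk hkn).trans (le_csSup ⟨_, hub⟩ hmem))
end

section
/- For all integers n ≥ 4, the star-anti-Ramsey number of the complete graph K_4 satisfies ar*(n, K_4) = 2n - 3. -/
open SimpleGraph

namespace IsStarColouring

variable {α : Type*} {c : EdgeColouring α}

theorem ne_of_disjoint (hc : IsStarColouring c) {a b x y : α} (hab : a ≠ b) (hxy : x ≠ y)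
    (hax : a ≠ x) (hay : a ≠ y) (hbx : b ≠ x) (hby : b ≠ y) : c s(a, b) ≠ c s(x, y) := by
  intro h
  rcases hc.1 a b x y hab hxy h with h | h | h | h <;> contradiction

/-- If `a` sends the colour of `ab` to another vertex `x`, then `b` does not. -/
theorem ne_of_eq (hc : IsStarColouring c) {a b x y : α} (hab : a ≠ b) (hax : a ≠ x)
    (hbx : b ≠ x) (hay : a ≠ y) (hby : b ≠ y) (h : c s(a, b) = c s(a, x)) :
    c s(a, b) ≠ c s(b, y) := by
  intro h'
  by_cases hxy : x = y
  · subst hxy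
    exact hc.2 b a x hab.symm hax hbx ⟨by rw [Sym2.eq_swap, h], by rw [← h, h']⟩
  · exact hc.ne_of_disjoint hax hby hab hay hbx.symm hxy (h.symm.trans h')

end IsStarColouring

section Combinatorics

variable {α : Type*} {c : EdgeColouring α}

/-- In a star-colouring without a rainbow `K₄`, any four vertices span two edges of the same
colour, and these share a vertex. -/
theorem exists_eq_of_not_rainbow (hc : IsStarColouring c)
    (hr : ¬ HasRainbowCopy c (⊤ : SimpleGraph (Fin 4))) {a b x y : α} (hab : a ≠ b)
    (hax : a ≠ x) (hay : a ≠ y) (hbx : b ≠ x) (hby : b ≠ y) (hxy : x ≠ y) :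
    (c s(a, b) = c s(a, x) ∨ c s(a, b) = c s(a, y) ∨ c s(a, x) = c s(a, y)) ∨
    (c s(b, a) = c s(b, x) ∨ c s(b, a) = c s(b, y) ∨ c s(b, x) = c s(b, y)) ∨
    (c s(x, a) = c s(x, b) ∨ c s(x, a) = c s(x, y) ∨ c s(x, b) = c s(x, y)) ∨
    (c s(y, a) = c s(y, b) ∨ c s(y, a) = c s(y, x) ∨ c s(y, b) = c s(y, x)) := by
  by_contra h
  have h1 := hc.ne_of_disjoint hab hxy hax hay hbx hby
  have h2 := hc.ne_of_disjoint hax hby hab hay hbx.symm hxy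
  have h3 := hc.ne_of_disjoint hay hbx hab hax hby.symm hxy.symm
  simp only [not_or, Sym2.eq_swap (a := b) (b := a), Sym2.eq_swap (a := x) (b := a),
    Sym2.eq_swap (a := y) (b := a), Sym2.eq_swap (a := x) (b := b),
    Sym2.eq_swap (a := y) (b := b), Sym2.eq_swap (a := y) (b := x)] at h
  have hinj : Function.Injective ![a, b, x, y] := by
    intro i j hij
    fin_cases i <;> fin_cases j <;> simp_all
  refine hr ⟨⟨_, hinj⟩, fun i j k l hij hkl hne heq => ?_⟩
  rw [SimpleGraph.top_adj] at hij hkl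
  fin_cases i <;> fin_cases j <;> fin_cases k <;> fin_cases l <;>
    simp [Sym2.eq_swap (a := b) (b := a), Sym2.eq_swap (a := x) (b := a),
      Sym2.eq_swap (a := y) (b := a), Sym2.eq_swap (a := x) (b := b),
      Sym2.eq_swap (a := y) (b := b), Sym2.eq_swap (a := y) (b := x)] at hij hkl hne heq <;>
    grind

/-- The graph of the edges whose colour occurs on no other edge at their endpoints. -/
def uniqueEdgeGraph (c : EdgeColouring α) : SimpleGraph α where
  Adj a b := a ≠ b ∧ ∀ x, x ≠ a → x ≠ b → c s(a, x) ≠ c s(a, b) ∧ c s(b, x) ≠ c s(a, b)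
  symm := ⟨fun a b h => ⟨h.1.symm, fun x hb ha => by
    rw [Sym2.eq_swap (a := b) (b := a)]; exact (h.2 x ha hb).symm⟩⟩
  loopless := ⟨fun a h => h.1 rfl⟩

/-- `w` runs periodically through `m` vertices, and the colour of each edge between consecutive
vertices is not repeated at its endpoints by an edge to another vertex of `w`. -/
def IsUniqueCycle (c : EdgeColouring α) (m : ℕ) (w : ℕ → α) : Prop :=
  (∀ i j, w i = w j ↔ i ≡ j [MOD m]) ∧
  ∀ i j, w j ≠ w i → w j ≠ w (i + 1) →
    c s(w i, w j) ≠ c s(w i, w (i + 1)) ∧ c s(w (i + 1), w j) ≠ c s(w i, w (i + 1))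

theorem not_isUniqueCycle_four (hc : IsStarColouring c)
    (hr : ¬ HasRainbowCopy c (⊤ : SimpleGraph (Fin 4))) (w : ℕ → α) :
    ¬ IsUniqueCycle c 4 w := by
  rintro ⟨hw, hs⟩
  have hne : ∀ i j, i % 4 ≠ j % 4 → w i ≠ w j := fun i j h => by
    rw [Ne, hw]; exact h
  have h4 : w 4 = w 0 := (hw 4 0).2 rfl
  have h01 := hs 0
  have h12 := hs 1
  have h23 := hs 2
  have h30 := hs 3
  simp only [zero_add, Nat.reduceAdd, h4] at h01 h12 h23 h30
  have n01 := hne 0 1 (by decide)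
  have n02 := hne 0 2 (by decide)
  have n03 := hne 0 3 (by decide)
  have n12 := hne 1 2 (by decide)
  have n13 := hne 1 3 (by decide)
  have n23 := hne 2 3 (by decide)
  have := exists_eq_of_not_rainbow hc hr n01 n02 n03 n12 n13 n23
  have a1 := h01 2 n02.symm n12.symm
  have a2 := h01 3 n03.symm n13.symm
  have a3 := h12 3 n13.symm n23.symm
  have a4 := h12 0 n01 n02
  have a5 := h23 0 n02 n03
  have a6 := h23 1 n12 n13
  have a7 := h30 1 n13 n01.symm
  have a8 := h30 2 n23 n02.symm
  simp only [Sym2.eq_swap (a := w 1) (b := w 0), Sym2.eq_swap (a := w 2) (b := w 0),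
    Sym2.eq_swap (a := w 3) (b := w 0), Sym2.eq_swap (a := w 2) (b := w 1),
    Sym2.eq_swap (a := w 3) (b := w 1), Sym2.eq_swap (a := w 3) (b := w 2)] at *
  grind

/-- If the chord joining `w i` to `w (i + a)` had a unique colour along the arc, it would close a
shorter cycle. -/
theorem IsUniqueCycle.exists_eq_chord {m : ℕ} {w : ℕ → α} (hw : IsUniqueCycle c m w)
    (ih : ∀ m' < m, 4 ≤ m' → ∀ w', ¬ IsUniqueCycle c m' w') {a : ℕ} (ha : 3 ≤ a)
    (ham : a + 2 ≤ m) (i : ℕ) :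
    ∃ t, 0 < t ∧ t < a ∧ (c s(w i, w (i + t)) = c s(w i, w (i + a)) ∨
      c s(w (i + a), w (i + t)) = c s(w i, w (i + a))) := by
  by_contra! h
  refine ih (a + 1) (by omega) (by omega) (fun t => w (i + t % (a + 1))) ⟨fun s t => ?_, ?_⟩
  · rw [hw.1]
    have h1 := Nat.mod_lt s (show 0 < a + 1 by omega)
    have h2 := Nat.mod_lt t (show 0 < a + 1 by omega)
    constructor
    · intro h
      have := Nat.ModEq.add_left_cancel' i h
      rwa [Nat.ModEq, Nat.mod_eq_of_lt (show s % (a + 1) < m by omega),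
        Nat.mod_eq_of_lt (show t % (a + 1) < m by omega)] at this
    · intro h
      rw [show s % (a + 1) = t % (a + 1) from h]
  · intro s t h1 h2
    have hs := Nat.mod_lt s (show 0 < a + 1 by omega)
    have ht := Nat.mod_lt t (show 0 < a + 1 by omega)
    by_cases hsa : s % (a + 1) = a
    · have hs' : (s + 1) % (a + 1) = 0 := by
        rw [Nat.add_mod, hsa]
        simp
      simp only [hsa, hs', add_zero] at h1 h2 ⊢
      have ht0 : t % (a + 1) ≠ 0 := by
        intro h0; rw [h0] at h2; exact h2 rfl
      have hta : t % (a + 1) ≠ a := by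
        intro h0; rw [h0] at h1; exact h1 rfl
      rw [Sym2.eq_swap (a := w (i + a)) (b := w i)]
      exact (h _ (by omega) (by omega)).symm
    · have hs' : (s + 1) % (a + 1) = s % (a + 1) + 1 := by
        rw [Nat.add_mod, Nat.mod_eq_of_lt (show 1 < a + 1 by omega)]
        exact Nat.mod_eq_of_lt (by omega)
      simp only [hs', ← add_assoc] at h1 h2 ⊢
      exact hw.2 _ _ h1 h2

theorem not_isUniqueCycle (hc : IsStarColouring c)
    (hr : ¬ HasRainbowCopy c (⊤ : SimpleGraph (Fin 4))) (m : ℕ) (hm : 4 ≤ m) (w : ℕ → α) :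
    ¬ IsUniqueCycle c m w := by
  induction m using Nat.strong_induction_on generalizing w with | _ m ih
  rcases hm.eq_or_lt with rfl | hm
  · exact not_isUniqueCycle_four hc hr w
  intro hw
  have hne : ∀ i a b, a < b → b < a + m → w (i + a) ≠ w (i + b) := by
    intro i a b hab hbm h
    have := Nat.ModEq.add_left_cancel' i ((hw.1 _ _).1 h)
    rw [Nat.modEq_iff_dvd' hab.le] at this
    exact absurd (Nat.le_of_dvd (by omega) this) (by omega)
  have hne0 : ∀ i b, 0 < b → b < m → w i ≠ w (i + b) := fun i b h0 hb =>
    hne i 0 b h0 (by omega)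
  have hper : ∀ i, w (i + m) = w i := fun i => (hw.1 _ _).2 (Nat.add_mod_right i m)
  have hchord := fun {a} => hw.exists_eq_chord ih (a := a)
  have hnext : ∀ i a, 2 ≤ a → a ≤ m - 2 → c s(w i, w (i + a)) ≠ c s(w i, w (i + 1)) :=
    fun i a h2 ha => (hw.2 i (i + a) (hne0 i a (by omega) (by omega)).symm
      (hne i 1 a (by omega) (by omega)).symm).1
  have hprev : ∀ i a, 2 ≤ a → a ≤ m - 2 → c s(w i, w (i + a)) ≠ c s(w i, w (i + (m - 1))) := by
    intro i a h2 ha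
    have h := (hw.2 (i + (m - 1)) (i + a) (hne i a (m - 1) (by omega) (by omega))
      (by rw [show i + (m - 1) + 1 = i + m by omega, hper]
          exact (hne0 i a (by omega) (by omega)).symm)).2
    rwa [show i + (m - 1) + 1 = i + m by omega, hper, Sym2.eq_swap (a := w (i + (m - 1)))] at h
  have hdown : ∀ i a b, a ≠ b → 2 ≤ a → a ≤ m - 2 → 2 ≤ b → b ≤ m - 2 →
      c s(w i, w (i + a)) = c s(w i, w (i + b)) → c s(w i, w (i + 2)) = c s(w i, w (i + a)) := by
    intro i a
    induction a using Nat.strong_induction_on with | _ a iha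
    intro b hab ha2 ham hb2 hbm h
    rcases ha2.eq_or_lt with rfl | ha2
    · rfl
    obtain ⟨t, ht0, hta, ht | ht⟩ := hchord ha2 (by omega) i
    · have ht1 : t ≠ 1 := by
        rintro rfl
        exact hnext i a (by omega) ham ht.symm
      rw [← ht]
      exact iha t hta a hta.ne (by omega) (by omega) (by omega) ham ht
    · refine absurd ht.symm (hc.ne_of_eq (hne0 i a (by omega) (by omega))
        (hne0 i b (by omega) (by omega)) ?_ (hne0 i t (by omega) (by omega))
        (hne i t a hta (by omega)).symm h)
      rcases hab.lt_or_gt with hab | hab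
      · exact hne i a b hab (by omega)
      · exact (hne i b a hab (by omega)).symm
  have hup : ∀ k i a b, m - 2 - a = k → a ≠ b → 2 ≤ a → a ≤ m - 2 → 2 ≤ b → b ≤ m - 2 →
      c s(w i, w (i + a)) = c s(w i, w (i + b)) →
      c s(w i, w (i + (m - 2))) = c s(w i, w (i + a)) := by
    intro k
    induction k using Nat.strong_induction_on with | _ k ihk
    intro i a b hk hab ha2 ham hb2 hbm h
    rcases ham.eq_or_lt with rfl | ham
    · rfl
    obtain ⟨t, ht0, hta, ht⟩ := hchord (a := m - a) (by omega) (by omega) (i + a)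
    rw [show i + a + (m - a) = i + m by omega, hper, show i + a + t = i + (a + t) by omega,
      Sym2.eq_swap (a := w (i + a)) (b := w i)] at ht
    rcases ht with ht | ht
    · refine absurd ht.symm (hc.ne_of_eq (hne0 i a (by omega) (by omega))
        (hne0 i b (by omega) (by omega)) ?_ (hne0 i (a + t) (by omega) (by omega))
        (hne i a (a + t) (by omega) (by omega)) h)
      rcases hab.lt_or_gt with hab | hab
      · exact hne i a b hab (by omega)
      · exact (hne i b a hab (by omega)).symm
    · have ht1 : a + t ≠ m - 1 := by
        intro h1
        rw [h1] at ht
        exact hprev i a ha2 (by omega) ht.symm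
      rw [← ht]
      exact ihk (m - 2 - (a + t)) (by omega) i (a + t) a rfl (by omega) (by omega) (by omega)
        (by omega) (by omega) ht
  -- The vertices that are the centre of the colour of some chord.
  let Own : ℕ → Prop := fun i => c s(w i, w (i + 2)) = c s(w i, w (i + (m - 2)))
  have hown_per : ∀ i, Own (i + m) ↔ Own i := by
    intro i
    simp only [Own]
    rw [show i + m + 2 = i + 2 + m by omega, show i + m + (m - 2) = i + (m - 2) + m by omega,
      hper, hper, hper]
  have hown : ∀ i a b, a ≠ b → 2 ≤ a → a ≤ m - 2 → 2 ≤ b → b ≤ m - 2 →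
      c s(w i, w (i + a)) = c s(w i, w (i + b)) → Own i := fun i a b hab ha2 ham hb2 hbm h =>
    (hdown i a b hab ha2 ham hb2 hbm h).trans (hup _ i a b rfl hab ha2 ham hb2 hbm h).symm
  have hcover3 : ∀ i a, 3 ≤ a → a ≤ m - 2 → Own i ∨ Own (i + a) := by
    intro i a ha2 ham
    obtain ⟨t, ht0, hta, ht | ht⟩ := hchord ha2 (by omega) i
    · have ht1 : t ≠ 1 := by
        rintro rfl
        exact hnext i a (by omega) ham ht.symm
      exact Or.inl (hown i t a hta.ne (by omega) (by omega) (by omega) ham ht)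
    · right
      rw [Sym2.eq_swap (a := w i), ← hper i, ← hper (i + t),
        show i + m = i + a + (m - a) by omega,
        show i + t + m = i + a + (m - a + t) by omega] at ht
      have ht1 : m - a + t ≠ m - 1 := by
        intro h1
        rw [h1] at ht
        exact hprev (i + a) (m - a) (by omega) (by omega) ht.symm
      exact hown (i + a) (m - a + t) (m - a) (by omega) (by omega) (by omega) (by omega)
        (by omega) ht
  have hcover : ∀ i a, 2 ≤ a → a ≤ m - 2 → Own i ∨ Own (i + a) := by
    intro i a ha2 ham
    rcases ha2.eq_or_lt with rfl | ha2
    · have := hcover3 (i + 2) (m - 2) (by omega) le_rfl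
      rw [show i + 2 + (m - 2) = i + m by omega, hown_per] at this
      exact this.symm
    · exact hcover3 i a ha2 ham
  have halt : ∀ i, Own i → ¬ Own (i + 2) := by
    intro i h1 h2
    simp only [Own] at h1 h2
    rw [show i + 2 + (m - 2) = i + m by omega, hper, show i + 2 + 2 = i + 4 by omega] at h2
    refine hc.ne_of_eq (hne0 i 2 (by omega) (by omega)) (hne0 i (m - 2) (by omega) (by omega))
      (hne i 2 (m - 2) (by omega) (by omega)) (hne0 i 4 (by omega) (by omega))
      (hne i 2 4 (by omega) (by omega)) h1 ?_
    rw [Sym2.eq_swap, h2]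
  obtain ⟨i, hi⟩ : ∃ i, Own i := by
    rcases hcover 0 2 le_rfl (by omega) with h | h
    exacts [⟨_, h⟩, ⟨_, h⟩]
  have h2 := halt i hi
  rcases (show 5 ≤ m from hm).eq_or_lt with rfl | hm6
  · have h4 := (hcover (i + 2) 2 le_rfl (by omega)).resolve_left h2
    have h6 := halt _ h4
    have h8 := (hcover _ 2 le_rfl (by omega)).resolve_left h6
    have h10 := halt _ h8
    exact h10 ((hown_per (i + 5)).2 ((hown_per i).2 hi))
  · have hm2 : ¬ Own (i + 2 + (m - 4)) := by
      intro h
      refine halt _ h ?_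
      rw [show i + 2 + (m - 4) + 2 = i + m by omega, hown_per]
      exact hi
    exact (hcover (i + 2) (m - 4) (by omega) (by omega)).elim h2 hm2

theorem length_eq_three_of_isCycle (hc : IsStarColouring c)
    (hr : ¬ HasRainbowCopy c (⊤ : SimpleGraph (Fin 4))) {v : α}
    {p : (uniqueEdgeGraph c).Walk v v} (hp : p.IsCycle) : p.length = 3 := by
  by_contra h3
  have h4 : 4 ≤ p.length := by
    have := hp.three_le_length
    omega
  refine not_isUniqueCycle hc hr p.length h4 (fun i => p.getVert (i % p.length))
    ⟨fun i j => ⟨fun h => ?_, fun h => ?_⟩, fun i j h1 h2 => ?_⟩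
  · have hi := Nat.mod_lt i (show 0 < p.length by omega)
    have hj := Nat.mod_lt j (show 0 < p.length by omega)
    exact hp.getVert_injOn' (by simp only [Set.mem_ofPred_eq]; omega)
      (by simp only [Set.mem_ofPred_eq]; omega) h
  · simp only
    rw [show i % p.length = j % p.length from h]
  · have hi := Nat.mod_lt i (show 0 < p.length by omega)
    have hadj : (uniqueEdgeGraph c).Adj (p.getVert (i % p.length))
        (p.getVert ((i + 1) % p.length)) := by
      have h := p.adj_getVert_succ hi
      by_cases hl : i % p.length = p.length - 1
      · have h0 : (i + 1) % p.length = 0 := by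
          rw [Nat.add_mod, hl, Nat.mod_eq_of_lt (show 1 < p.length by omega),
            Nat.sub_add_cancel (by omega), Nat.mod_self]
        rw [h0, p.getVert_zero]
        rwa [hl, Nat.sub_add_cancel (by omega), p.getVert_length, ← hl] at h
      · have h0 : (i + 1) % p.length = i % p.length + 1 := by
          rw [Nat.add_mod, Nat.mod_eq_of_lt (show 1 < p.length by omega)]
          exact Nat.mod_eq_of_lt (by omega)
        rwa [h0]
    exact hadj.2 _ h1 h2

theorem exists_eq_of_triangle (hc : IsStarColouring c)
    (hr : ¬ HasRainbowCopy c (⊤ : SimpleGraph (Fin 4))) {a b d t : α}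
    (hab : (uniqueEdgeGraph c).Adj a b) (hbd : (uniqueEdgeGraph c).Adj b d)
    (had : (uniqueEdgeGraph c).Adj a d) (hta : t ≠ a) (htb : t ≠ b) (htd : t ≠ d) :
    c s(t, a) = c s(t, b) ∨ c s(t, a) = c s(t, d) ∨ c s(t, b) = c s(t, d) := by
  have := exists_eq_of_not_rainbow hc hr hta htb htd hab.1 had.1 hbd.1
  have h1 := hab.2 t hta htb
  have h2 := hbd.2 t htb htd
  have h3 := had.2 t hta htd
  have h4 := hab.2 d had.1.symm hbd.1.symm
  have h5 := hbd.2 a hab.1 had.1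
  simp only [Sym2.eq_swap (b := t), Sym2.eq_swap (a := b) (b := a), Sym2.eq_swap (a := d) (b := a),
    Sym2.eq_swap (a := d) (b := b)] at *
  grind

theorem not_two_disjoint_triangles (hc : IsStarColouring c)
    (hr : ¬ HasRainbowCopy c (⊤ : SimpleGraph (Fin 4))) {a b d x y z : α}
    (hab : (uniqueEdgeGraph c).Adj a b) (hbd : (uniqueEdgeGraph c).Adj b d)
    (had : (uniqueEdgeGraph c).Adj a d)
    (hxy : (uniqueEdgeGraph c).Adj x y) (hyz : (uniqueEdgeGraph c).Adj y z)
    (hxz : (uniqueEdgeGraph c).Adj x z) (hax : a ≠ x) (hay : a ≠ y) (haz : a ≠ z)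
    (hbx : b ≠ x) (hby : b ≠ y) (hbz : b ≠ z) (hdx : d ≠ x) (hdy : d ≠ y) (hdz : d ≠ z) :
    False := by
  have ha := exists_eq_of_triangle hc hr hxy hyz hxz hax hay haz
  have hb := exists_eq_of_triangle hc hr hxy hyz hxz hbx hby hbz
  have hx := exists_eq_of_triangle hc hr hab hbd had hax.symm hbx.symm hdx.symm
  have hy := exists_eq_of_triangle hc hr hab hbd had hay.symm hby.symm hdy.symm
  have hz := exists_eq_of_triangle hc hr hab hbd had haz.symm hbz.symm hdz.symm
  have key : ∀ {p q r s}, p ≠ q → p ≠ r → q ≠ r → p ≠ s → q ≠ s → c s(p, q) = c s(p, r) →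
      c s(p, q) ≠ c s(q, s) := fun hpq hpr hqr hps hqs => hc.ne_of_eq hpq hpr hqr hps hqs
  have := hab.1
  have := hbd.1
  have := had.1
  have := hxy.1
  have := hyz.1
  have := hxz.1
  have e : ∀ p q : α, c s(p, q) = c s(q, p) := fun p q => by rw [Sym2.eq_swap]
  have hxa := e x a
  have hxb := e x b
  have hxd := e x d
  have hya := e y a
  have hyb := e y b
  have hyd := e y d
  have hza := e z a
  have hzb := e z b
  have hzd := e z d
  clear e hr
  grind

theorem not_two_triangles_share_vertex (hc : IsStarColouring c)
    (hr : ¬ HasRainbowCopy c (⊤ : SimpleGraph (Fin 4))) {v b d y z : α}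
    (hvb : (uniqueEdgeGraph c).Adj v b) (hbd : (uniqueEdgeGraph c).Adj b d)
    (hvd : (uniqueEdgeGraph c).Adj v d)
    (hvy : (uniqueEdgeGraph c).Adj v y) (hyz : (uniqueEdgeGraph c).Adj y z)
    (hvz : (uniqueEdgeGraph c).Adj v z)
    (hby : b ≠ y) (hbz : b ≠ z) (hdy : d ≠ y) : False := by
  have h1 := exists_eq_of_triangle hc hr hvb hbd hvd hvy.1.symm hby.symm hdy.symm
  have h2 := exists_eq_of_triangle hc hr hvy hyz hvz hvb.1.symm hby hbz
  have h3 := hvy.2 b hvb.1.symm hby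
  have h4 := hvy.2 d hvd.1.symm hdy
  have h5 := hvb.2 y hvy.1.symm hby.symm
  have h6 := hvb.2 z hvz.1.symm hbz.symm
  have h7 := hc.ne_of_eq (a := y) (b := b) (x := d) (y := z) hby.symm hdy.symm hbd.1 hyz.1 hbz
  rw [Sym2.eq_swap (a := y) (b := b)] at *
  rw [Sym2.eq_swap (a := y) (b := v)] at *
  rw [Sym2.eq_swap (a := b) (b := v)] at *
  grind

theorem not_uniqueEdgeGraph_four_cycle (hc : IsStarColouring c)
    (hr : ¬ HasRainbowCopy c (⊤ : SimpleGraph (Fin 4))) {a b x y : α}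
    (hab : (uniqueEdgeGraph c).Adj a b) (hbx : (uniqueEdgeGraph c).Adj b x)
    (hxy : (uniqueEdgeGraph c).Adj x y) (hay : (uniqueEdgeGraph c).Adj a y)
    (hax : a ≠ x) (hby : b ≠ y) : False := by
  have := exists_eq_of_not_rainbow hc hr hab.1 hax hay.1 hbx.1 hby hxy.1
  have h1 := hab.2 x hax.symm hbx.1.symm
  have h2 := hab.2 y hay.1.symm hby.symm
  have h3 := hbx.2 a hab.1 hax
  have h4 := hbx.2 y hby.symm hxy.1.symm
  have h5 := hxy.2 a hax hay.1
  have h6 := hxy.2 b hbx.1 hby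
  have h7 := hay.2 b hab.1.symm hby
  have h8 := hay.2 x hax.symm hxy.1
  simp only [Sym2.eq_swap (a := b) (b := a), Sym2.eq_swap (a := x) (b := a),
    Sym2.eq_swap (a := y) (b := a), Sym2.eq_swap (a := x) (b := b), Sym2.eq_swap (a := y) (b := b),
    Sym2.eq_swap (a := y) (b := x)] at *
  grind

theorem eq_or_eq_of_triangles_share_vertex (hc : IsStarColouring c)
    (hr : ¬ HasRainbowCopy c (⊤ : SimpleGraph (Fin 4))) {v b d y z : α}
    (hvb : (uniqueEdgeGraph c).Adj v b) (hbd : (uniqueEdgeGraph c).Adj b d)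
    (hvd : (uniqueEdgeGraph c).Adj v d)
    (hvy : (uniqueEdgeGraph c).Adj v y) (hyz : (uniqueEdgeGraph c).Adj y z)
    (hvz : (uniqueEdgeGraph c).Adj v z) : b = y ∨ b = z := by
  by_contra! h
  by_cases hdy : d = y
  · subst hdy
    exact not_uniqueEdgeGraph_four_cycle hc hr hvb hbd hyz hvz hvy.1 h.2
  · exact not_two_triangles_share_vertex hc hr hvb hbd hvd hvy hyz hvz h.1 h.2 hdy

/-- The graph of unique edges contains at most one triangle. -/
theorem mem_triangle (hc : IsStarColouring c)
    (hr : ¬ HasRainbowCopy c (⊤ : SimpleGraph (Fin 4))) {a b d x y z : α}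
    (hab : (uniqueEdgeGraph c).Adj a b) (hbd : (uniqueEdgeGraph c).Adj b d)
    (had : (uniqueEdgeGraph c).Adj a d)
    (hxy : (uniqueEdgeGraph c).Adj x y) (hyz : (uniqueEdgeGraph c).Adj y z)
    (hxz : (uniqueEdgeGraph c).Adj x z) : a = x ∨ a = y ∨ a = z := by
  have key : ∀ {v b d}, (uniqueEdgeGraph c).Adj v b → (uniqueEdgeGraph c).Adj b d →
      (uniqueEdgeGraph c).Adj v d → (v = x ∨ v = y ∨ v = z) → b = x ∨ b = y ∨ b = z := by
    rintro v b d hvb hbd hvd (rfl | rfl | rfl)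
    · exact .inr (eq_or_eq_of_triangles_share_vertex hc hr hvb hbd hvd hxy hyz hxz)
    · have := eq_or_eq_of_triangles_share_vertex hc hr hvb hbd hvd hxy.symm hxz hyz
      tauto
    · have := eq_or_eq_of_triangles_share_vertex hc hr hvb hbd hvd hxz.symm hxy hyz.symm
      tauto
  by_contra ha
  have hb := mt (key hab.symm had hbd) ha
  have hd := mt (key had.symm hab hbd.symm) ha
  simp only [not_or] at ha hb hd
  exact not_two_disjoint_triangles hc hr hab hbd had hxy hyz hxz ha.1 ha.2.1 ha.2.2
    hb.1 hb.2.1 hb.2.2 hd.1 hd.2.1 hd.2.2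

theorem exists_isAcyclic_deleteEdges [Nonempty α] (hc : IsStarColouring c)
    (hr : ¬ HasRainbowCopy c (⊤ : SimpleGraph (Fin 4))) :
    ∃ e : Sym2 α, ((uniqueEdgeGraph c).deleteEdges {e}).IsAcyclic := by
  have exists_triangle : ∀ {G : SimpleGraph α}, G ≤ uniqueEdgeGraph c → ¬ G.IsAcyclic →
      ∃ x y z, G.Adj x y ∧ G.Adj y z ∧ G.Adj x z := by
    intro G hG hcyc
    simp only [SimpleGraph.IsAcyclic, not_forall, not_not] at hcyc
    obtain ⟨v, p, hp⟩ := hcyc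
    have hlen : p.length = 3 := by
      simpa using length_eq_three_of_isCycle hc hr (hp.mapLe hG)
    have h0 := p.adj_getVert_succ (show 0 < p.length by omega)
    have h1 := p.adj_getVert_succ (show 1 < p.length by omega)
    have h2 := p.adj_getVert_succ (show 2 < p.length by omega)
    have h3 := p.getVert_length
    rw [hlen] at h3
    rw [show 2 + 1 = 3 from rfl, h3] at h2
    rw [p.getVert_zero] at h0
    exact ⟨_, _, _, h0, h1, h2.symm⟩
  by_cases h : (uniqueEdgeGraph c).IsAcyclic
  · exact ⟨s(Classical.arbitrary α, Classical.arbitrary α), h.anti (deleteEdges_le _)⟩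
  obtain ⟨a, b, d, hab, hbd, had⟩ := exists_triangle le_rfl h
  refine ⟨s(a, b), ?_⟩
  by_contra h'
  have hle := (uniqueEdgeGraph c).deleteEdges_le {s(a, b)}
  obtain ⟨x, y, z, hxy, hyz, hxz⟩ := exists_triangle hle h'
  have ha := mem_triangle hc hr hab hbd had (hle hxy) (hle hyz) (hle hxz)
  have hb := mem_triangle hc hr hab.symm had hbd (hle hxy) (hle hyz) (hle hxz)
  have hne := hab.1
  simp only [SimpleGraph.deleteEdges_adj, Set.mem_singleton_iff] at hxy hyz hxz
  grind

theorem ncard_edgeSet_lt_of_isAcyclic [Finite α] [Nonempty α] {G : SimpleGraph α}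
    (hG : G.IsAcyclic) : G.edgeSet.ncard < Nat.card α := by
  classical
  have := Fintype.ofFinite α
  obtain ⟨T, hGT, -, hT⟩ :=
    SimpleGraph.connected_top.exists_isTree_le_of_le_of_isAcyclic (le_top : G ≤ ⊤) hG
  have hcard := hT.card_edgeFinset
  have hle := Set.ncard_le_ncard (SimpleGraph.edgeSet_mono hGT) (Set.toFinite _)
  rw [Set.ncard_eq_toFinset_card' T.edgeSet] at hle
  rw [Nat.card_eq_fintype_card, ← hcard]
  exact Nat.lt_succ_of_le hle

theorem ncard_edgeSet_uniqueEdgeGraph_le [Finite α] [Nonempty α] (hc : IsStarColouring c)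
    (hr : ¬ HasRainbowCopy c (⊤ : SimpleGraph (Fin 4))) :
    (uniqueEdgeGraph c).edgeSet.ncard ≤ Nat.card α := by
  obtain ⟨e, he⟩ := exists_isAcyclic_deleteEdges hc hr
  have hlt := ncard_edgeSet_lt_of_isAcyclic he
  rw [SimpleGraph.edgeSet_deleteEdges] at hlt
  have := Set.ncard_le_ncard_sdiff_add_ncard (uniqueEdgeGraph c).edgeSet {e} (Set.toFinite _)
  rw [Set.ncard_singleton] at this
  omega

/-- The colours used on edges avoiding the vertex `v`. -/
def coloursAvoiding (c : EdgeColouring α) (v : α) : Set ℕ :=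
  c '' {e | ¬ e.IsDiag ∧ v ∉ e}

theorem coloursAvoiding_eq (c : EdgeColouring α) (v : α) :
    (fun e : Sym2 {x // x ≠ v} => c (e.map Subtype.val)) '' {e | ¬ e.IsDiag} =
      coloursAvoiding c v := by
  ext m
  constructor
  · rintro ⟨e, he, rfl⟩
    refine ⟨e.map Subtype.val, ⟨?_, ?_⟩, rfl⟩
    · rwa [Sym2.isDiag_map Subtype.val_injective]
    · rintro h
      obtain ⟨x, -, hx⟩ := Sym2.mem_map.1 h
      exact x.2 hx
  · rintro ⟨e, ⟨he, hv⟩, rfl⟩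
    induction e using Sym2.ind with
    | _ a b =>
      simp only [Sym2.mem_iff, not_or] at hv
      refine ⟨s(⟨a, Ne.symm hv.1⟩, ⟨b, Ne.symm hv.2⟩), ?_, rfl⟩
      simpa using he

theorem mem_image_uniqueEdgeGraph {v w : α} {m : ℕ} (hvw : v ≠ w)
    (hm : m ∈ c '' {e | ¬ e.IsDiag}) (hv : m ∉ coloursAvoiding c v)
    (hw : m ∉ coloursAvoiding c w) : (uniqueEdgeGraph c).Adj v w ∧ c s(v, w) = m := by
  have key : ∀ e : Sym2 α, ¬ e.IsDiag → c e = m → e = s(v, w) := fun e he hce =>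
    (Sym2.mem_and_mem_iff hvw).1
      ⟨by_contra fun h => hv ⟨e, ⟨he, h⟩, hce⟩, by_contra fun h => hw ⟨e, ⟨he, h⟩, hce⟩⟩
  obtain ⟨e, he, hce⟩ := hm
  obtain rfl := key e he hce
  refine ⟨⟨hvw, fun x hxv hxw => ⟨fun h => ?_, fun h => ?_⟩⟩, hce⟩
  · have := key s(v, x) (by simpa using hxv.symm) (h.trans hce)
    simp_all
  · have := key s(w, x) (by simpa using hxw.symm) (h.trans hce)
    simp_all

open Classical in
theorem card_filter_notMem_coloursAvoiding_le [Fintype α] {m : ℕ}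
    (hm : m ∈ c '' {e | ¬ e.IsDiag}) :
    (Finset.univ.filter fun v => m ∉ coloursAvoiding c v).card ≤
      1 + if m ∈ c '' (uniqueEdgeGraph c).edgeSet then 1 else 0 := by
  split_ifs with h
  · by_contra! hlt
    obtain ⟨x, hx, y, hy, z, hz, hxy, hxz, hyz⟩ := Finset.two_lt_card.1 hlt
    simp only [Finset.mem_filter, Finset.mem_univ, true_and] at hx hy hz
    have h1 := mem_image_uniqueEdgeGraph hxy hm hx hy
    have h2 := mem_image_uniqueEdgeGraph hxz hm hx hz
    exact (h1.1.2 z hxz.symm hyz.symm).1 (h2.2.trans h1.2.symm)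
  · by_contra! hlt
    obtain ⟨x, hx, y, hy, hxy⟩ := Finset.one_lt_card.1 hlt
    simp only [Finset.mem_filter, Finset.mem_univ, true_and] at hx hy
    exact h ⟨s(x, y), (mem_image_uniqueEdgeGraph hxy hm hx hy)⟩

theorem sum_ncard_diff_coloursAvoiding_le [Fintype α] [Nonempty α] (hc : IsStarColouring c)
    (hr : ¬ HasRainbowCopy c (⊤ : SimpleGraph (Fin 4))) :
    ∑ v, (c '' {e | ¬ e.IsDiag} \ coloursAvoiding c v).ncard ≤
      colourCount c + Fintype.card α := by
  classical
  set C := (c '' {e | ¬ e.IsDiag}).toFinset with hC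
  have hCk : C.card = colourCount c := by rw [colourCount, Set.ncard_eq_toFinset_card']
  have hS : (C.filter (· ∈ c '' (uniqueEdgeGraph c).edgeSet)).card ≤ Fintype.card α := by
    rw [← Nat.card_eq_fintype_card, ← Set.ncard_coe_finset]
    refine (Set.ncard_le_ncard (t := c '' (uniqueEdgeGraph c).edgeSet) ?_ (Set.toFinite _)).trans
      ((Set.ncard_image_le (Set.toFinite _)).trans (ncard_edgeSet_uniqueEdgeGraph_le hc hr))
    intro m hm
    simpa using (Finset.mem_filter.1 (Finset.mem_coe.1 hm)).2
  calc ∑ v, (c '' {e | ¬ e.IsDiag} \ coloursAvoiding c v).ncard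
      = ∑ v, (C.filter fun m => m ∉ coloursAvoiding c v).card := by
        refine Finset.sum_congr rfl fun v _ => ?_
        rw [← Set.ncard_coe_finset]
        congr 1
        ext m
        simp [hC]
    _ = ∑ m ∈ C, (Finset.univ.filter fun v => m ∉ coloursAvoiding c v).card :=
        Finset.sum_card_bipartiteAbove_eq_sum_card_bipartiteBelow
          (fun v m => m ∉ coloursAvoiding c v)
    _ ≤ ∑ m ∈ C, (1 + if m ∈ c '' (uniqueEdgeGraph c).edgeSet then 1 else 0) :=
        Finset.sum_le_sum fun m hm =>
          card_filter_notMem_coloursAvoiding_le (Set.mem_toFinset.1 hm)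
    _ ≤ colourCount c + Fintype.card α := by
        rw [Finset.sum_add_distrib, ← Finset.card_filter, Finset.sum_const, smul_eq_mul, mul_one,
          hCk]
        omega

end Combinatorics

theorem IsStarColouring.comp_map {α β : Type*} {c : EdgeColouring α} (hc : IsStarColouring c)
    (f : β ↪ α) : IsStarColouring fun e : Sym2 β => c (e.map f) := by
  refine ⟨fun a b x y hab hxy h => ?_, fun a b d hab hbd had => ?_⟩
  · simpa using hc.1 (f a) (f b) (f x) (f y) (by simpa) (by simpa) h
  · exact hc.2 (f a) (f b) (f d) (by simpa) (by simpa) (by simpa)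

theorem HasRainbowCopy.of_comp_map {α β γ : Type*} {c : EdgeColouring α} {f : β ↪ α}
    {H : SimpleGraph γ} (h : HasRainbowCopy (fun e : Sym2 β => c (e.map f)) H) :
    HasRainbowCopy c H := by
  obtain ⟨g, hg⟩ := h
  exact ⟨g.trans f, hg⟩

theorem colourCount_add_three_le (n : ℕ) (hn : 2 ≤ n) :
    ∀ (α : Type) [Fintype α] (c : EdgeColouring α), Fintype.card α = n → IsStarColouring c →
      ¬ HasRainbowCopy c (⊤ : SimpleGraph (Fin 4)) → colourCount c + 3 ≤ 2 * n := by
  classical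
  induction n, hn using Nat.le_induction with
  | base =>
    intro α _ c hα _ _
    have h : colourCount c ≤ {e : Sym2 α | ¬ e.IsDiag}.ncard := Set.ncard_image_le (Set.toFinite _)
    have h2 : {e : Sym2 α | ¬ e.IsDiag}.ncard = 1 := by
      have h3 := Sym2.card_subtype_not_diag (α := α)
      rw [hα, ← Nat.card_eq_fintype_card] at h3
      exact h3
    omega
  | succ n hn ih =>
    intro α _ c hα hc hr
    have : Nonempty α := Fintype.card_pos_iff.1 (by omega)
    by_contra! hlt
    have hsat : ∀ v, colourCount c + 3 - 2 * n ≤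
        (c '' {e | ¬ e.IsDiag} \ coloursAvoiding c v).ncard := by
      intro v
      have h := ih {x // x ≠ v} (fun e => c (e.map (Function.Embedding.subtype _)))
        (by simp [Fintype.card_subtype_compl, hα]) (hc.comp_map _) (fun h => hr h.of_comp_map)
      have hcount : colourCount (fun e : Sym2 {x // x ≠ v} =>
          c (e.map (Function.Embedding.subtype _))) = (coloursAvoiding c v).ncard :=
        congrArg Set.ncard (coloursAvoiding_eq c v)
      rw [hcount] at h
      have hle := Set.le_ncard_sdiff (coloursAvoiding c v) (c '' {e | ¬ e.IsDiag})
        ((Set.toFinite _).image _)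
      have : (c '' {e | ¬ e.IsDiag}).ncard = colourCount c := rfl
      omega
    have h := (Finset.sum_le_sum fun v (_ : v ∈ Finset.univ) => hsat v).trans
      (sum_ncard_diff_coloursAvoiding_le hc hr)
    rw [Finset.sum_const, smul_eq_mul, Finset.card_univ, hα] at h
    obtain ⟨t, ht⟩ := Nat.exists_eq_add_of_le (show 2 * n ≤ colourCount c by omega)
    rw [ht, show 2 * n + t + 3 - 2 * n = t + 3 by omega] at h
    nlinarith [Nat.zero_le (n * t)]

/-- Each vertex `i` of the path `0, 1, …, n - 1` is the centre of two stars: the single edge to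
its successor, and the edges to all further vertices. -/
def pathColouring (n : ℕ) : EdgeColouring (Fin n) :=
  Sym2.lift ⟨fun i j => 2 * min i.1 j.1 + if max i.1 j.1 = min i.1 j.1 + 1 then 0 else 1,
    fun i j => by simp [min_comm, max_comm]⟩

theorem pathColouring_mk {n : ℕ} (i j : Fin n) : pathColouring n s(i, j) =
    2 * min i.1 j.1 + if max i.1 j.1 = min i.1 j.1 + 1 then 0 else 1 := rfl

theorem isStarColouring_pathColouring (n : ℕ) : IsStarColouring (pathColouring n) := by
  refine ⟨fun a b x y hab hxy h => ?_, fun a b d hab hbd had h => ?_⟩ <;>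
    simp only [pathColouring_mk, ne_eq, Fin.ext_iff] at *
  · grind
  · grind

theorem not_hasRainbowCopy_pathColouring (n : ℕ) :
    ¬ HasRainbowCopy (pathColouring n) (⊤ : SimpleGraph (Fin 4)) := by
  rintro ⟨f, hf⟩
  obtain ⟨u, hu⟩ := Finite.exists_min f
  have hcard : 1 < (Finset.univ.filter fun j => j ≠ u ∧ (f j).1 ≠ (f u).1 + 1).card := by
    by_contra! hle
    have h1 : (Finset.univ.filter fun j => (f j).1 = (f u).1 + 1).card ≤ 1 := by
      rw [Finset.card_le_one]
      intro a ha b hb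
      simp only [Finset.mem_filter, Finset.mem_univ, true_and] at ha hb
      exact f.injective (Fin.ext (ha.trans hb.symm))
    have h2 : (Finset.univ : Finset (Fin 4)) ⊆ {u} ∪
        ((Finset.univ.filter fun j => (f j).1 = (f u).1 + 1) ∪
          Finset.univ.filter fun j => j ≠ u ∧ (f j).1 ≠ (f u).1 + 1) := by
      intro j _
      simp only [Finset.mem_union, Finset.mem_singleton, Finset.mem_filter, Finset.mem_univ,
        true_and]
      tauto
    have h3 := (Finset.card_le_card h2).trans (Finset.card_union_le _ _)
    have h4 := Finset.card_union_le (Finset.univ.filter fun j => (f j).1 = (f u).1 + 1)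
      (Finset.univ.filter fun j => j ≠ u ∧ (f j).1 ≠ (f u).1 + 1)
    simp only [Finset.card_univ, Fintype.card_fin, Finset.card_singleton] at h3
    omega
  obtain ⟨j, hj, k, hk, hjk⟩ := Finset.one_lt_card.1 hcard
  simp only [Finset.mem_filter, Finset.mem_univ, true_and] at hj hk
  have hcol : ∀ i, i ≠ u ∧ (f i).1 ≠ (f u).1 + 1 →
      pathColouring n s(f u, f i) = 2 * (f u).1 + 1 := fun i hi => by
    rw [pathColouring_mk, min_eq_left (Fin.le_def.1 (hu i)), max_eq_right (Fin.le_def.1 (hu i)),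
      if_neg hi.2]
  refine hf u j u k hj.1.symm hk.1.symm ?_ ((hcol j hj).trans (hcol k hk).symm)
  simp [hjk, hj.1]

theorem colourCount_pathColouring {n : ℕ} (hn : 2 ≤ n) :
    colourCount (pathColouring n) = 2 * n - 3 := by
  have himage : pathColouring n '' {e | ¬ e.IsDiag} = Finset.range (2 * n - 3) := by
    ext m
    rw [Finset.coe_range, Set.mem_Iio]
    constructor
    · rintro ⟨e, he, rfl⟩
      induction e using Sym2.ind with
      | _ i j =>
        have hij : i.1 ≠ j.1 := fun h => he (by simpa using Fin.ext h)
        have := i.2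
        have := j.2
        rw [pathColouring_mk]
        grind
    · intro hm
      obtain ⟨q, rfl | rfl⟩ := Nat.even_or_odd' m
      · refine ⟨s(⟨q, by omega⟩, ⟨q + 1, by omega⟩), by simp, ?_⟩
        simp [pathColouring_mk]
      · refine ⟨s(⟨q, by omega⟩, ⟨q + 2, by omega⟩), by simp, ?_⟩
        simp [pathColouring_mk]
  rw [colourCount, himage, Set.ncard_coe_finset, Finset.card_range]

/-- For all integers `n ≥ 4`, `ar*(n, K_4) = 2n - 3`. -/
theorem starAntiRamsey_K4 (n : ℕ) (hn : 4 ≤ n) :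
    starAntiRamsey n (⊤ : SimpleGraph (Fin 4)) = 2 * n - 3 := by
  refine IsGreatest.csSup_eq ⟨⟨pathColouring n, isStarColouring_pathColouring n,
    colourCount_pathColouring (by omega), not_hasRainbowCopy_pathColouring n⟩, ?_⟩
  rintro _ ⟨c, hc, rfl, hr⟩
  have := colourCount_add_three_le n (by omega) (Fin n) c (Fintype.card_fin n) hc hr
  omega
end

section
/- For all integers n ≥ 2, the star-anti-Ramsey number of K_4 minus an edge satisfies ar*(n, K_4^-) = ⌊3(n-1)/2⌋. -/
open SimpleGraph

/-- `K_4` minus one edge. -/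
def K4minus : SimpleGraph (Fin 4) := (⊤ : SimpleGraph (Fin 4)).deleteEdges {s(0, 1)}

/-- The properties of the colour function `d a b = c s(a, b)` of a star-colouring `c` without a
rainbow `K_4^-`, restricted to pairs of distinct vertices. -/
structure IsStarK4minusFree {α : Type*} (d : α → α → ℕ) : Prop where
  symm : ∀ a b, d a b = d b a
  meet : ∀ a b x y, a ≠ b → x ≠ y → d a b = d x y → a = x ∨ a = y ∨ b = x ∨ b = y
  triangle : ∀ a b e, a ≠ b → b ≠ e → a ≠ e → ¬(d a b = d b e ∧ d b e = d a e)
  not_rainbow : ∀ p q r s, p ≠ q → p ≠ r → p ≠ s → q ≠ r → q ≠ s → r ≠ s →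
    ¬[d p r, d p s, d q r, d q s, d r s].Nodup

theorem hasRainbowCopy_K4minus_iff {α : Type*} (c : EdgeColouring α) :
    HasRainbowCopy c K4minus ↔ ∃ p q r s : α, p ≠ q ∧ p ≠ r ∧ p ≠ s ∧ q ≠ r ∧ q ≠ s ∧ r ≠ s ∧
      [c s(p, r), c s(p, s), c s(q, r), c s(q, s), c s(r, s)].Nodup := by
  constructor
  · rintro ⟨f, hf⟩
    refine ⟨f 0, f 1, f 2, f 3, ?_, ?_, ?_, ?_, ?_, ?_, ?_⟩
    iterate 6 exact f.injective.ne (by decide)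
    have hf' : ∀ u v x y : Fin 4, (u ≠ v ∧ s(u, v) ≠ s(0, 1)) → (x ≠ y ∧ s(x, y) ≠ s(0, 1)) →
        s(u, v) ≠ s(x, y) → c s(f u, f v) ≠ c s(f x, f y) := by
      intro u v x y h1 h2
      exact hf u v x y (by simpa [K4minus] using h1) (by simpa [K4minus] using h2)
    simp only [List.nodup_cons, List.mem_cons, not_or, List.not_mem_nil, not_false_eq_true,
      List.nodup_nil, and_true]
    refine ⟨⟨?_, ?_, ?_, ?_⟩, ⟨?_, ?_, ?_⟩, ⟨?_, ?_⟩, ?_⟩ <;>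
      exact hf' _ _ _ _ (by decide) (by decide) (by decide)
  · rintro ⟨p, q, r, s, hpq, hpr, hps, hqr, hqs, hrs, h⟩
    simp only [List.nodup_cons, List.mem_cons, not_or, List.not_mem_nil, not_false_eq_true,
      List.nodup_nil, and_true] at h
    obtain ⟨⟨h1, h2, h3, h4⟩, ⟨h5, h6, h7⟩, ⟨h8, h9⟩, h10⟩ := h
    refine ⟨⟨![p, q, r, s], ?_⟩, ?_⟩
    · intro i j hij
      fin_cases i <;> fin_cases j <;> simp_all
    · intro u v x y huv hxy hne
      simp only [K4minus, deleteEdges_adj, top_adj, Set.mem_singleton_iff] at huv hxy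
      change c s(![p, q, r, s] u, ![p, q, r, s] v) ≠ c s(![p, q, r, s] x, ![p, q, r, s] y)
      have e : ∀ a b : α, c s(a, b) = c s(b, a) := fun a b => by rw [Sym2.eq_swap]
      fin_cases u <;> fin_cases v <;> first | (exfalso; revert huv; decide) | skip
      all_goals fin_cases x <;> fin_cases y <;>
        first
        | (exfalso; revert hxy; decide)
        | (exfalso; revert hne; decide)
        | (clear huv hxy hne; simp; grind)

theorem IsStarColouring.isStarK4minusFree {α : Type*} {c : EdgeColouring α}
    (hc : IsStarColouring c) (hr : ¬ HasRainbowCopy c K4minus) :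
    IsStarK4minusFree fun a b => c s(a, b) where
  symm a b := by rw [Sym2.eq_swap]
  meet := hc.1
  triangle := hc.2
  not_rainbow p q r s h1 h2 h3 h4 h5 h6 h :=
    hr ((hasRainbowCopy_K4minus_iff c).2 ⟨p, q, r, s, h1, h2, h3, h4, h5, h6, h⟩)

section UpperBound

variable {α : Type*}

/-- The colours used on pairs of distinct vertices of `W`. -/
def coloursOn (d : α → α → ℕ) (W : Finset α) : Finset ℕ :=
  W.offDiag.image fun p => d p.1 p.2

/-- The colour `m` occurs at `v`, and every pair in `W` of colour `m` contains `v`. -/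
def Saturates (d : α → α → ℕ) (W : Finset α) (v : α) (m : ℕ) : Prop :=
  (∃ x ∈ W, v ≠ x ∧ d v x = m) ∧ ∀ x ∈ W, ∀ y ∈ W, x ≠ y → d x y = m → v = x ∨ v = y

variable {d : α → α → ℕ} {W : Finset α} {a b u v : α} {m : ℕ}

theorem mem_coloursOn : m ∈ coloursOn d W ↔ ∃ x ∈ W, ∃ y ∈ W, x ≠ y ∧ d x y = m := by
  simp only [coloursOn, Finset.mem_image, Finset.mem_offDiag, Prod.exists]
  grind

/-- Pairwise intersecting edges that contain no triangle have a common vertex. -/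
theorem saturates_or_saturates (hd : IsStarK4minusFree d) (ha : a ∈ W) (hb : b ∈ W)
    (hab : a ≠ b) : Saturates d W a (d a b) ∨ Saturates d W b (d a b) := by
  have hs := hd.symm
  by_contra! h
  obtain ⟨h1, h2⟩ := h
  simp only [Saturates, not_and, not_forall] at h1 h2
  obtain ⟨x, hx, y, hy, hxy, h3, h4⟩ := h1 ⟨b, hb, hab, rfl⟩
  obtain ⟨z, hz, w, hw, hzw, h5, h6⟩ := h2 ⟨a, ha, hab.symm, hs b a⟩
  have m1 := hd.meet a b x y hab hxy h3.symm
  have m2 := hd.meet a b z w hab hzw h5.symm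
  have m3 := hd.meet x y z w hxy hzw (h3.trans h5.symm)
  have t1 := hd.triangle a b x
  have t2 := hd.triangle a b y
  grind

variable [DecidableEq α]

/-- The colours on `W` that disappear when the vertices in `U` are removed. -/
def lostColours (d : α → α → ℕ) (W U : Finset α) : Finset ℕ :=
  coloursOn d W \ coloursOn d (W \ U)

theorem mem_lostColours_singleton (hd : IsStarK4minusFree d) (hv : v ∈ W) :
    m ∈ lostColours d W {v} ↔ Saturates d W v m := by
  have := hd.symm
  simp only [lostColours, Finset.mem_sdiff, mem_coloursOn, Finset.mem_singleton, Saturates]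
  constructor
  · rintro ⟨⟨x, hx, y, hy, hxy, h⟩, h'⟩
    refine ⟨?_, by grind⟩
    by_cases hvx : v = x
    · exact ⟨y, hy, by grind, by grind⟩
    · exact ⟨x, hx, by grind, by grind⟩
  · rintro ⟨⟨x, hx, hvx, h⟩, h'⟩
    exact ⟨⟨v, hv, x, hx, hvx, h⟩, by grind⟩

theorem card_lostColours_singleton_le (hd : IsStarK4minusFree d) (hv : v ∈ W) :
    (lostColours d W {v}).card ≤ 2 := by
  by_contra! h
  obtain ⟨i, j, k, hi, hj, hk, hij, hik, hjk⟩ := Finset.two_lt_card_iff.1 h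
  rw [mem_lostColours_singleton hd hv] at hi hj hk
  obtain ⟨⟨x, hx, hvx, rfl⟩, h1⟩ := hi
  obtain ⟨⟨y, hy, hvy, rfl⟩, h2⟩ := hj
  obtain ⟨⟨z, hz, hvz, rfl⟩, h3⟩ := hk
  have hxy : x ≠ y := by grind
  have hxz : x ≠ z := by grind
  have hyz : y ≠ z := by grind
  have hs := hd.symm
  have k1 := hd.not_rainbow x z v y
  have k2 := hd.not_rainbow x y v z
  have t := hd.triangle x y z hxy hyz hxz
  have e1 := h1 y hy z hz hyz
  have e2 := h1 x hx y hy hxy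
  have e3 := h1 x hx z hz hxz
  have f1 := h2 y hy z hz hyz
  have f2 := h2 x hx y hy hxy
  have f3 := h2 x hx z hz hxz
  have g1 := h3 y hy z hz hyz
  have g2 := h3 x hx y hy hxy
  have g3 := h3 x hx z hz hxz
  simp only [List.nodup_cons, List.mem_cons, not_or, List.not_mem_nil, not_false_eq_true,
      List.nodup_nil, and_true] at k1 k2
  grind

/-- If the pair `u v` is a whole colour class and both `u` and `v` saturate a further colour, then
some `x` forms with `u` and `v` a rainbow triangle of saturated colours. -/
theorem exists_saturated_triangle (hd : IsStarK4minusFree d) (hu : u ∈ W) (hv : v ∈ W)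
    (huv : u ≠ v) (hsu : Saturates d W u (d u v)) (hsv : Saturates d W v (d u v)) {i j : ℕ}
    (hi : Saturates d W u i) (hiv : i ≠ d u v) (hj : Saturates d W v j) (hju : j ≠ d u v) :
    ∃ x ∈ W, u ≠ x ∧ v ≠ x ∧ d u x = i ∧ d v x = j := by
  have hs := hd.symm
  obtain ⟨⟨x, hx, hux, rfl⟩, h1⟩ := hi
  obtain ⟨⟨y, hy, hvy, rfl⟩, h2⟩ := hj
  have hvx : v ≠ x := by grind
  have huy : u ≠ y := by grind
  by_contra! h
  have hne : d v x ≠ d v y := h x hx hux hvx rfl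
  have hne' : d u y ≠ d u x := fun e => h y hy huy hvy e rfl
  have hxy : x ≠ y := by grind
  have hij : d u x ≠ d v y := by grind
  have m := hd.meet u y v x huy hvx
  have k1 := hd.not_rainbow u y v x
  have k2 := hd.not_rainbow v x u y
  have e1 := h1 x hx y hy hxy
  have e2 := h2 x hx y hy hxy
  have e3 := hsu.2 x hx y hy hxy
  have e4 := h1 v hv x hx hvx
  have e5 := h2 u hu y hy huy
  have e6 := hsu.2 v hv x hx hvx
  have e7 := hsv.2 u hu y hy huy
  have k3 := hd.not_rainbow u x v y
  have k4 := hd.not_rainbow v y u x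
  simp only [List.nodup_cons, List.mem_cons, not_or, List.not_mem_nil, not_false_eq_true,
      List.nodup_nil, and_true] at k1 k2 k3 k4
  grind

theorem card_lostColours_pair_le (hd : IsStarK4minusFree d) (hu : u ∈ W) (hv : v ∈ W)
    (huv : u ≠ v) (hsu : Saturates d W u (d u v)) (hsv : Saturates d W v (d u v))
    (hcu : 1 < (lostColours d W {u}).card) (hcv : 1 < (lostColours d W {v}).card) :
    (lostColours d W {u, v}).card ≤ 3 := by
  have hs := hd.symm
  obtain ⟨i, hi, hi'⟩ := Finset.exists_mem_ne hcu (d u v)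
  obtain ⟨j, hj, hj'⟩ := Finset.exists_mem_ne hcv (d u v)
  rw [mem_lostColours_singleton hd hu] at hi
  rw [mem_lostColours_singleton hd hv] at hj
  obtain ⟨x, hx, hux, hvx, rfl, rfl⟩ := exists_saturated_triangle hd hu hv huv hsu hsv hi hi' hj hj'
  have hsub : lostColours d W {u, v} ⊆ lostColours d W {u} ∪ lostColours d W {v} := by
    intro m hm
    rw [Finset.mem_union, mem_lostColours_singleton hd hu, mem_lostColours_singleton hd hv]
    by_contra! hcon
    obtain ⟨hnu, hnv⟩ := hcon
    simp only [lostColours, Finset.mem_sdiff, mem_coloursOn, Finset.mem_insert,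
      Finset.mem_singleton] at hm
    obtain ⟨⟨p, hp, q, hq, hpq, rfl⟩, hm⟩ := hm
    have hsat : ∃ w ∈ W, Saturates d W w (d p q) := by
      rcases saturates_or_saturates hd hp hq hpq with h | h
      exacts [⟨p, hp, h⟩, ⟨q, hq, h⟩]
    obtain ⟨w, hw, hsw⟩ := hsat
    have hwu : w ≠ u := by grind
    have hwv : w ≠ v := by grind
    have hall : ∀ y ∈ W, w ≠ y → d w y = d p q → y = u ∨ y = v := by
      intro y hy hwy h
      by_contra! hne
      exact hm ⟨w, by grind, y, by grind, hwy, h⟩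
    have hwu' : d w u = d p q := by
      by_contra hne
      refine hnv ⟨?_, ?_⟩ <;> grind [Saturates]
    have hwv' : d w v = d p q := by
      by_contra hne
      refine hnu ⟨?_, ?_⟩ <;> grind [Saturates]
    have hwx : w ≠ x := by grind [Saturates]
    have hwx' : d w x ≠ d p q := fun h => by grind
    have k := hd.not_rainbow w u v x
    have k' := hd.not_rainbow u w v x
    have e1 := hsu.2 w hw x hx hwx
    have e2 := hi.2 w hw x hx hwx
    have e3 := hj.2 w hw x hx hwx
    have e4 := hsu.2 w hw v hv hwv
    have e5 := hi.2 w hw v hv hwv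
    have e6 := hj.2 w hw u hu hwu
    have e7 := hi.2 v hv x hx hvx
    simp only [List.nodup_cons, List.mem_cons, not_or, List.not_mem_nil, not_false_eq_true,
      List.nodup_nil, and_true] at k k'
    grind
  have hmem : d u v ∈ lostColours d W {u} ∩ lostColours d W {v} := by
    rw [Finset.mem_inter, mem_lostColours_singleton hd hu, mem_lostColours_singleton hd hv]
    exact ⟨hsu, hsv⟩
  have h1 := Finset.card_le_card hsub
  have h2 := Finset.card_union_add_card_inter (lostColours d W {u}) (lostColours d W {v})
  have h3 := Finset.card_pos.2 ⟨_, hmem⟩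
  have h4 := card_lostColours_singleton_le hd hu
  have h5 := card_lostColours_singleton_le hd hv
  omega

open Classical in
/-- The vertices of `W` that saturate the colour of their edge to `v`. -/
noncomputable def saturatedInNeighbours (d : α → α → ℕ) (W : Finset α) (v : α) : Finset α :=
  W.filter fun r => r ≠ v ∧ Saturates d W r (d r v)

theorem mem_saturatedInNeighbours {r : α} :
    r ∈ saturatedInNeighbours d W v ↔ r ∈ W ∧ r ≠ v ∧ Saturates d W r (d r v) := by
  simp [saturatedInNeighbours]

theorem saturates_of_card_saturatedInNeighbours_le (hd : IsStarK4minusFree d) (hv : v ∈ W)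
    (ha : a ∈ W) (hb : b ∈ W) (hva : v ≠ a) (hvb : v ≠ b) (hsa : Saturates d W v (d v a))
    (hsb : Saturates d W v (d v b)) (hne : d v a ≠ d v b) (hab : Saturates d W a (d a b))
    (hle : (saturatedInNeighbours d W b).card ≤ (saturatedInNeighbours d W v).card) :
    Saturates d W a (d v a) := by
  have hs := hd.symm
  by_contra hcon
  have hab' : a ≠ b := by grind
  have hsub : insert v (insert a ((saturatedInNeighbours d W v).erase b)) ⊆
      saturatedInNeighbours d W b := by
    intro r hr
    rw [Finset.mem_insert, Finset.mem_insert, Finset.mem_erase, mem_saturatedInNeighbours] at hr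
    rw [mem_saturatedInNeighbours]
    rcases hr with rfl | rfl | ⟨hrb, hr, hrv, hsr⟩
    · exact ⟨hv, hvb, hsb⟩
    · exact ⟨ha, hab', hab⟩
    · refine ⟨hr, hrb, ?_⟩
      have hra : r ≠ a := by
        rintro rfl
        exact hcon (hs r v ▸ hsr)
      have k := hd.not_rainbow r a v b
      have e1 := hsa.2 a ha b hb hab'
      have e2 := hsb.2 a ha b hb hab'
      have e3 := hsr.2 a ha b hb hab'
      have e4 := hsr.2 v hv a ha hva
      have e5 := hsr.2 v hv b hb hvb
      have e6 := hsa.2 r hr b hb hrb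
      have e7 := hsb.2 r hr b hb hrb
      have e8 := hab.2 r hr b hb hrb
      have : d r b = d r v := by
        simp only [List.nodup_cons, List.mem_cons, not_or, List.not_mem_nil, not_false_eq_true,
          List.nodup_nil, and_true] at k
        grind
      rwa [this]
  have h1 := Finset.card_le_card hsub
  have h2 : v ∉ insert a ((saturatedInNeighbours d W v).erase b) := by
    simp [mem_saturatedInNeighbours, hva]
  have h3 : a ∉ (saturatedInNeighbours d W v).erase b := by
    simp only [Finset.mem_erase, mem_saturatedInNeighbours, not_and]
    intro _ _ _ h
    exact hcon (hs a v ▸ h)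
  rw [Finset.card_insert_of_notMem h2, Finset.card_insert_of_notMem h3] at h1
  have h4 := Finset.pred_card_le_card_erase (s := saturatedInNeighbours d W v) (a := b)
  omega

theorem exists_pair_card_lostColours_le (hd : IsStarK4minusFree d) (hW : W.Nonempty)
    (h : ∀ v ∈ W, 1 < (lostColours d W {v}).card) :
    ∃ u v x, u ∈ W ∧ v ∈ W ∧ x ∈ W ∧ u ≠ v ∧ x ≠ u ∧ x ≠ v ∧
      (lostColours d W {u, v}).card ≤ 3 := by
  have hs := hd.symm
  obtain ⟨v, hv, hmax⟩ := Finset.exists_max_image W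
    (fun v => (saturatedInNeighbours d W v).card) hW
  obtain ⟨i, hi, j, hj, hij⟩ := Finset.one_lt_card.1 (h v hv)
  rw [mem_lostColours_singleton hd hv] at hi hj
  obtain ⟨a, ha, hva, rfl⟩ := hi.1
  obtain ⟨b, hb, hvb, rfl⟩ := hj.1
  have hab : a ≠ b := by grind
  rcases saturates_or_saturates hd ha hb hab with hsat | hsat
  · exact ⟨v, a, b, hv, ha, hb, hva, hvb.symm, hab.symm, card_lostColours_pair_le hd hv ha hva hi
      (saturates_of_card_saturatedInNeighbours_le hd hv ha hb hva hvb hi hj hij hsat (hmax b hb))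
      (h v hv) (h a ha)⟩
  · rw [hs] at hsat
    exact ⟨v, b, a, hv, hb, ha, hvb, hva.symm, hab, card_lostColours_pair_le hd hv hb hvb hj
      (saturates_of_card_saturatedInNeighbours_le hd hv hb ha hvb hva hj hi hij.symm hsat
        (hmax a ha)) (h v hv) (h b hb)⟩

theorem card_coloursOn_le_add (U : Finset α) :
    (coloursOn d W).card ≤ (lostColours d W U).card + (coloursOn d (W \ U)).card := by
  have := Finset.le_card_sdiff (coloursOn d (W \ U)) (coloursOn d W)
  unfold lostColours
  omega

theorem two_mul_card_coloursOn_add_three_le (hd : IsStarK4minusFree d) :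
    ∀ W : Finset α, W.Nonempty → 2 * (coloursOn d W).card + 3 ≤ 3 * W.card := by
  intro W
  induction W using Finset.strongInduction with
  | H W ih =>
    intro hW
    by_cases h : ∀ v ∈ W, 1 < (lostColours d W {v}).card
    · obtain ⟨u, v, x, hu, hv, hx, huv, hxu, hxv, hle⟩ := exists_pair_card_lostColours_le hd hW h
      have h1 := ih (W \ {u, v}) (Finset.sdiff_ssubset (by grind) (by simp)) ⟨x, by grind⟩
      have h2 := Finset.card_sdiff_add_card_eq_card (s := {u, v}) (t := W) (by grind)
      have h3 := card_coloursOn_le_add (d := d) (W := W) {u, v}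
      rw [Finset.card_pair huv] at h2
      omega
    · push Not at h
      obtain ⟨v, hv, hle⟩ := h
      rcases (W \ {v}).eq_empty_or_nonempty with he | hne
      · have hW1 : W = {v} :=
          (Finset.sdiff_eq_empty_iff_subset.1 he).antisymm (Finset.singleton_subset_iff.2 hv)
        simp [coloursOn, hW1]
      · have h1 := ih (W \ {v}) (Finset.sdiff_ssubset (by grind) (by simp)) hne
        have h2 := Finset.card_sdiff_add_card_eq_card (s := {v}) (t := W) (by grind)
        have h3 := card_coloursOn_le_add (d := d) (W := W) {v}
        rw [Finset.card_singleton] at h2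
        omega

end UpperBound

theorem colourCount_eq_card_coloursOn {α : Type*} [DecidableEq α] [Fintype α]
    (c : EdgeColouring α) :
    colourCount c = (coloursOn (fun a b => c s(a, b)) Finset.univ).card := by
  rw [colourCount, ← Set.ncard_coe_finset]
  congr 1
  ext m
  simp only [Set.mem_image, Set.mem_ofPred_eq, Finset.mem_coe, mem_coloursOn, Finset.mem_univ,
    true_and]
  constructor
  · rintro ⟨e, he, rfl⟩
    induction e with
    | h x y => exact ⟨x, y, by simpa using he, rfl⟩
  · rintro ⟨x, y, hxy, rfl⟩
    exact ⟨s(x, y), by simpa using hxy, rfl⟩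

/-- The colour of the pair `{i, j}` in the extremal colouring: the vertices `2k` and `2k + 1` are
joined by a private colour, and each of them has a private colour towards all larger vertices. -/
def pairedColour (i j : ℕ) : ℕ :=
  if i / 2 = j / 2 then 3 * (min i j / 2) else 3 * (min i j / 2) + 1 + min i j % 2

theorem pairedColour_comm (i j : ℕ) : pairedColour i j = pairedColour j i := by
  simp only [pairedColour, min_comm, eq_comm]

/-- The extremal star-colouring of `K_n` without a rainbow `K_4^-`. -/
def pairedColouring (n : ℕ) : EdgeColouring (Fin n) :=
  Sym2.lift ⟨fun i j => pairedColour i j, fun i j => pairedColour_comm i j⟩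

theorem pairedColouring_mk {n : ℕ} (i j : Fin n) :
    pairedColouring n s(i, j) = pairedColour i j := rfl

theorem isStarColouring_pairedColouring (n : ℕ) : IsStarColouring (pairedColouring n) := by
  constructor
  · intro a b x y hab hxy h
    simp only [pairedColouring_mk, pairedColour, Fin.ext_iff, ne_eq] at *
    split_ifs at h <;> omega
  · intro a b e hab hbe hae h
    simp only [pairedColouring_mk, pairedColour, Fin.ext_iff, ne_eq] at *
    split_ifs at h <;> omega

theorem pairedColour_eq_of_half_lt {m x y : ℕ} (hx : m / 2 < x / 2) (hy : m / 2 < y / 2) :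
    pairedColour m x = pairedColour m y := by
  simp [pairedColour, hx.ne, hy.ne, (show m ≤ x by omega), (show m ≤ y by omega)]

theorem half_ne_of_ne {x y z : ℕ} (hxy : x ≠ y) (hxz : x ≠ z) (hyz : y ≠ z) :
    ¬(x / 2 = y / 2 ∧ y / 2 = z / 2) := by
  omega

theorem not_hasRainbowCopy_pairedColouring (n : ℕ) :
    ¬ HasRainbowCopy (pairedColouring n) K4minus := by
  rw [hasRainbowCopy_K4minus_iff]
  rintro ⟨p, q, r, s, hpq, hpr, hps, hqr, hqs, hrs, h⟩
  simp only [List.nodup_cons, List.mem_cons, not_or, List.not_mem_nil, not_false_eq_true,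
    List.nodup_nil, and_true, pairedColouring_mk] at h
  simp only [Fin.ext_iff, ne_eq] at hpq hpr hps hqr hqs hrs
  obtain ⟨⟨h1, h2, h3, h4⟩, ⟨h5, h6, h7⟩, ⟨h8, h9⟩, h10⟩ := h
  have key : ∀ {m x y : ℕ}, pairedColour m x ≠ pairedColour m y →
      ¬(m / 2 < x / 2 ∧ m / 2 < y / 2) :=
    fun hne ⟨hx, hy⟩ => hne (pairedColour_eq_of_half_lt hx hy)
  have k1 := key h1
  have k2 := key h8
  have k3 := key (m := r) (x := p) (y := q) (by simpa only [pairedColour_comm] using h2)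
  have k4 := key (m := r) (x := p) (y := s) (by rwa [pairedColour_comm])
  have k5 := key (m := r) (x := q) (y := s) (by rwa [pairedColour_comm])
  have k6 := key (m := s) (x := p) (y := q) (by
    rwa [pairedColour_comm, pairedColour_comm s])
  have k7 := key (m := s) (x := p) (y := r) (by
    rwa [pairedColour_comm, pairedColour_comm s])
  have k8 := key (m := s) (x := q) (y := r) (by
    rwa [pairedColour_comm, pairedColour_comm s])
  have t1 := half_ne_of_ne hpq hpr hqr
  have t2 := half_ne_of_ne hpq hps hqs
  have t3 := half_ne_of_ne hpr hps hrs
  have t4 := half_ne_of_ne hqr hqs hrs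
  clear hpq hpr hps hqr hqs hrs h1 h2 h3 h4 h5 h6 h7 h8 h9 h10 key
  generalize (p : ℕ) / 2 = p', (q : ℕ) / 2 = q', (r : ℕ) / 2 = r', (s : ℕ) / 2 = s' at *
  omega

theorem le_colourCount_pairedColouring (n : ℕ) :
    3 * (n - 1) / 2 ≤ colourCount (pairedColouring n) := by
  rw [colourCount_eq_card_coloursOn, ← Finset.card_range (3 * (n - 1) / 2)]
  refine Finset.card_le_card fun m hm => ?_
  rw [Finset.mem_range] at hm
  rw [mem_coloursOn]
  obtain ⟨x, y, hxy, hy, h⟩ : ∃ x y, x < y ∧ y < n ∧ pairedColour x y = m := by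
    have h3 : m % 3 = 0 ∨ m % 3 = 1 ∨ m % 3 = 2 := by omega
    rcases h3 with h3 | h3 | h3
    · refine ⟨2 * (m / 3), 2 * (m / 3) + 1, by omega, by omega, ?_⟩
      simp only [pairedColour]
      split_ifs <;> omega
    · refine ⟨2 * (m / 3), 2 * (m / 3) + 2, by omega, by omega, ?_⟩
      simp only [pairedColour]
      split_ifs <;> omega
    · refine ⟨2 * (m / 3) + 1, 2 * (m / 3) + 2, by omega, by omega, ?_⟩
      simp only [pairedColour]
      split_ifs <;> omega
  exact ⟨⟨x, hxy.trans hy⟩, Finset.mem_univ _, ⟨y, hy⟩, Finset.mem_univ _,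
    by simpa using hxy.ne, h⟩

theorem colourCount_le_s2 {n : ℕ} (hn : 2 ≤ n) {c : EdgeColouring (Fin n)} (hc : IsStarColouring c)
    (hr : ¬ HasRainbowCopy c K4minus) : colourCount c ≤ 3 * (n - 1) / 2 := by
  have h := two_mul_card_coloursOn_add_three_le (hc.isStarK4minusFree hr) Finset.univ
    ⟨⟨0, by omega⟩, Finset.mem_univ _⟩
  rw [Finset.card_univ, Fintype.card_fin, ← colourCount_eq_card_coloursOn] at h
  omega

/-- For all integers `n ≥ 2`, `ar*(n, K_4^-) = ⌊3(n-1)/2⌋`. -/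
theorem starAntiRamsey_K4minus (n : ℕ) (hn : 2 ≤ n) :
    starAntiRamsey n K4minus = 3 * (n - 1) / 2 := by
  refine IsGreatest.csSup_eq ⟨⟨pairedColouring n, isStarColouring_pairedColouring n, ?_,
    not_hasRainbowCopy_pairedColouring n⟩, ?_⟩
  · exact le_antisymm (colourCount_le_s2 hn (isStarColouring_pairedColouring n)
      (not_hasRainbowCopy_pairedColouring n)) (le_colourCount_pairedColouring n)
  · rintro s ⟨c, hc, rfl, hr⟩
    exact colourCount_le_s2 hn hc hr
end

section
/- For every ε > 0 there exists n_0 such that for all n ≥ n_0, the star-anti-Ramsey number of K_5 minus an edge satisfies (1-ε)·(n/2)^{3/2} ≤ ar*(n, K_5^-) ≤ (16+ε)·(n/2)^{3/2}. -/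
open SimpleGraph

/-- `K_5` minus one edge. -/
def K5minus : SimpleGraph (Fin 5) := (⊤ : SimpleGraph (Fin 5)).deleteEdges {s(0, 1)}

/-- The Fourier transform of the triangle function `t ↦ max (l - |t|) 0`. -/
noncomputable def fejerKernel (l u : ℝ) : ℝ :=
  ∫ t in -l..l, (l - |t|) * Real.cos (t * u)

theorem fejerKernel_eq {l u : ℝ} (hl : 0 ≤ l) (hu : u ≠ 0) :
    fejerKernel l u = 2 * (1 - Real.cos (l * u)) / u ^ 2 := by
  have hc : Continuous fun t : ℝ => (l - |t|) * Real.cos (t * u) := by fun_prop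
  have h0 : ∫ t in (0 : ℝ)..l, (l - |t|) * Real.cos (t * u) =
      (1 - Real.cos (l * u)) / u ^ 2 := by
    have h1 : ∫ t in (0 : ℝ)..l, (l - |t|) * Real.cos (t * u) =
        ∫ t in (0 : ℝ)..l, (l - t) * Real.cos (t * u) := by
      refine intervalIntegral.integral_congr fun t ht => ?_
      rw [Set.uIcc_of_le hl] at ht
      simp only [abs_of_nonneg ht.1]
    have h2 : ∀ t ∈ Set.uIcc 0 l, HasDerivAt
        (fun t => (l - t) * Real.sin (t * u) / u - Real.cos (t * u) / u ^ 2)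
        ((l - t) * Real.cos (t * u)) t := by
      intro t _
      have hm : HasDerivAt (fun t : ℝ => t * u) u t := by
        simpa using (hasDerivAt_id t).mul_const u
      have hl' : HasDerivAt (fun t : ℝ => l - t) (-1) t := by
        simpa using (hasDerivAt_id t).const_sub l
      refine (((hl'.mul hm.sin).div_const u).sub
        (hm.cos.div_const (u ^ 2))).congr_deriv ?_
      field_simp
      ring
    rw [h1, intervalIntegral.integral_eq_sub_of_hasDerivAt h2
      (Continuous.intervalIntegrable (by fun_prop) _ _)]
    simp
    ring
  have h1 : ∫ t in (-l)..0, (l - |t|) * Real.cos (t * u) =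
      ∫ t in (0 : ℝ)..l, (l - |t|) * Real.cos (t * u) := by
    have := intervalIntegral.integral_comp_neg (a := 0) (b := l)
      (fun t : ℝ => (l - |t|) * Real.cos (t * u))
    simpa using this.symm
  rw [fejerKernel, ← intervalIntegral.integral_add_adjacent_intervals (b := 0)
    (hc.intervalIntegrable _ _) (hc.intervalIntegrable _ _), h1, h0]
  ring

theorem fejerKernel_nonneg {l : ℝ} (hl : 0 ≤ l) (u : ℝ) : 0 ≤ fejerKernel l u := by
  rcases eq_or_ne u 0 with rfl | hu
  · refine intervalIntegral.integral_nonneg (by linarith) fun t ht => ?_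
    have := abs_le.2 ht
    simpa using this
  · rw [fejerKernel_eq hl hu]
    have := Real.cos_le_one (l * u)
    positivity [sub_nonneg.2 this]

theorem fejerKernel_le {l u : ℝ} (hl : 0 ≤ l) (hu : u ≠ 0) :
    fejerKernel l u ≤ 4 / u ^ 2 := by
  rw [fejerKernel_eq hl hu]
  have := Real.neg_one_le_cos (l * u)
  gcongr
  linarith

theorem le_fejerKernel {l u : ℝ} (hl : 0 ≤ l) (hu : u ≠ 0) (h : |l * u| ≤ 1) :
    l ^ 2 / 2 ≤ fejerKernel l u := by
  rw [fejerKernel_eq hl hu, le_div_iff₀ (by positivity)]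
  have h1 := (abs_le.1 (Real.cos_bound h)).2
  have h2 : |l * u| ^ 4 ≤ (l * u) ^ 2 := by
    rw [← sq_abs (l * u)]
    exact pow_le_pow_of_le_one (abs_nonneg _) h (by norm_num)
  nlinarith

theorem exists_continuousOn_eq_LSeries_vonMangoldt_sub_one :
    ∃ h : ℂ → ℂ, ContinuousOn h {s | 1 ≤ s.re} ∧ ∀ s : ℂ, 1 < s.re →
      LSeriesHasSum (fun n => (ArithmeticFunction.vonMangoldt n : ℂ) - 1) s (h s) := by
  classical
  let z : ℂ → ℂ := Function.update (fun s => riemannZeta s - 1 / (s - 1)) 1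
    (Real.eulerMascheroniConstant : ℂ)
  have hz : Continuous z := by
    rw [continuous_iff_continuousAt]
    intro s
    rcases eq_or_ne s 1 with rfl | hs
    · exact continuousAt_update_same.2 tendsto_riemannZeta_sub_one_div
    · rw [continuousAt_update_of_ne hs]
      exact (differentiableAt_riemannZeta hs).continuousAt.sub
        (continuousAt_const.div (by fun_prop) (sub_ne_zero.2 hs))
  refine ⟨fun s => ArithmeticFunction.vonMangoldt.LFunctionResidueClassAux (1 : ZMod 1) s - z s,
    (ArithmeticFunction.vonMangoldt.continuousOn_LFunctionResidueClassAux _).sub hz.continuousOn,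
    fun s hs => ?_⟩
  have hs1 : s ≠ 1 := by
    rintro rfl
    simp at hs
  have h1 := ArithmeticFunction.vonMangoldt.eqOn_LFunctionResidueClassAux
    (a := (1 : ZMod 1)) isUnit_one hs
  have h2 : ArithmeticFunction.vonMangoldt.residueClass (1 : ZMod 1) =
      fun n => ArithmeticFunction.vonMangoldt n := by
    ext n
    simp [Subsingleton.elim (n : ZMod 1) 1]
  have h3 : LSeriesHasSum 1 s (riemannZeta s) := by
    rw [← LSeries_one_eq_riemannZeta hs]
    exact ((LSeriesSummable_one_iff).2 hs).LSeriesHasSum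
  have h4 := (ArithmeticFunction.LSeriesSummable_vonMangoldt hs).LSeriesHasSum
  have h5 : LSeriesHasSum (fun n => (ArithmeticFunction.vonMangoldt n : ℂ) - 1) s
      (LSeries (fun n => (ArithmeticFunction.vonMangoldt n : ℂ)) s - riemannZeta s) :=
    h4.sub h3
  simp only [h2] at h1
  simp only [h1, z, Function.update_of_ne hs1]
  convert h5 using 1
  simp

theorem hasSum_vonMangoldt_sub_one_mul_fejerKernel {h : ℂ → ℂ}
    (hh : ∀ s : ℂ, 1 < s.re →
      LSeriesHasSum (fun n => (ArithmeticFunction.vonMangoldt n : ℂ) - 1) s (h s))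
    {l σ : ℝ} (hl : 0 ≤ l) (hσ : 1 < σ) (y : ℝ) :
    HasSum (fun n : ℕ => (ArithmeticFunction.vonMangoldt n - 1) * (n : ℝ) ^ (-σ) *
        fejerKernel l (Real.log n - y))
      (∫ t in -l..l, ((l - |t| : ℝ) : ℂ) * Complex.exp (t * y * Complex.I) *
        h (σ + t * Complex.I)).re := by
  set a : ℕ → ℂ := fun n => (ArithmeticFunction.vonMangoldt n : ℂ) - 1 with ha
  have hterm : ∀ (n : ℕ) (t : ℝ), ‖LSeries.term a (σ + t * Complex.I) n‖ =
      ‖LSeries.term a σ n‖ := by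
    intro n t
    simp [LSeries.norm_term_eq]
  have hsummable : Summable fun n => ‖LSeries.term a σ n‖ :=
    (hh σ (by simpa using hσ)).summable.norm
  have hform : ∀ (n : ℕ) (t : ℝ),
      ((l - |t| : ℝ) : ℂ) * Complex.exp (t * y * Complex.I) *
        LSeries.term a (σ + t * Complex.I) n =
      (((ArithmeticFunction.vonMangoldt n - 1) * (n : ℝ) ^ (-σ) * (l - |t|) : ℝ) : ℂ) *
        Complex.exp ((-(t * (Real.log n - y)) : ℝ) * Complex.I) := by
    intro n t
    rcases eq_or_ne n 0 with rfl | hn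
    · simp [Real.zero_rpow (by linarith : -σ ≠ 0)]
    · have hn' : (0 : ℝ) < n := by positivity
      rw [LSeries.term_of_ne_zero hn, Complex.cpow_def_of_ne_zero (by exact_mod_cast hn),
        div_eq_mul_inv, ← Complex.exp_neg, Real.rpow_def_of_pos hn', ha,
        ← Complex.natCast_log]
      push_cast
      have e : Complex.exp (t * y * Complex.I) *
          Complex.exp (-(Complex.log n * (σ + t * Complex.I))) =
          Complex.exp (Complex.log n * -σ) *
            Complex.exp (-(t * (Complex.log n - y)) * Complex.I) := by
        rw [← Complex.exp_add, ← Complex.exp_add]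
        congr 1
        ring
      linear_combination ((l : ℂ) - (|t| : ℝ)) * ((ArithmeticFunction.vonMangoldt n : ℂ) - 1) * e
  have key := intervalIntegral.hasSum_integral_of_dominated_convergence
    (μ := MeasureTheory.volume) (a := -l) (b := l)
    (F := fun n t => ((l - |t| : ℝ) : ℂ) * Complex.exp (t * y * Complex.I) *
        LSeries.term a (σ + t * Complex.I) n)
    (f := fun t => ((l - |t| : ℝ) : ℂ) * Complex.exp (t * y * Complex.I) *
        h (σ + t * Complex.I))
    (fun n _ => l * ‖LSeries.term a σ n‖)
    (fun n => by
      simp only [hform]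
      exact Continuous.aestronglyMeasurable (by fun_prop))
    (fun n => Filter.Eventually.of_forall fun t ht => by
      rw [Set.uIoc_of_le (by linarith)] at ht
      have h1 : |t| ≤ l := abs_le.2 ⟨ht.1.le, ht.2⟩
      have h2 : ‖Complex.exp (t * y * Complex.I)‖ = 1 := by
        rw [← Complex.ofReal_mul, Complex.norm_exp_ofReal_mul_I]
      rw [norm_mul, norm_mul, h2, hterm, mul_one, Complex.norm_real, Real.norm_eq_abs,
        abs_of_nonneg (by linarith)]
      gcongr
      linarith [abs_nonneg t])
    (Filter.Eventually.of_forall fun t _ => hsummable.mul_left l)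
    (by simp)
    (Filter.Eventually.of_forall fun t _ =>
      (hh (σ + t * Complex.I) (by simpa using hσ)).mul_left _)
  refine (Complex.hasSum_re key).congr_fun ?_
  intro n
  simp only [hform]
  rw [← Complex.reCLM_apply, ← ContinuousLinearMap.intervalIntegral_comp_comm _
    (Continuous.intervalIntegrable (by fun_prop) _ _)]
  simp only [Complex.reCLM_apply, Complex.re_ofReal_mul, Complex.exp_ofReal_mul_I_re,
    Real.cos_neg, fejerKernel]
  rw [← intervalIntegral.integral_const_mul]
  refine intervalIntegral.integral_congr fun t _ => ?_
  ring

theorem sum_vonMangoldt_div_dyadic_le (k : ℕ) :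
    ∑ n ∈ Finset.Ico (2 ^ k) (2 ^ (k + 1)), ArithmeticFunction.vonMangoldt n / n ≤
      2 * (Real.log 4 + 4) := by
  have h1 : ∑ n ∈ Finset.Ico (2 ^ k) (2 ^ (k + 1)), ArithmeticFunction.vonMangoldt n / n ≤
      ∑ n ∈ Finset.Ico (2 ^ k) (2 ^ (k + 1)), ArithmeticFunction.vonMangoldt n / 2 ^ k := by
    refine Finset.sum_le_sum fun n hn => ?_
    have : ((2 ^ k : ℕ) : ℝ) ≤ n := by exact_mod_cast (Finset.mem_Ico.1 hn).1
    push_cast at this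
    have h0 : 0 ≤ ArithmeticFunction.vonMangoldt n := ArithmeticFunction.vonMangoldt_nonneg
    gcongr
  have h2 : ∑ n ∈ Finset.Ico (2 ^ k) (2 ^ (k + 1)), ArithmeticFunction.vonMangoldt n ≤
      Chebyshev.psi (2 ^ (k + 1)) := by
    refine Finset.sum_le_sum_of_subset_of_nonneg (fun n hn => ?_)
      fun _ _ _ => ArithmeticFunction.vonMangoldt_nonneg
    have hf : ⌊(2 : ℝ) ^ (k + 1)⌋₊ = 2 ^ (k + 1) := by
      exact_mod_cast Nat.floor_natCast (R := ℝ) (2 ^ (k + 1))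
    rw [Finset.mem_Ico] at hn
    rw [Finset.mem_Ioc, hf]
    exact ⟨lt_of_lt_of_le (by positivity) hn.1, hn.2.le⟩
  have h3 : Chebyshev.psi (2 ^ (k + 1)) ≤ (Real.log 4 + 4) * (2 ^ k * 2) := by
    rw [← pow_succ]
    exact Chebyshev.psi_le_const_mul_self (by positivity)
  refine h1.trans ?_
  rw [← Finset.sum_div, div_le_iff₀ (by positivity)]
  linarith

theorem summable_one_div_one_add_int_sq : Summable fun j : ℤ => 1 / (1 + (j : ℝ) ^ 2) := by
  refine Summable.of_nonneg_of_le (fun j => by positivity) (fun j => ?_)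
    ((Real.summable_one_div_int_pow.2 one_lt_two).add (hasSum_ite_eq (0 : ℤ) (1 : ℝ)).summable)
  rcases eq_or_ne j 0 with rfl | hj
  · simp
  · have : (0 : ℝ) < (j : ℝ) ^ 2 := by positivity
    simp only [hj, if_false, add_zero]
    gcongr
    linarith

theorem one_add_sq_le_max_sq {δ y : ℝ} (hδ : 0 < δ) (hδ1 : δ ≤ 1) {k n : ℕ}
    (h1 : 2 ^ k ≤ n) (h2 : n < 2 ^ (k + 1)) :
    δ ^ 2 / 20 * (1 + (((k : ℤ) - ⌊y / Real.log 2⌋ : ℤ) : ℝ) ^ 2) ≤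
      max (δ ^ 2) ((Real.log n - y) ^ 2) := by
  set m := ⌊y / Real.log 2⌋
  have hL := Real.log_two_gt_d9
  have hL' := Real.log_two_lt_d9
  have hm1 : m * Real.log 2 ≤ y := by
    rw [← le_div_iff₀ (by linarith)]
    exact Int.floor_le _
  have hm2 : y ≤ (m + 1) * Real.log 2 := by
    rw [← div_le_iff₀ (by linarith)]
    exact (Int.lt_floor_add_one _).le
  have hk1 : k * Real.log 2 ≤ Real.log n := by
    rw [← Real.log_pow]
    exact Real.log_le_log (by positivity) (by exact_mod_cast h1)
  have hk2 : Real.log n ≤ (k + 1) * Real.log 2 := by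
    have hn : (0 : ℝ) < n := by exact_mod_cast lt_of_lt_of_le (by positivity) h1
    have : Real.log n ≤ Real.log (2 ^ (k + 1)) :=
      Real.log_le_log hn (by exact_mod_cast h2.le)
    rw [Real.log_pow] at this
    exact_mod_cast this
  set d : ℤ := (k : ℤ) - m with hd
  have hdr : (d : ℝ) = k - m := by push_cast [hd]; ring
  have hδ2 : δ ^ 2 ≤ 1 := pow_le_one₀ hδ.le hδ1
  have hsq : 0 < δ ^ 2 := by positivity
  have aux : ∀ x : ℝ, 2 ≤ x → ∀ v : ℝ, (x - 1) * Real.log 2 ≤ v →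
      δ ^ 2 / 20 * (1 + x ^ 2) ≤ v ^ 2 := by
    intro x hx v hv
    have hv1 : (x - 1) * (1 / 2) ≤ v := by nlinarith
    have hv2 : ((x - 1) * (1 / 2)) ^ 2 ≤ v ^ 2 := by gcongr; nlinarith
    have : δ ^ 2 / 20 * (1 + x ^ 2) ≤ 1 / 20 * (1 + x ^ 2) := by gcongr
    nlinarith
  rcases le_or_gt d (-2) with hd1 | hd1
  · refine le_max_of_le_right ?_
    have hx : (d : ℝ) ≤ -2 := by exact_mod_cast hd1
    have := aux (-d) (by linarith) (y - Real.log n) (by rw [hdr]; nlinarith)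
    nlinarith
  rcases le_or_gt 2 d with hd2 | hd2
  · refine le_max_of_le_right ?_
    have hx : (2 : ℝ) ≤ d := by exact_mod_cast hd2
    exact aux d hx (Real.log n - y) (by rw [hdr]; nlinarith)
  · refine le_max_of_le_left ?_
    have hx : (d : ℝ) ≤ 1 := by exact_mod_cast Int.lt_add_one_iff.1 hd2
    have hx' : (-1 : ℝ) ≤ d := by exact_mod_cast hd1
    have : (d : ℝ) ^ 2 ≤ 1 := by nlinarith
    nlinarith

theorem exists_sum_vonMangoldt_div_le {δ : ℝ} (hδ : 0 < δ) (hδ1 : δ ≤ 1) :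
    ∃ C : ℝ, ∀ (y : ℝ) (N : ℕ), ∑ n ∈ Finset.range N,
      ArithmeticFunction.vonMangoldt n / n / max (δ ^ 2) ((Real.log n - y) ^ 2) ≤ C := by
  refine ⟨20 / δ ^ 2 * (2 * (Real.log 4 + 4)) * ∑' j : ℤ, 1 / (1 + (j : ℝ) ^ 2), fun y N => ?_⟩
  set m := ⌊y / Real.log 2⌋
  set f : ℕ → ℝ := fun n =>
    ArithmeticFunction.vonMangoldt n / n / max (δ ^ 2) ((Real.log n - y) ^ 2) with hf
  have hsq : 0 < δ ^ 2 := by positivity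
  have hf0 : ∀ n, 0 ≤ f n := fun n =>
    div_nonneg (div_nonneg ArithmeticFunction.vonMangoldt_nonneg n.cast_nonneg)
      (hsq.le.trans (le_max_left _ _))
  have hblock : ∀ k : ℕ, ∑ n ∈ Finset.Ico (2 ^ k) (2 ^ (k + 1)), f n ≤
      20 / δ ^ 2 * (2 * (Real.log 4 + 4)) * (1 / (1 + (((k : ℤ) - m : ℤ) : ℝ) ^ 2)) := by
    intro k
    have h1 : ∀ n ∈ Finset.Ico (2 ^ k) (2 ^ (k + 1)), f n ≤
        ArithmeticFunction.vonMangoldt n / n *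
          (20 / δ ^ 2 * (1 / (1 + (((k : ℤ) - m : ℤ) : ℝ) ^ 2))) := by
      intro n hn
      rw [Finset.mem_Ico] at hn
      have h := one_add_sq_le_max_sq (y := y) hδ hδ1 hn.1 hn.2
      have h0 : 0 ≤ ArithmeticFunction.vonMangoldt n / n :=
        div_nonneg ArithmeticFunction.vonMangoldt_nonneg n.cast_nonneg
      have e : 20 / δ ^ 2 * (1 / (1 + (((k : ℤ) - m : ℤ) : ℝ) ^ 2)) =
          (δ ^ 2 / 20 * (1 + (((k : ℤ) - m : ℤ) : ℝ) ^ 2))⁻¹ := by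
        field_simp
      rw [e, hf, ← div_eq_mul_inv]
      exact div_le_div_of_nonneg_left h0 (by positivity) h
    refine (Finset.sum_le_sum h1).trans ?_
    rw [← Finset.sum_mul]
    calc _ ≤ 2 * (Real.log 4 + 4) *
          (20 / δ ^ 2 * (1 / (1 + (((k : ℤ) - m : ℤ) : ℝ) ^ 2))) := by
          gcongr
          exact sum_vonMangoldt_div_dyadic_le k
      _ = _ := by ring
  have hsum : ∀ M : ℕ, ∑ n ∈ Finset.Ico 1 (2 ^ M), f n =
      ∑ k ∈ Finset.range M, ∑ n ∈ Finset.Ico (2 ^ k) (2 ^ (k + 1)), f n := by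
    intro M
    induction M with
    | zero => simp
    | succ M ih =>
      rw [Finset.sum_range_succ, ← ih, Finset.sum_Ico_consecutive _ Nat.one_le_two_pow
        (Nat.pow_le_pow_right two_pos M.le_succ)]
  have h4 : (0 : ℝ) ≤ Real.log 4 := Real.log_nonneg (by norm_num)
  calc ∑ n ∈ Finset.range N, f n ≤ ∑ n ∈ Finset.range (2 ^ N), f n :=
        Finset.sum_le_sum_of_subset_of_nonneg
          (Finset.range_mono Nat.lt_two_pow_self.le) fun n _ _ => hf0 n
    _ = ∑ n ∈ Finset.Ico 1 (2 ^ N), f n := by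
        rw [Finset.range_eq_Ico, Finset.sum_eq_sum_Ico_succ_bot (by positivity)]
        simp [hf]
    _ ≤ ∑ k ∈ Finset.range N,
          20 / δ ^ 2 * (2 * (Real.log 4 + 4)) * (1 / (1 + (((k : ℤ) - m : ℤ) : ℝ) ^ 2)) := by
        rw [hsum]
        exact Finset.sum_le_sum fun k _ => hblock k
    _ ≤ _ := by
        rw [← Finset.mul_sum]
        gcongr
        have hinj : Function.Injective fun k : ℕ => (k : ℤ) - m := fun a b h => by
          simpa using h
        have := summable_one_div_one_add_int_sq.sum_le_tsum
          ((Finset.range N).map ⟨_, hinj⟩) (fun j _ => by positivity)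
        rw [Finset.sum_map] at this
        exact this

theorem tendsto_integral_triangle_mul_exp {l : ℝ} (hl : 0 ≤ l) (g : ℝ → ℂ) :
    Filter.Tendsto (fun y : ℝ => ∫ t in -l..l,
      ((l - |t| : ℝ) : ℂ) * Complex.exp (t * y * Complex.I) * g t) Filter.atTop (nhds 0) := by
  have h1 := Real.tendsto_integral_exp_smul_cocompact
    ((Set.Ioc (-l) l).indicator fun t => ((l - |t| : ℝ) : ℂ) * g t)
  have h2 : Filter.Tendsto (fun y : ℝ => -y / (2 * Real.pi)) Filter.atTop
      (Filter.cocompact ℝ) :=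
    (Filter.tendsto_neg_atTop_atBot.atBot_div_const (by positivity)).mono_right
      atBot_le_cocompact
  refine (h1.comp h2).congr fun y => ?_
  rw [intervalIntegral.integral_of_le (by linarith),
    ← MeasureTheory.integral_indicator measurableSet_Ioc]
  refine MeasureTheory.integral_congr_ae (Filter.Eventually.of_forall fun t => ?_)
  by_cases ht : t ∈ Set.Ioc (-l) l
  · simp only [Set.indicator_of_mem ht, Circle.smul_def, Real.fourierChar_apply, smul_eq_mul]
    have e : 2 * Real.pi * -(t * (-y / (2 * Real.pi))) = t * y := by
      field_simp
    rw [e]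
    push_cast
    ring
  · simp [Set.indicator_of_notMem ht]

theorem sum_inv_Ioc_floor_ge {x l : ℝ} (hl : 1 ≤ l) (hx : 2 * l ≤ x) :
    1 / (4 * l) ≤ ∑ n ∈ Finset.Ioc ⌊x⌋₊ ⌊x + x / l⌋₊, (n : ℝ)⁻¹ := by
  have hx0 : 0 < x := by linarith
  have hxl : 2 ≤ x / l := (le_div_iff₀ (by linarith)).2 hx
  have hxl' : x / l ≤ x := div_le_self hx0.le hl
  have h1 : ∀ n ∈ Finset.Ioc ⌊x⌋₊ ⌊x + x / l⌋₊, (2 * x)⁻¹ ≤ (n : ℝ)⁻¹ := by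
    intro n hn
    rw [Finset.mem_Ioc] at hn
    have h2 : (n : ℝ) ≤ x + x / l := (Nat.le_floor_iff (by positivity)).1 hn.2
    have h3 : (0 : ℝ) < n := by exact_mod_cast (Nat.zero_le _).trans_lt hn.1
    gcongr
    linarith
  have h2 := Finset.card_nsmul_le_sum _ _ _ h1
  rw [Nat.card_Ioc, nsmul_eq_mul] at h2
  refine le_trans ?_ h2
  have h3 : ⌊x⌋₊ ≤ ⌊x + x / l⌋₊ := Nat.floor_le_floor (by linarith)
  have h4 : x + x / l < ⌊x + x / l⌋₊ + 1 := Nat.lt_floor_add_one _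
  have h5 : (⌊x⌋₊ : ℝ) ≤ x := Nat.floor_le hx0.le
  have h6 : x / l / 2 ≤ ((⌊x + x / l⌋₊ - ⌊x⌋₊ : ℕ) : ℝ) := by
    rw [Nat.cast_sub h3]
    linarith
  calc 1 / (4 * l) = x / l / 2 * (2 * x)⁻¹ := by
        field_simp
        norm_num
    _ ≤ _ := by gcongr

theorem log_sub_log_mem_of_mem_Ioc_floor {x l : ℝ} (hl : 0 < l) (hx : 0 < x) {n : ℕ}
    (hn : n ∈ Finset.Ioc ⌊x⌋₊ ⌊x + x / l⌋₊) :
    0 < Real.log n - Real.log x ∧ Real.log n - Real.log x ≤ 1 / l := by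
  rw [Finset.mem_Ioc] at hn
  have h1 : x < n := (Nat.floor_lt hx.le).1 hn.1
  have h2 : (n : ℝ) ≤ x + x / l := (Nat.le_floor_iff (by positivity)).1 hn.2
  refine ⟨sub_pos.2 (Real.log_lt_log hx h1), ?_⟩
  rw [← Real.log_div (by linarith) hx.ne']
  refine (Real.log_le_sub_one_of_pos (div_pos (hx.trans h1) hx)).trans ?_
  rw [sub_le_iff_le_add, div_le_iff₀ hx]
  calc (n : ℝ) ≤ x + x / l := h2
    _ = (1 / l + 1) * x := by ring

/-- Every short multiplicative window far enough out contains a prime power. -/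
theorem eventually_exists_isPrimePow_abs_log_sub_le {δ : ℝ} (hδ : 0 < δ) :
    ∀ᶠ y : ℝ in Filter.atTop, ∃ n : ℕ, IsPrimePow n ∧ |Real.log n - y| ≤ δ := by
  wlog hδ1 : δ ≤ 1 generalizing δ
  · filter_upwards [this one_pos le_rfl] with y ⟨n, hn, h⟩
    exact ⟨n, hn, by linarith⟩
  obtain ⟨h, hc, hh⟩ := exists_continuousOn_eq_LSeries_vonMangoldt_sub_one
  obtain ⟨C, hC⟩ := exists_sum_vonMangoldt_div_le hδ hδ1
  have hC0 : 0 ≤ C := by simpa using hC 0 0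
  set l := 32 * (C + 1) + 1 / δ with hl
  have hδi : 0 < 1 / δ := by positivity
  have hl1 : 1 ≤ l := by linarith
  have hlδ : 1 / l ≤ δ := by
    rw [one_div_le (by linarith) hδ]
    linarith
  have hRL := (tendsto_integral_triangle_mul_exp (l := l) (by linarith)
    fun t => h (1 + t * Complex.I)).eventually (Metric.ball_mem_nhds 0 one_pos)
  filter_upwards [hRL, Real.tendsto_exp_atTop.eventually_ge_atTop (2 * l)] with y hy hxl
  by_contra! hno
  set x := Real.exp y with hx
  have hlog : Real.log x = y := Real.log_exp y
  have hΛ : ∀ n : ℕ, |Real.log n - y| ≤ δ → ArithmeticFunction.vonMangoldt n = 0 := by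
    intro n hn
    by_contra h0
    exact absurd hn (not_le.2 (hno n (ArithmeticFunction.vonMangoldt_ne_zero_iff.1 h0)))
  set S := Finset.Ioc ⌊x⌋₊ ⌊x + x / l⌋₊ with hS
  set J : ℝ → ℝ := fun σ => (∫ t in -l..l, ((l - |t| : ℝ) : ℂ) *
    Complex.exp (t * y * Complex.I) * h ((max σ 1 : ℝ) + t * Complex.I)).re with hJ
  have hJc : Continuous J := by
    have h1 : Continuous fun p : ℝ × ℝ => h ((max p.1 1 : ℝ) + p.2 * Complex.I) :=
      hc.comp_continuous (by fun_prop) (by simp)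
    refine Complex.continuous_re.comp
      (intervalIntegral.continuous_parametric_intervalIntegral_of_continuous' ?_ _ _)
    simp only [Function.uncurry_def]
    exact Continuous.mul (by fun_prop) h1
  have hpoint : ∀ σ : ℝ, 1 < σ → ∀ n : ℕ,
      (ArithmeticFunction.vonMangoldt n - 1) * (n : ℝ) ^ (-σ) *
        fejerKernel l (Real.log n - y) ≤
      4 * (ArithmeticFunction.vonMangoldt n / n / max (δ ^ 2) ((Real.log n - y) ^ 2)) -
        if n ∈ S then (n : ℝ) ^ (-σ) * (l ^ 2 / 2) else 0 := by
    intro σ hσ n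
    rcases Nat.eq_zero_or_pos n with rfl | hn
    · simp [hS, Real.zero_rpow (by linarith : -σ ≠ 0)]
    have hn1 : (1 : ℝ) ≤ n := by exact_mod_cast hn
    have hW := fejerKernel_nonneg (by linarith : 0 ≤ l) (Real.log n - y)
    have hp : 0 ≤ (n : ℝ) ^ (-σ) := by positivity
    rcases le_or_gt |Real.log n - y| δ with hd | hd
    · rw [hΛ n hd]
      split_ifs with hnS
      · have hu := log_sub_log_mem_of_mem_Ioc_floor (by linarith) (Real.exp_pos y) hnS
        rw [← hx, hlog] at hu
        have := le_fejerKernel (by linarith : 0 ≤ l) hu.1.ne' (by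
          rw [abs_of_pos (mul_pos (by linarith) hu.1), ← le_div_iff₀' (by linarith)]
          exact hu.2)
        simp only [zero_div, mul_zero]
        linarith [mul_le_mul_of_nonneg_left this hp]
      · simp only [zero_div, mul_zero, sub_zero]
        nlinarith [mul_nonneg hp hW]
    · have hnS : n ∉ S := by
        intro hnS
        have hu := log_sub_log_mem_of_mem_Ioc_floor (by linarith) (Real.exp_pos y) hnS
        rw [← hx, hlog] at hu
        rw [abs_of_pos hu.1] at hd
        linarith [hu.2]
      have hu0 : Real.log n - y ≠ 0 := by
        intro h0
        rw [h0, abs_zero] at hd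
        linarith
      have hmax : max (δ ^ 2) ((Real.log n - y) ^ 2) = (Real.log n - y) ^ 2 := by
        refine max_eq_right ?_
        rw [← sq_abs (Real.log n - y)]
        gcongr
      have hpn : (n : ℝ) ^ (-σ) ≤ (n : ℝ)⁻¹ := by
        rw [← Real.rpow_neg_one]
        exact Real.rpow_le_rpow_of_exponent_le hn1 (by linarith)
      have h0 : 0 ≤ ArithmeticFunction.vonMangoldt n := ArithmeticFunction.vonMangoldt_nonneg
      rw [if_neg hnS, hmax, sub_zero]
      calc _ ≤ ArithmeticFunction.vonMangoldt n * (n : ℝ) ^ (-σ) *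
            fejerKernel l (Real.log n - y) := by
            gcongr
            linarith
        _ ≤ ArithmeticFunction.vonMangoldt n * (n : ℝ)⁻¹ * (4 / (Real.log n - y) ^ 2) := by
            gcongr
            exact fejerKernel_le (by linarith) hu0
        _ = _ := by ring
  have hbound : ∀ σ : ℝ, 1 < σ →
      J σ ≤ 4 * C - ∑ n ∈ S, (n : ℝ) ^ (-σ) * (l ^ 2 / 2) := by
    intro σ hσ
    have hs := hasSum_vonMangoldt_sub_one_mul_fejerKernel hh (by linarith : 0 ≤ l) hσ y
    have e : J σ = (∫ t in -l..l, ((l - |t| : ℝ) : ℂ) *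
        Complex.exp (t * y * Complex.I) * h (σ + t * Complex.I)).re := by
      simp only [hJ, max_eq_left hσ.le]
    rw [e]
    refine le_of_tendsto hs.tendsto_sum_nat ?_
    filter_upwards [Filter.eventually_gt_atTop ⌊x + x / l⌋₊] with N hN
    refine (Finset.sum_le_sum fun n _ => hpoint σ hσ n).trans ?_
    rw [Finset.sum_sub_distrib, ← Finset.mul_sum, Finset.sum_ite_mem]
    have hSN : Finset.range N ∩ S = S := by
      refine Finset.inter_eq_right.2 fun n hn => ?_
      rw [hS, Finset.mem_Ioc] at hn
      exact Finset.mem_range.2 (hn.2.trans_lt hN)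
    rw [hSN]
    linarith [hC y N]
  have hlim : J 1 ≤ 4 * C - ∑ n ∈ S, (n : ℝ) ^ (-1 : ℝ) * (l ^ 2 / 2) := by
    have hr : Continuous fun σ : ℝ => 4 * C - ∑ n ∈ S, (n : ℝ) ^ (-σ) * (l ^ 2 / 2) := by
      refine continuous_const.sub (continuous_finsetSum _ fun n hn => ?_)
      have hn0 : (n : ℝ) ≠ 0 := by
        rw [hS, Finset.mem_Ioc] at hn
        exact_mod_cast ((Nat.zero_le _).trans_lt hn.1).ne'
      exact (continuous_const.rpow continuous_neg fun σ => Or.inl hn0).mul continuous_const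
    refine le_of_tendsto_of_tendsto (hJc.continuousWithinAt (s := Set.Ioi 1) (x := 1))
      (hr.continuousWithinAt (s := Set.Ioi 1) (x := 1)) ?_
    filter_upwards [self_mem_nhdsWithin] with σ hσ using hbound σ hσ
  have hsum := sum_inv_Ioc_floor_ge hl1 hxl
  simp only [Real.rpow_neg_one, ← Finset.sum_mul] at hlim
  have hsum2 : l / 8 ≤ (∑ n ∈ S, (n : ℝ)⁻¹) * (l ^ 2 / 2) := by
    calc l / 8 = 1 / (4 * l) * (l ^ 2 / 2) := by
          field_simp
          norm_num
      _ ≤ _ := by gcongr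
  have hJ1 : -1 < J 1 := by
    have h1 := mem_ball_zero_iff.1 hy
    have h2 := (abs_le.1 (Complex.abs_re_le_norm (∫ t in -l..l, ((l - |t| : ℝ) : ℂ) *
      Complex.exp (t * y * Complex.I) * h (1 + t * Complex.I)))).1
    simp only [hJ, max_self, Complex.ofReal_one]
    linarith
  linarith

theorem IsStarColouring.exists_centre {α : Type*} {c : EdgeColouring α} (hc : IsStarColouring c)
    {a b : α} (hab : a ≠ b) :
    ∃ u v : α, u ≠ v ∧ c s(u, v) = c s(a, b) ∧
      ∀ x y : α, x ≠ y → c s(x, y) = c s(a, b) → u = x ∨ u = y := by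
  by_cases ha : ∀ x y : α, x ≠ y → c s(x, y) = c s(a, b) → a = x ∨ a = y
  · exact ⟨a, b, hab, rfl, ha⟩
  by_cases hb : ∀ x y : α, x ≠ y → c s(x, y) = c s(a, b) → b = x ∨ b = y
  · exact ⟨b, a, hab.symm, by rw [Sym2.eq_swap], hb⟩
  push Not at ha hb
  obtain ⟨x, y, hxy, hxyc, hax, hay⟩ := ha
  obtain ⟨z, w, hzw, hzwc, hbz, hbw⟩ := hb
  obtain ⟨d, hbd, had, hd⟩ : ∃ d, b ≠ d ∧ a ≠ d ∧ c s(b, d) = c s(a, b) := by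
    rcases hc.1 a b x y hab hxy hxyc.symm with h | h | rfl | rfl
    · exact absurd h hax
    · exact absurd h hay
    · exact ⟨y, hxy, hay, hxyc⟩
    · exact ⟨x, hxy.symm, hax, by rw [Sym2.eq_swap, hxyc]⟩
  obtain ⟨d', had', hbd', hd'⟩ : ∃ d', a ≠ d' ∧ b ≠ d' ∧ c s(a, d') = c s(a, b) := by
    rcases hc.1 a b z w hab hzw hzwc.symm with rfl | rfl | h | h
    · exact ⟨w, hzw, hbw, hzwc⟩
    · exact ⟨z, hzw.symm, hbz, by rw [Sym2.eq_swap, hzwc]⟩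
    · exact absurd h hbz
    · exact absurd h hbw
  have hdd : d = d' := by
    rcases hc.1 b d a d' hbd had' (hd.trans hd'.symm) with h | h | h | h
    · exact absurd h.symm hab
    · exact absurd h hbd'
    · exact absurd h.symm had
    · exact h
  subst hdd
  exact absurd ⟨hd.symm, hd.trans hd'.symm⟩ (hc.2 a b d hab hbd had)

theorem IsStarColouring.hasRainbowCopy_of_injective {α β : Type*} {c : EdgeColouring α}
    (hc : IsStarColouring c) {H : SimpleGraph β} {f : β → α} (hf : Function.Injective f)
    (h : ∀ w u v : β, u ≠ v → H.Adj w u → H.Adj w v → c s(f w, f u) ≠ c s(f w, f v)) :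
    HasRainbowCopy c H := by
  refine ⟨⟨f, hf⟩, fun u v x y huv hxy hne heq => ?_⟩
  simp only [Function.Embedding.coeFn_mk] at heq
  rcases hc.1 _ _ _ _ (hf.ne huv.ne) (hf.ne hxy.ne) heq with h' | h' | h' | h'
  · obtain rfl := hf h'
    exact h u v y (fun e => hne (by rw [e])) huv hxy heq
  · obtain rfl := hf h'
    refine h u v x (fun e => hne (by rw [e, Sym2.eq_swap])) huv hxy.symm ?_
    rw [heq, Sym2.eq_swap]
  · obtain rfl := hf h'
    refine h v u y (fun e => hne (by rw [e, Sym2.eq_swap])) huv.symm hxy ?_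
    rw [← heq, Sym2.eq_swap]
  · obtain rfl := hf h'
    refine h v u x (fun e => hne (by rw [e])) huv.symm hxy.symm ?_
    rw [Sym2.eq_swap, heq, Sym2.eq_swap]

/-- A set of arcs, each pointing away from a centre of its colour class, such that different
arcs have different colours. -/
structure IsRainbowArcSet {α : Type*} (c : EdgeColouring α) (E : Finset (α × α)) : Prop where
  ne : ∀ e ∈ E, e.1 ≠ e.2
  centre : ∀ e ∈ E, ∀ x y : α, x ≠ y → c s(x, y) = c s(e.1, e.2) → e.1 = x ∨ e.1 = y
  inj : ∀ e ∈ E, ∀ e' ∈ E, c s(e.1, e.2) = c s(e'.1, e'.2) → e = e'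

theorem IsStarColouring.exists_isRainbowArcSet {α : Type*} [Finite α] {c : EdgeColouring α}
    (hc : IsStarColouring c) :
    ∃ E : Finset (α × α), IsRainbowArcSet c E ∧ E.card = colourCount c := by
  have key : ∀ m : (c '' {e : Sym2 α | ¬ e.IsDiag}), ∃ e : α × α,
      e.1 ≠ e.2 ∧ c s(e.1, e.2) = m ∧
        ∀ x y : α, x ≠ y → c s(x, y) = m → e.1 = x ∨ e.1 = y := by
    rintro ⟨_, e, he, rfl⟩
    induction e using Sym2.ind with
    | _ a b =>
      obtain ⟨u, v, huv, h1, h2⟩ := hc.exists_centre (a := a) (b := b) (by simpa using he)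
      exact ⟨(u, v), huv, h1, h2⟩
  choose g hne hcol hcen using key
  have hg : Function.Injective g := fun m m' h => by
    apply Subtype.ext
    rw [← hcol m, ← hcol m', h]
  have hfin : (Set.range g).Finite := Set.toFinite _
  refine ⟨hfin.toFinset, ⟨?_, ?_, ?_⟩, ?_⟩
  · intro e he
    obtain ⟨m, rfl⟩ := hfin.mem_toFinset.1 he
    exact hne m
  · intro e he x y hxy h
    obtain ⟨m, rfl⟩ := hfin.mem_toFinset.1 he
    exact hcen m x y hxy (h.trans (hcol m))
  · intro e he e' he' h
    obtain ⟨m, rfl⟩ := hfin.mem_toFinset.1 he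
    obtain ⟨m', rfl⟩ := hfin.mem_toFinset.1 he'
    rw [hcol m, hcol m'] at h
    rw [Subtype.ext h]
  · rw [← Set.ncard_eq_toFinset_card _ hfin, colourCount, ← Set.image_univ,
      Set.ncard_image_of_injective _ hg, Set.ncard_univ, Nat.card_coe_set_eq]

theorem K5minus_adj {u v : Fin 5} : K5minus.Adj u v ↔ u ≠ v ∧ s(u, v) ≠ s(0, 1) := by
  simp [K5minus]

section CommonOutNeighbours

variable {α : Type*} {c : EdgeColouring α} {E : Finset (α × α)}

theorem IsRainbowArcSet.hasRainbowCopy_K5minus (hE : IsRainbowArcSet c E) (hc : IsStarColouring c)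
    {a d x y z : α} (had : a ≠ d) (hxy : x ≠ y) (hxz : x ≠ z) (hyz : y ≠ z)
    (h : ∀ b, b = x ∨ b = y ∨ b = z → (a, b) ∈ E ∧ (d, b) ∈ E ∧
      c s(a, b) ≠ c s(a, d) ∧ c s(d, b) ≠ c s(a, d))
    (hz : c s(x, z) ≠ c s(y, z)) : HasRainbowCopy c K5minus := by
  have hne : ∀ b, b = x ∨ b = y ∨ b = z → a ≠ b ∧ d ≠ b := fun b hb =>
    ⟨hE.ne _ (h b hb).1, hE.ne _ (h b hb).2.1⟩
  have hcen : ∀ e b b', (e = a ∨ e = d) → (b = x ∨ b = y ∨ b = z) → (b' = x ∨ b' = y ∨ b' = z) →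
      b ≠ b' → c s(b, b') ≠ c s(e, b) := by
    rintro e b b' (rfl | rfl) hb hb' hbb heq
    · rcases hE.centre _ (h b hb).1 _ _ hbb heq with h1 | h1
      · exact (hne b hb).1 h1
      · exact (hne b' hb').1 h1
    · rcases hE.centre _ (h b hb).2.1 _ _ hbb heq with h1 | h1
      · exact (hne b hb).2 h1
      · exact (hne b' hb').2 h1
  have hinj : ∀ e b e' b', (e = a ∨ e = d) → (e' = a ∨ e' = d) → (b = x ∨ b = y ∨ b = z) →
      (b' = x ∨ b' = y ∨ b' = z) → c s(e, b) = c s(e', b') → e = e' ∧ b = b' := by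
    intro e b e' b' he he' hb hb' heq
    have h1 : (e, b) ∈ E := by rcases he with rfl | rfl; exacts [(h b hb).1, (h b hb).2.1]
    have h2 : (e', b') ∈ E := by rcases he' with rfl | rfl; exacts [(h b' hb').1, (h b' hb').2.1]
    simpa using hE.inj _ h1 _ h2 heq
  have hf : Function.Injective ![x, y, z, a, d] := by
    have h1 := hne x (by simp)
    have h2 := hne y (by simp)
    have h3 := hne z (by simp)
    rw [← List.nodup_ofFn]
    simp [List.ofFn_succ, hxy, hxz, hyz, had, h1.1.symm, h1.2.symm, h2.1.symm, h2.2.symm,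
      h3.1.symm, h3.2.symm]
  refine hc.hasRainbowCopy_of_injective hf fun w u v huv hwu hwv => ?_
  rw [K5minus_adj] at hwu hwv
  fin_cases w <;> fin_cases u <;> fin_cases v <;>
    first
    | exact absurd rfl huv
    | exact absurd rfl hwu.1
    | exact absurd rfl hwv.1
    | exact absurd rfl hwu.2
    | exact absurd rfl hwv.2
    | exact absurd Sym2.eq_swap hwu.2
    | exact absurd Sym2.eq_swap hwv.2
    | (clear huv hwu hwv
       simp
       grind [Sym2.eq_swap])

theorem IsRainbowArcSet.hasRainbowCopy_K5minus_of_three_le (hE : IsRainbowArcSet c E)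
    (hc : IsStarColouring c) {a d : α} (had : a ≠ d) {T : Finset α} (hT : 3 ≤ T.card)
    (h : ∀ b ∈ T, (a, b) ∈ E ∧ (d, b) ∈ E ∧ c s(a, b) ≠ c s(a, d) ∧ c s(d, b) ≠ c s(a, d)) :
    HasRainbowCopy c K5minus := by
  obtain ⟨x, hx, y, hy, z, hz, hxy, hxz, hyz⟩ := Finset.two_lt_card.1 hT
  by_cases h1 : c s(x, z) = c s(y, z)
  · refine hE.hasRainbowCopy_K5minus hc (x := y) (y := z) (z := x) had hyz hxy.symm hxz.symm
      (by rintro b (rfl | rfl | rfl) <;> exact h _ ‹_›) fun h2 => ?_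
    refine hc.2 x y z hxy hyz hxz ⟨?_, ?_⟩
    · rw [Sym2.eq_swap, h2, Sym2.eq_swap, h1]
    · exact h1.symm
  · exact hE.hasRainbowCopy_K5minus hc had hxy hxz hyz
      (by rintro b (rfl | rfl | rfl) <;> exact h _ ‹_›) h1

theorem IsRainbowArcSet.card_le_three (hE : IsRainbowArcSet c E) (hc : IsStarColouring c)
    (hK : ¬ HasRainbowCopy c K5minus) {a d : α} (had : a ≠ d) {T : Finset α}
    (h : ∀ b ∈ T, (a, b) ∈ E ∧ (d, b) ∈ E) : T.card ≤ 3 := by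
  classical
  by_contra! hT
  have hbad : ∀ b ∈ T, ∀ b' ∈ T, ¬ (c s(a, b) ≠ c s(a, d) ∧ c s(d, b) ≠ c s(a, d)) →
      ¬ (c s(a, b') ≠ c s(a, d) ∧ c s(d, b') ≠ c s(a, d)) → b = b' := by
    intro b hb b' hb' h1 h2
    have key : ∀ e ∈ E, ∀ e' ∈ E, c s(e.1, e.2) = c s(a, d) → c s(e'.1, e'.2) = c s(a, d) →
      e.2 = e'.2 := fun e he e' he' h1 h2 => by rw [hE.inj e he e' he' (h1.trans h2.symm)]
    have g := h b hb
    have g' := h b' hb'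
    rw [not_and_or, not_not, not_not] at h1 h2
    rcases h1 with h1 | h1 <;> rcases h2 with h2 | h2
    · exact key _ g.1 _ g'.1 h1 h2
    · exact key _ g.1 _ g'.2 h1 h2
    · exact key _ g.2 _ g'.1 h1 h2
    · exact key _ g.2 _ g'.2 h1 h2
  have hsplit := Finset.card_filter_add_card_filter_not (s := T)
    (fun b => c s(a, b) ≠ c s(a, d) ∧ c s(d, b) ≠ c s(a, d))
  have hle : (T.filter fun b => ¬ (c s(a, b) ≠ c s(a, d) ∧ c s(d, b) ≠ c s(a, d))).card ≤ 1 := by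
    refine Finset.card_le_one.2 fun b hb b' hb' => ?_
    rw [Finset.mem_filter] at hb hb'
    exact hbad b hb.1 b' hb'.1 hb.2 hb'.2
  refine hK (hE.hasRainbowCopy_K5minus_of_three_le hc had
    (T := T.filter fun b => c s(a, b) ≠ c s(a, d) ∧ c s(d, b) ≠ c s(a, d)) (by omega) ?_)
  intro b hb
  rw [Finset.mem_filter] at hb
  exact ⟨(h b hb.1).1, (h b hb.1).2, hb.2⟩

end CommonOutNeighbours

theorem sq_card_le_of_codegree_le {α : Type*} [Fintype α] (E : Finset (α × α)) (k : ℕ)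
    (h : ∀ a d : α, a ≠ d → ∀ T : Finset α, (∀ b ∈ T, (a, b) ∈ E ∧ (d, b) ∈ E) → T.card ≤ k) :
    E.card ^ 2 ≤ Fintype.card α * (k * Fintype.card α ^ 2 + E.card) := by
  classical
  set N : α → Finset α := fun b => Finset.univ.filter fun a => (a, b) ∈ E with hN
  have hcard : E.card = ∑ b, (N b).card := by
    rw [Finset.card_eq_sum_card_fiberwise (f := Prod.snd) (t := Finset.univ) (by simp)]
    refine Finset.sum_congr rfl fun b _ => ?_
    refine Finset.card_bij' (fun e _ => e.1) (fun a _ => (a, b)) ?_ ?_ ?_ ?_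
    · rintro ⟨x, y⟩ hx
      simp only [Finset.mem_filter] at hx
      obtain ⟨hx, rfl⟩ := hx
      simpa [hN] using hx
    · intro a ha
      simpa [hN] using ha
    · rintro ⟨x, y⟩ hx
      simp only [Finset.mem_filter] at hx
      simp [hx.2]
    · intro a ha
      rfl
  have hsq : ∑ b, (N b).card ^ 2 ≤ k * Fintype.card α ^ 2 + E.card := by
    have h1 : ∀ b, (N b).card ^ 2 = ∑ a, ∑ d, if a ∈ N b ∧ d ∈ N b then 1 else 0 := by
      intro b
      rw [← Fintype.sum_prod_type' (f := fun a d => if a ∈ N b ∧ d ∈ N b then 1 else 0), sq,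
        ← Finset.card_product, ← Finset.card_filter]
      congr 1
      ext p
      simp
    simp_rw [h1]
    rw [Finset.sum_comm]
    have h2 : ∀ a : α, (∑ b, ∑ d, if a ∈ N b ∧ d ∈ N b then 1 else 0) ≤
        k * Fintype.card α + ∑ b, if a ∈ N b then 1 else 0 := by
      intro a
      rw [Finset.sum_comm]
      have h3 : ∀ d : α, (∑ b, if a ∈ N b ∧ d ∈ N b then 1 else 0) ≤
          k + if d = a then ∑ b, (if a ∈ N b then 1 else 0) else 0 := by
        intro d
        by_cases hd : d = a
        · subst hd
          simp
        · rw [← Finset.card_filter]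
          simp only [hd, if_false, add_zero]
          refine h a d (fun e => hd e.symm) _ fun b hb => ?_
          simpa [hN] using hb
      refine (Finset.sum_le_sum fun d _ => h3 d).trans ?_
      rw [Finset.sum_add_distrib, Finset.sum_ite_eq' Finset.univ a]
      simp [mul_comm]
    refine (Finset.sum_le_sum fun a _ => h2 a).trans ?_
    rw [Finset.sum_add_distrib, Finset.sum_comm (γ := α), hcard]
    refine add_le_add (by simp [sq]; exact le_of_eq (by ring)) (le_of_eq ?_)
    refine Finset.sum_congr rfl fun b _ => ?_
    rw [← Finset.card_filter]
    congr 1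
    ext a
    simp
  calc E.card ^ 2 = (∑ b, (N b).card) ^ 2 := by rw [hcard]
    _ ≤ Fintype.card α * ∑ b, (N b).card ^ 2 := by
        simpa using sq_sum_le_card_mul_sum_sq (s := Finset.univ) (f := fun b => (N b).card)
    _ ≤ _ := Nat.mul_le_mul_left _ hsq

theorem IsStarColouring.sq_colourCount_le {α : Type*} [Fintype α] {c : EdgeColouring α}
    (hc : IsStarColouring c) (hK : ¬ HasRainbowCopy c K5minus) :
    colourCount c ^ 2 ≤ Fintype.card α * (3 * Fintype.card α ^ 2 + colourCount c) := by
  obtain ⟨E, hE, hcard⟩ := hc.exists_isRainbowArcSet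
  rw [← hcard]
  exact sq_card_le_of_codegree_le E 3 fun a d had T hT => hE.card_le_three hc hK had hT

theorem starAntiRamsey_K5minus_le (n : ℕ) (hn : 2 ≤ n) :
    (starAntiRamsey n K5minus : ℝ) ≤ 16 * ((n : ℝ) / 2) ^ ((3 : ℝ) / 2) := by
  set r : ℝ := ((n : ℝ) / 2) ^ ((3 : ℝ) / 2) with hr
  have hn' : (2 : ℝ) ≤ n := by exact_mod_cast hn
  have hr0 : 0 ≤ r := by positivity
  have hr2 : r ^ 2 = (n : ℝ) ^ 3 / 8 := by
    rw [hr, ← Real.rpow_natCast, ← Real.rpow_mul (by positivity)]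
    norm_num
    ring
  have hnr : (n : ℝ) ≤ 2 * r := by
    have : (n : ℝ) / 2 ≤ r := by
      conv_lhs => rw [← Real.rpow_one ((n : ℝ) / 2)]
      exact Real.rpow_le_rpow_of_exponent_le (by linarith) (by norm_num)
    linarith
  have key : starAntiRamsey n K5minus ≤ ⌊16 * r⌋₊ := by
    refine csSup_le' ?_
    rintro s ⟨c, hc, rfl, hK⟩
    refine Nat.le_floor ?_
    have h := hc.sq_colourCount_le hK
    rw [Fintype.card_fin] at h
    have h' : (colourCount c : ℝ) ^ 2 ≤ n * (3 * n ^ 2 + colourCount c) := by exact_mod_cast h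
    by_contra! hlt
    nlinarith [mul_le_mul_of_nonneg_right hnr (Nat.cast_nonneg (α := ℝ) (colourCount c))]
  exact (Nat.cast_le.2 key).trans (Nat.floor_le (by positivity))

/-- No two distinct vertices have two distinct common neighbours. -/
def SimpleGraph.IsFourCycleFree {V : Type*} (G : SimpleGraph V) : Prop :=
  ∀ a b x y : V, a ≠ b → x ≠ y → G.Adj a x → G.Adj a y → G.Adj b x → ¬ G.Adj b y

theorem card_edges_le_four_of_isFourCycleFree (H : SimpleGraph (Fin 5)) [DecidableRel H.Adj]
    (side : Fin 5 → Bool) (hside : ∀ i j, H.Adj i j → side i ≠ side j)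
    (hH : H.IsFourCycleFree) :
    (Finset.univ.filter fun p : Fin 5 × Fin 5 => p.1 < p.2 ∧ H.Adj p.1 p.2).card ≤ 4 := by
  set e : Fin 5 → Fin 5 → ℕ := fun i j => if H.Adj i j then 1 else 0 with he
  have hsymm : ∀ i j, e i j = e j i := fun i j => by simp [he, H.adj_comm]
  have hle : ∀ i j, e i j ≤ 1 := fun i j => by simp only [he]; split_ifs <;> simp
  have hzero : ∀ i j, side i = side j → e i j = 0 := fun i j hij => by
    simp only [he]
    rw [if_neg fun h => hside i j h hij]
  have hC : ∀ a b x y, a ≠ b → x ≠ y → e a x + e a y + e b x + e b y ≤ 3 := by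
    intro a b x y hab hxy
    simp only [he]
    have := hH a b x y hab hxy
    split_ifs <;> first | omega | (exfalso; tauto)
  have hsum : (Finset.univ.filter fun p : Fin 5 × Fin 5 => p.1 < p.2 ∧ H.Adj p.1 p.2).card =
      e 0 1 + e 0 2 + e 0 3 + e 0 4 + e 1 2 + e 1 3 + e 1 4 + e 2 3 + e 2 4 + e 3 4 := by
    have h1 : (Finset.univ.filter fun p : Fin 5 × Fin 5 => p.1 < p.2 ∧ H.Adj p.1 p.2).card =
        ∑ i, ∑ j, if i < j then e i j else 0 := by
      rw [Finset.card_filter, Fintype.sum_prod_type]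
      simp only [he, ite_and]
    rw [h1]
    simp [Fin.sum_univ_five]
    ring
  rw [hsum]
  have c1 := hC 0 1 2 3 (by decide) (by decide)
  have c2 := hC 0 1 2 4 (by decide) (by decide)
  have c3 := hC 0 1 3 4 (by decide) (by decide)
  have c4 := hC 0 2 1 3 (by decide) (by decide)
  have c5 := hC 0 2 1 4 (by decide) (by decide)
  have c6 := hC 0 2 3 4 (by decide) (by decide)
  have c7 := hC 0 3 1 2 (by decide) (by decide)
  have c8 := hC 0 3 1 4 (by decide) (by decide)
  have c9 := hC 0 3 2 4 (by decide) (by decide)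
  have c10 := hC 0 4 1 2 (by decide) (by decide)
  have c11 := hC 0 4 1 3 (by decide) (by decide)
  have c12 := hC 0 4 2 3 (by decide) (by decide)
  have c13 := hC 1 2 3 4 (by decide) (by decide)
  have c14 := hC 1 3 2 4 (by decide) (by decide)
  have c15 := hC 1 4 2 3 (by decide) (by decide)
  have hs : ∀ i j, i < j → e j i = e i j := fun i j _ => hsymm j i
  simp only [hs 1 2 (by decide), hs 1 3 (by decide), hs 1 4 (by decide), hs 2 3 (by decide),
    hs 2 4 (by decide), hs 3 4 (by decide)] at c1 c2 c3 c4 c5 c6 c7 c8 c9 c10 c11 c12 c13 c14 c15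
  have l01 := hle 0 1
  have l02 := hle 0 2
  have l03 := hle 0 3
  have l04 := hle 0 4
  have l12 := hle 1 2
  have l13 := hle 1 3
  have l14 := hle 1 4
  have l23 := hle 2 3
  have l24 := hle 2 4
  have l34 := hle 3 4
  have z01 := hzero 0 1
  have z02 := hzero 0 2
  have z03 := hzero 0 3
  have z04 := hzero 0 4
  have z12 := hzero 1 2
  have z13 := hzero 1 3
  have z14 := hzero 1 4
  have z23 := hzero 2 3
  have z24 := hzero 2 4
  have z34 := hzero 3 4
  clear_value e
  generalize side 0 = s0 at *
  generalize side 1 = s1 at *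
  generalize side 2 = s2 at *
  generalize side 3 = s3 at *
  generalize side 4 = s4 at *
  clear hsum hC hzero hle hsymm hside hs he
  cases s0 <;> cases s1 <;> cases s2 <;> cases s3 <;> cases s4 <;>
    simp only [forall_const, reduceCtorEq, false_implies] at z01 z02 z03 z04 z12 z13 z14 z23 z24 z34 <;>
    omega

section GraphColouring

variable {n : ℕ} (G : SimpleGraph (Fin n))

open Classical in
/-- The edges of `G` receive pairwise distinct colours, all other edges are coloured lexically. -/
noncomputable def graphColouring : EdgeColouring (Fin n) := fun e =>
  if e ∈ G.edgeSet then n + Fintype.equivFin (Sym2 (Fin n)) e else lexColouring n e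

variable {G}

theorem lexColouring_mk (a b : Fin n) : lexColouring n s(a, b) = min a.1 b.1 := rfl

theorem lexColouring_lt (a b : Fin n) : lexColouring n s(a, b) < n := by
  rw [lexColouring_mk]
  omega

theorem graphColouring_of_adj {a b : Fin n} (h : G.Adj a b) :
    graphColouring G s(a, b) = n + Fintype.equivFin (Sym2 (Fin n)) s(a, b) :=
  if_pos h

theorem graphColouring_of_not_adj {a b : Fin n} (h : ¬ G.Adj a b) :
    graphColouring G s(a, b) = lexColouring n s(a, b) :=
  if_neg h

theorem graphColouring_eq_iff {a b x y : Fin n} :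
    graphColouring G s(a, b) = graphColouring G s(x, y) ↔
      s(a, b) = s(x, y) ∨ ¬ G.Adj a b ∧ ¬ G.Adj x y ∧ min a.1 b.1 = min x.1 y.1 := by
  by_cases h1 : G.Adj a b <;> by_cases h2 : G.Adj x y
  · simp only [graphColouring_of_adj h1, graphColouring_of_adj h2, h1, not_true, false_and,
      or_false, Nat.add_left_cancel_iff, Fin.val_inj, EmbeddingLike.apply_eq_iff_eq]
  · simp only [graphColouring_of_adj h1, graphColouring_of_not_adj h2, h1, not_true, false_and,
      or_false]
    have := lexColouring_lt x y
    refine ⟨fun h => by omega, fun h => absurd ?_ h2⟩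
    rwa [← SimpleGraph.mem_edgeSet, ← h]
  · simp only [graphColouring_of_adj h2, graphColouring_of_not_adj h1, h2, not_true, false_and,
      and_false, or_false]
    have := lexColouring_lt a b
    refine ⟨fun h => by omega, fun h => absurd ?_ h1⟩
    rwa [← SimpleGraph.mem_edgeSet, h]
  · simp only [graphColouring_of_not_adj h1, graphColouring_of_not_adj h2, h1, h2, not_false_eq_true,
      true_and, lexColouring_mk]
    refine ⟨Or.inr, ?_⟩
    rintro (h | h)
    · rw [← lexColouring_mk, h, lexColouring_mk]
    · exact h

theorem isStarColouring_graphColouring : IsStarColouring (graphColouring G) := by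
  constructor
  · intro a b x y hab hxy h
    rcases graphColouring_eq_iff.1 h with h | ⟨-, -, h⟩
    · rw [Sym2.eq_iff] at h
      tauto
    · simp only [← Fin.val_inj]
      omega
  · rintro a b d hab hbd had ⟨h1, h2⟩
    rcases graphColouring_eq_iff.1 h1 with h1 | ⟨-, -, h1⟩
    · rw [Sym2.eq_iff] at h1
      tauto
    rcases graphColouring_eq_iff.1 h2 with h2 | ⟨-, -, h2⟩
    · rw [Sym2.eq_iff] at h2
      tauto
    rw [← Fin.val_ne_iff] at hab hbd had
    omega

theorem ncard_edgeSet_le_colourCount_graphColouring :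
    G.edgeSet.ncard ≤ colourCount (graphColouring G) := by
  have hinj : Set.InjOn (graphColouring G) G.edgeSet := by
    intro e he e' he' h
    induction e using Sym2.ind with
    | _ a b =>
      induction e' using Sym2.ind with
      | _ x y =>
        rcases graphColouring_eq_iff.1 h with h | ⟨h, -⟩
        · exact h
        · exact absurd he h
  rw [← Set.InjOn.ncard_image hinj]
  exact Set.ncard_le_ncard (Set.image_mono fun e he => G.not_isDiag_of_mem_edgeSet he)
    (Set.toFinite _)

theorem not_hasRainbowCopy_graphColouring (side : Fin n → Bool)
    (hside : ∀ i j, G.Adj i j → side i ≠ side j) (hG : G.IsFourCycleFree) :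
    ¬ HasRainbowCopy (graphColouring G) K5minus := by
  classical
  rintro ⟨f, hf⟩
  have hH := card_edges_le_four_of_isFourCycleFree (G.comap f) (side ∘ f)
    (fun i j h => hside _ _ h) (fun a b x y hab hxy => hG _ _ _ _ (f.injective.ne hab)
      (f.injective.ne hxy))
  obtain ⟨m, hm⟩ := Finite.exists_max f
  have hlex : ((Finset.univ.filter fun p : Fin 5 × Fin 5 => p.1 < p.2 ∧ p ≠ (0, 1)).filter
      fun p => ¬ (G.comap f).Adj p.1 p.2).card ≤ ((Finset.univ : Finset (Fin 5)).erase m).card := by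
    refine Finset.card_le_card_of_injOn (fun p => if f p.1 < f p.2 then p.1 else p.2) ?_ ?_
    · rintro ⟨i, j⟩ hp
      simp only [Finset.coe_filter, Finset.mem_filter, Finset.mem_univ, true_and,
        Set.mem_ofPred_eq] at hp
      have hij : f i ≠ f j := f.injective.ne hp.1.1.ne
      simp only [Finset.coe_erase, Set.mem_sdiff, Finset.coe_univ, Set.mem_univ, true_and,
        Set.mem_singleton_iff]
      rintro h
      split_ifs at h with h1
      · subst h
        exact absurd (hm j) (not_le.2 h1)
      · subst h
        exact h1 (lt_of_le_of_ne (hm i) hij)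
    · rintro ⟨i, j⟩ hp ⟨k, l⟩ hq h
      simp only [Finset.coe_filter, Finset.mem_filter, Finset.mem_univ, true_and,
        Set.mem_ofPred_eq, SimpleGraph.comap_adj] at hp hq
      have adj : ∀ {i j : Fin 5}, i < j → (i, j) ≠ (0, 1) → K5minus.Adj i j := by
        intro i j hij h01
        rw [K5minus_adj]
        refine ⟨hij.ne, fun h => ?_⟩
        rw [Sym2.eq_iff] at h
        rcases h with ⟨rfl, rfl⟩ | ⟨rfl, rfl⟩
        · exact h01 rfl
        · exact absurd hij (by decide)
      by_contra hne
      have hs : s(i, j) ≠ s(k, l) := fun h => by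
        rw [Sym2.eq_iff] at h
        rcases h with ⟨rfl, rfl⟩ | ⟨rfl, rfl⟩
        · exact hne rfl
        · exact absurd hp.1.1 (not_lt.2 hq.1.1.le)
      refine hf i j k l (adj hp.1.1 hp.1.2) (adj hq.1.1 hq.1.2) hs
        (graphColouring_eq_iff.2 (Or.inr ⟨hp.2, hq.2, ?_⟩))
      have hmin : ∀ i j, (f (if f i < f j then i else j)).1 = min (f i).1 (f j).1 := by
        intro i j
        split_ifs with h1 <;> rw [Fin.lt_def] at h1 <;> omega
      rw [← hmin, ← hmin]
      exact congrArg (fun t => (f t).1) h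
  have hsplit := Finset.card_filter_add_card_filter_not
    (s := Finset.univ.filter fun p : Fin 5 × Fin 5 => p.1 < p.2 ∧ p ≠ (0, 1))
    (fun p => (G.comap f).Adj p.1 p.2)
  have hnine : (Finset.univ.filter fun p : Fin 5 × Fin 5 => p.1 < p.2 ∧ p ≠ (0, 1)).card = 9 := by
    decide
  have hsub : ((Finset.univ.filter fun p : Fin 5 × Fin 5 => p.1 < p.2 ∧ p ≠ (0, 1)).filter
      fun p => (G.comap f).Adj p.1 p.2).card ≤
      (Finset.univ.filter fun p : Fin 5 × Fin 5 => p.1 < p.2 ∧ (G.comap f).Adj p.1 p.2).card := by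
    refine Finset.card_le_card fun p hp => ?_
    simp only [Finset.mem_filter, Finset.mem_univ, true_and] at hp ⊢
    exact ⟨hp.1.1, hp.2⟩
  rw [Finset.card_erase_of_mem (Finset.mem_univ m), Finset.card_univ, Fintype.card_fin] at hlex
  omega

theorem ncard_edgeSet_le_starAntiRamsey (side : Fin n → Bool)
    (hside : ∀ i j, G.Adj i j → side i ≠ side j) (hG : G.IsFourCycleFree) :
    G.edgeSet.ncard ≤ starAntiRamsey n K5minus := by
  refine ncard_edgeSet_le_colourCount_graphColouring.trans (le_csSup ?_
    ⟨graphColouring G, isStarColouring_graphColouring, rfl,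
      not_hasRainbowCopy_graphColouring side hside hG⟩)
  refine ⟨{e : Sym2 (Fin n) | ¬ e.IsDiag}.ncard, ?_⟩
  rintro s ⟨c, -, rfl, -⟩
  exact Set.ncard_image_le (Set.toFinite _)

end GraphColouring

section IncidenceGraph

variable (K : Type*) [Field K]

/-- The incidence graph of points `(x, y)` and non-vertical lines `y = a x + b`. -/
def incidenceGraph : SimpleGraph ((K × K) ⊕ (K × K)) where
  Adj
    | Sum.inl p, Sum.inr l => p.2 = l.1 * p.1 + l.2
    | Sum.inr l, Sum.inl p => p.2 = l.1 * p.1 + l.2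
    | _, _ => False
  symm := ⟨by rintro (p | l) (p' | l') h <;> exact h⟩
  loopless := ⟨by rintro (p | l) h <;> exact h⟩

variable {K}

theorem incidenceGraph_adj_inl_inr {p l : K × K} :
    (incidenceGraph K).Adj (Sum.inl p) (Sum.inr l) ↔ p.2 = l.1 * p.1 + l.2 := Iff.rfl

theorem eq_or_eq_of_mem_lines {p p' l l' : K × K} (h1 : p.2 = l.1 * p.1 + l.2)
    (h2 : p.2 = l'.1 * p.1 + l'.2) (h3 : p'.2 = l.1 * p'.1 + l.2)
    (h4 : p'.2 = l'.1 * p'.1 + l'.2) : p = p' ∨ l = l' := by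
  have h : (l.1 - l'.1) * (p.1 - p'.1) = 0 := by linear_combination h2 - h1 - h4 + h3
  rcases mul_eq_zero.1 h with h | h
  · right
    have h' := sub_eq_zero.1 h
    refine Prod.ext h' ?_
    linear_combination h2 - h1 - p.1 * h'
  · left
    have h' := sub_eq_zero.1 h
    refine Prod.ext h' ?_
    linear_combination h1 - h3 + l.1 * h'

theorem isFourCycleFree_incidenceGraph : (incidenceGraph K).IsFourCycleFree := by
  rintro (a | a) (b | b) (x | x) (y | y) hab hxy h1 h2 h3 h4 <;>
    first
    | exact h1
    | exact h2
    | exact h3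
    | (rcases eq_or_eq_of_mem_lines h1 h2 h3 h4 with h | h
       · exact hab (congrArg _ h)
       · exact hxy (congrArg _ h))
    | (rcases eq_or_eq_of_mem_lines h1 h3 h2 h4 with h | h
       · exact hxy (congrArg _ h)
       · exact hab (congrArg _ h))

theorem pow_three_le_ncard_edgeSet_map_incidenceGraph [Finite K] {V : Type*} [Finite V]
    (f : (K × K) ⊕ (K × K) ↪ V) :
    Nat.card K ^ 3 ≤ ((incidenceGraph K).map f).edgeSet.ncard := by
  have hg : Function.Injective fun t : K × K × K =>
      s(f (Sum.inl (t.1, t.2.1 * t.1 + t.2.2)), f (Sum.inr t.2)) := by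
    rintro ⟨x, a, b⟩ ⟨x', a', b'⟩ h
    simp only [Sym2.eq_iff, EmbeddingLike.apply_eq_iff_eq, Sum.inl.injEq, Sum.inr.injEq,
      Prod.mk.injEq, reduceCtorEq, false_and, or_false] at h
    obtain ⟨⟨rfl, -⟩, rfl, rfl⟩ := h
    rfl
  calc Nat.card K ^ 3 = Nat.card (K × K × K) := by simp only [Nat.card_prod]; ring
    _ = (Set.range fun t : K × K × K =>
        s(f (Sum.inl (t.1, t.2.1 * t.1 + t.2.2)), f (Sum.inr t.2))).ncard := by
      rw [← Set.image_univ, Set.ncard_image_of_injective _ hg, Set.ncard_univ]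
    _ ≤ _ := by
      refine Set.ncard_le_ncard ?_ (Set.toFinite _)
      rintro _ ⟨t, rfl⟩
      rw [SimpleGraph.mem_edgeSet, SimpleGraph.map_adj]
      exact ⟨_, _, incidenceGraph_adj_inl_inr.2 rfl, rfl, rfl⟩

end IncidenceGraph

theorem SimpleGraph.IsFourCycleFree.map {V W : Type*} {G : SimpleGraph V}
    (hG : G.IsFourCycleFree) (f : V ↪ W) : (G.map f).IsFourCycleFree := by
  intro a b x y hab hxy h1 h2 h3 h4
  rw [SimpleGraph.map_adj] at h1 h2 h3 h4
  obtain ⟨a1, x1, g1, rfl, rfl⟩ := h1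
  obtain ⟨a2, y1, g2, e1, rfl⟩ := h2
  obtain ⟨b1, x2, g3, rfl, e2⟩ := h3
  obtain ⟨b2, y2, g4, e3, e4⟩ := h4
  obtain rfl := f.injective e1
  obtain rfl := f.injective e2
  obtain rfl := f.injective e3
  obtain rfl := f.injective e4
  exact hG _ _ _ _ (fun h => hab (by rw [h])) (fun h => hxy (by rw [h])) g1 g2 g3 g4

theorem pow_three_le_starAntiRamsey {n q : ℕ} (hq : IsPrimePow q) (hn : 2 * q ^ 2 ≤ n) :
    q ^ 3 ≤ starAntiRamsey n K5minus := by
  have hq0 : 0 < q := hq.pos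
  have : Nonempty (Fin q) := ⟨⟨0, hq0⟩⟩
  obtain ⟨hK⟩ : Nonempty (Field (Fin q)) := by
    rw [Fintype.nonempty_field_iff, Fintype.card_fin]
    exact hq
  obtain ⟨K, hF, hfin, hcard⟩ : ∃ (K : Type) (_ : Field K) (_ : Fintype K), Fintype.card K = q :=
    ⟨Fin q, hK, inferInstance, Fintype.card_fin q⟩
  obtain ⟨f⟩ : Nonempty ((K × K) ⊕ (K × K) ↪ Fin n) := by
    refine Function.Embedding.nonempty_of_card_le ?_
    simp only [Fintype.card_sum, Fintype.card_prod, hcard, Fintype.card_fin]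
    nlinarith
  have h1 := pow_three_le_ncard_edgeSet_map_incidenceGraph f
  rw [Nat.card_eq_fintype_card, hcard] at h1
  classical
  refine h1.trans (ncard_edgeSet_le_starAntiRamsey
    (fun v => decide (∃ p, f (Sum.inl p) = v)) ?_ (isFourCycleFree_incidenceGraph.map f))
  intro i j hij
  rw [SimpleGraph.map_adj] at hij
  obtain ⟨u, v, huv, rfl, rfl⟩ := hij
  rcases u with u | u <;> rcases v with v | v
  · exact absurd huv id
  · simp
  · simp
  · exact absurd huv id

theorem eventually_le_starAntiRamsey {ε : ℝ} (hε : 0 < ε) : ∀ᶠ n : ℕ in Filter.atTop,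
    (1 - ε) * ((n : ℝ) / 2) ^ ((3 : ℝ) / 2) ≤ (starAntiRamsey n K5minus : ℝ) := by
  have hlim : Filter.Tendsto (fun n : ℕ => Real.log ((n : ℝ) / 2) / 2 - ε / 6) Filter.atTop
      Filter.atTop :=
    Filter.tendsto_atTop_add_const_right _ _ ((Real.tendsto_log_atTop.comp
      (tendsto_natCast_atTop_atTop.atTop_div_const two_pos)).atTop_div_const two_pos)
  filter_upwards [hlim.eventually (eventually_exists_isPrimePow_abs_log_sub_le
    (show 0 < ε / 6 by positivity)), Filter.eventually_gt_atTop 0] with n ⟨q, hq, hqn⟩ hn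
  rw [abs_le] at hqn
  have hn2 : (0 : ℝ) < (n : ℝ) / 2 := by positivity
  have hq0 : (0 : ℝ) < q := by exact_mod_cast hq.pos
  have hle : 2 * q ^ 2 ≤ n := by
    have h : (q : ℝ) ^ 2 ≤ n / 2 := by
      rw [← Real.log_le_log_iff (by positivity) hn2, Real.log_pow]
      push_cast
      linarith
    have h' : (2 : ℝ) * q ^ 2 ≤ n := by linarith
    exact_mod_cast h'
  refine le_trans ?_ (Nat.cast_le.2 (pow_three_le_starAntiRamsey hq hle))
  calc (1 - ε) * ((n : ℝ) / 2) ^ ((3 : ℝ) / 2)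
      ≤ Real.exp (-ε) * ((n : ℝ) / 2) ^ ((3 : ℝ) / 2) := by
        gcongr
        linarith [Real.add_one_le_exp (-ε)]
    _ = Real.exp (-ε + Real.log ((n : ℝ) / 2) * (3 / 2)) := by
        rw [Real.exp_add, Real.rpow_def_of_pos hn2]
    _ ≤ Real.exp (Real.log ((q : ℝ) ^ 3)) := by
        rw [Real.exp_le_exp, Real.log_pow]
        push_cast
        linarith
    _ = ((q ^ 3 : ℕ) : ℝ) := by
        rw [Real.exp_log (by positivity)]
        push_cast
        rfl

/-- For every `ε > 0` and all sufficiently large `n`,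
`(1-ε)·(n/2)^{3/2} ≤ ar*(n, K_5^-) ≤ (16+ε)·(n/2)^{3/2}`. -/
theorem starAntiRamsey_K5minus (ε : ℝ) (hε : 0 < ε) :
    ∃ n₀ : ℕ, ∀ n : ℕ, n₀ ≤ n →
      (1 - ε) * ((n : ℝ) / 2) ^ ((3 : ℝ) / 2) ≤ (starAntiRamsey n K5minus : ℝ) ∧
      (starAntiRamsey n K5minus : ℝ) ≤ (16 + ε) * ((n : ℝ) / 2) ^ ((3 : ℝ) / 2) := by
  obtain ⟨N, hN⟩ := Filter.eventually_atTop.1 (eventually_le_starAntiRamsey hε)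
  refine ⟨max N 2, fun n hn => ⟨hN n ((le_max_left _ _).trans hn), ?_⟩⟩
  refine (starAntiRamsey_K5minus_le n ((le_max_right _ _).trans hn)).trans ?_
  gcongr
  linarith
end
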